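/- arXiv:2106.09796 — 3 statements merged into one kernel-verified Lean document; each statement's English description precedes it below -/
import Mathlib

section
/- (Huneke–Koh) Let R be a regular local ring containing a field of prime characteristic p, let I be an ideal of R, and let b be the biggest height of any minimal prime of I. If j > b is an integer such that Hom_R(R/I, H^j_I(R)) is a finitely generated R-module, then H^j_I(R) = 0. -/
open CategoryTheory

section DerivedBaseChange

open Limits

set_option linter.unusedSectionVars false

variable {C D E E' : Type*} [Category* C] [Category* D] [Category* E] [Category* E']
  [Abelian C] [Abelian D] [Abelian E] [Abelian E'] [HasProjectiveResolutions C]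
  [HasProjectiveResolutions D]
  (G : C ⥤ D) [G.Additive] [G.PreservesProjectiveObjects] [G.PreservesHomology]
  (S : C ⥤ E) [S.Additive] (T : D ⥤ E') [T.Additive]
  (G' : E ⥤ E') [G'.Additive] [G'.PreservesHomology]
  (τ : G ⋙ T ⟶ S ⋙ G')

/-- The comparison of complexes induced by a transformation `G ⋙ T ⟶ S ⋙ G'`. -/
noncomputable def complexComparison (K : ChainComplex C ℕ) :
    (T.mapHomologicalComplex _).obj ((G.mapHomologicalComplex _).obj K) ⟶
      (G'.mapHomologicalComplex _).obj ((S.mapHomologicalComplex _).obj K) where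
  f i := τ.app (K.X i)
  comm' i j _ := (τ.naturality (K.d i j)).symm

lemma complexComparison_isIso (K : ChainComplex C ℕ) (h : ∀ i, IsIso (τ.app (K.X i))) :
    IsIso (complexComparison G S T G' τ K) := by
  have : ∀ i, IsIso ((complexComparison G S T G' τ K).f i) := h
  exact HomologicalComplex.Hom.isIso_of_components _

lemma complexComparison_naturality {K K' : ChainComplex C ℕ} (φ : K ⟶ K') :
    (T.mapHomologicalComplex _).map ((G.mapHomologicalComplex _).map φ) ≫
      complexComparison G S T G' τ K' =
    complexComparison G S T G' τ K ≫
      (G'.mapHomologicalComplex _).map ((S.mapHomologicalComplex _).map φ) := by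
  ext i
  exact τ.naturality (φ.f i)

/-- Deriving after an exact functor preserving projectives. -/
noncomputable def isoLeftDerivedMapObj (n : ℕ) {X : C} (P : ProjectiveResolution X) :
    (T.leftDerived n).obj (G.obj X) ≅
      ((T.mapHomologicalComplex _).obj ((G.mapHomologicalComplex _).obj P.complex)).homology n :=
  (G.mapProjectiveResolution P).isoLeftDerivedObj T n

lemma isoLeftDerivedMapObj_hom_naturality (n : ℕ) {X Y : C} (f : X ⟶ Y)
    (P : ProjectiveResolution X) (Q : ProjectiveResolution Y)
    (φ : P.complex ⟶ Q.complex) (hφ : φ.f 0 ≫ Q.π.f 0 = P.π.f 0 ≫ f) :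
    (T.leftDerived n).map (G.map f) ≫ (isoLeftDerivedMapObj G T n Q).hom =
      (isoLeftDerivedMapObj G T n P).hom ≫ HomologicalComplex.homologyMap
        ((T.mapHomologicalComplex _).map ((G.mapHomologicalComplex _).map φ)) n := by
  refine ProjectiveResolution.isoLeftDerivedObj_hom_naturality (G.map f)
    (G.mapProjectiveResolution P) (G.mapProjectiveResolution Q)
    ((G.mapHomologicalComplex _).map φ) ?_ T n
  have h : ∀ {Z : C} (R : ProjectiveResolution Z), (G.mapProjectiveResolution R).π.f 0 =
      G.map (R.π.f 0) := fun {Z} R => by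
    have : ((HomologicalComplex.singleMapHomologicalComplex G
        (ComplexShape.down ℕ) 0).hom.app Z).f 0 = 𝟙 (G.obj Z) := by
      simp; rfl
    refine (congr(G.map (R.π.f 0) ≫ $this)).trans ?_
    exact Category.comp_id (G.map (R.π.f 0))
  rw [h, h]
  exact (G.map_comp _ _).symm.trans ((congr(G.map $hφ)).trans (G.map_comp _ _))

/-- Deriving before an exact functor. -/
noncomputable def isoMapLeftDerivedObj (n : ℕ) {X : C} (P : ProjectiveResolution X) :
    ((G'.mapHomologicalComplex _).obj ((S.mapHomologicalComplex _).obj P.complex)).homology n ≅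
      G'.obj ((S.leftDerived n).obj X) :=
  (((S.mapHomologicalComplex _).obj P.complex).sc n).mapHomologyIso G' ≪≫
    G'.mapIso (P.isoLeftDerivedObj S n).symm

lemma isoMapLeftDerivedObj_hom_naturality (n : ℕ) {X Y : C} (f : X ⟶ Y)
    (P : ProjectiveResolution X) (Q : ProjectiveResolution Y)
    (φ : P.complex ⟶ Q.complex) (hφ : φ.f 0 ≫ Q.π.f 0 = P.π.f 0 ≫ f) :
    HomologicalComplex.homologyMap
        ((G'.mapHomologicalComplex _).map ((S.mapHomologicalComplex _).map φ)) n ≫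
      (isoMapLeftDerivedObj S G' n Q).hom =
    (isoMapLeftDerivedObj S G' n P).hom ≫ G'.map ((S.leftDerived n).map f) := by
  have h1 := ShortComplex.mapHomologyIso_hom_naturality
    ((HomologicalComplex.shortComplexFunctor _ _ n).map ((S.mapHomologicalComplex _).map φ)) G'
  have h2 := congr(G'.map
    $(ProjectiveResolution.isoLeftDerivedObj_inv_naturality f P Q φ hφ S n))
  rw [G'.map_comp, G'.map_comp] at h2
  refine (Category.assoc _ _ _).symm.trans ?_
  refine (congr($h1 ≫ _)).trans ((Category.assoc _ _ _).trans ?_)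
  refine (congr(_ ≫ $h2.symm)).trans (Category.assoc _ _ _).symm

/-- Left derived functors and exact functors. -/
noncomputable def leftDerivedComparison (n : ℕ) {X : C} (P : ProjectiveResolution X) :
    (T.leftDerived n).obj (G.obj X) ⟶ G'.obj ((S.leftDerived n).obj X) :=
  (isoLeftDerivedMapObj G T n P).hom ≫
    HomologicalComplex.homologyMap (complexComparison G S T G' τ P.complex) n ≫
    (isoMapLeftDerivedObj S G' n P).hom

lemma leftDerivedComparison_isIso (n : ℕ) {X : C} (P : ProjectiveResolution X)
    (h : ∀ i, IsIso (τ.app (P.complex.X i))) :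
    IsIso (leftDerivedComparison G S T G' τ n P) := by
  have := complexComparison_isIso G S T G' τ P.complex h
  have : IsIso (HomologicalComplex.homologyMap (complexComparison G S T G' τ P.complex) n) :=
    inferInstanceAs (IsIso ((HomologicalComplex.homologyFunctor _ _ n).map _))
  unfold leftDerivedComparison
  infer_instance

lemma leftDerivedComparison_naturality (n : ℕ) {X Y : C} (f : X ⟶ Y)
    (P : ProjectiveResolution X) (Q : ProjectiveResolution Y) :
    (T.leftDerived n).map (G.map f) ≫ leftDerivedComparison G S T G' τ n Q =
      leftDerivedComparison G S T G' τ n P ≫ G'.map ((S.leftDerived n).map f) := by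
  let φ := ProjectiveResolution.lift f P Q
  have hφ : φ.f 0 ≫ Q.π.f 0 = P.π.f 0 ≫ f := by
    have := congr($(ProjectiveResolution.lift_commutes f P Q).f 0)
    rw [HomologicalComplex.comp_f, HomologicalComplex.comp_f] at this
    refine this.trans ?_
    rw [ChainComplex.single₀_map_f_zero]; rfl
  have h1 := isoLeftDerivedMapObj_hom_naturality G T n f P Q φ hφ
  have h2 := congr(HomologicalComplex.homologyMap $(complexComparison_naturality G S T G' τ φ) n)
  have h3 := isoMapLeftDerivedObj_hom_naturality S G' n f P Q φ hφ
  rw [HomologicalComplex.homologyMap_comp, HomologicalComplex.homologyMap_comp] at h2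
  unfold leftDerivedComparison
  rw [reassoc_of% h1, reassoc_of% h2, h3]
  simp only [Category.assoc]

end DerivedBaseChange

section BaseChangeFunctor

open TensorProduct Limits

universe u

variable (A B : Type u) [CommRing A] [CommRing B] [Algebra A B]

/-- Base change of modules as a functor. -/
noncomputable def baseChangeFunctor : ModuleCat.{u} A ⥤ ModuleCat.{u} B where
  obj M := ModuleCat.of B (B ⊗[A] M)
  map g := ModuleCat.ofHom (g.hom.baseChange B)
  map_id M := by ext x; simp
  map_comp f g := by ext x; simp [LinearMap.baseChange_comp]

@[simp]
lemma baseChangeFunctor_map_hom {M N : ModuleCat.{u} A} (g : M ⟶ N) :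
    ((baseChangeFunctor A B).map g).hom = g.hom.baseChange B := rfl

instance : (baseChangeFunctor A B).Additive where
  map_add {M N f g} := by
    ext x
    exact congr($(LinearMap.baseChange_add (A := B) f.hom g.hom) x)

/-- The hom-set bijection of the base change adjunction. -/
noncomputable def baseChangeHomEquiv (M : ModuleCat.{u} A) (N : ModuleCat.{u} B) :
    ((baseChangeFunctor A B).obj M ⟶ N) ≃
      (M ⟶ (ModuleCat.restrictScalars (algebraMap A B)).obj N) :=
  letI : Module A N := Module.compHom N (algebraMap A B)
  haveI : IsScalarTower A B N := ⟨fun a b n => by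
    rw [Algebra.smul_def, mul_smul]; rfl⟩
  ModuleCat.homEquiv.trans ((LinearMap.liftBaseChangeEquiv (R := A) (M := M) (N := N)
    B).symm.toEquiv.trans (ModuleCat.homEquiv (M := M)
      (N := (ModuleCat.restrictScalars (algebraMap A B)).obj N)).symm)

/-- Base change is left adjoint to restriction of scalars. -/
noncomputable def baseChangeAdjunction :
    baseChangeFunctor A B ⊣ ModuleCat.restrictScalars (algebraMap A B) :=
  Adjunction.mkOfHomEquiv
    { homEquiv := baseChangeHomEquiv A B
      homEquiv_naturality_left_symm f g := by
        ext x
        refine TensorProduct.induction_on x ?_ (fun b x => rfl) fun x y hx hy => ?_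
        · exact (map_zero _).trans (map_zero _).symm
        · exact (map_add _ _ _).trans (congr($hx + $hy).trans (map_add _ _ _).symm)
      homEquiv_naturality_right f g := by
        ext x
        rfl }

instance : (baseChangeFunctor A B).IsLeftAdjoint := (baseChangeAdjunction A B).isLeftAdjoint

instance : PreservesColimits (baseChangeFunctor A B) :=
  (baseChangeAdjunction A B).leftAdjoint_preservesColimits

instance : (ModuleCat.restrictScalars.{u} (algebraMap A B)).PreservesEpimorphisms where
  preserves f hf := by
    rw [ModuleCat.epi_iff_surjective] at hf ⊢
    exact hf

instance : (baseChangeFunctor A B).PreservesProjectiveObjects :=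
  Functor.preservesProjectiveObjects_of_adjunction_of_preservesEpimorphisms
    (baseChangeAdjunction A B)

instance [Module.Flat A B] : (baseChangeFunctor A B).PreservesMonomorphisms where
  preserves f hf := by
    rw [ModuleCat.mono_iff_injective] at hf ⊢
    exact Module.Flat.lTensor_preserves_injective_linearMap (M := B) f.hom hf

instance [Module.Flat A B] : (baseChangeFunctor A B).PreservesHomology :=
  Functor.preservesHomology_of_preservesMonos_and_cokernels _

instance [Module.Flat A B] : (baseChangeFunctor A B).op.PreservesHomology := by
  have : PreservesFiniteLimits (baseChangeFunctor A B) :=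
    Functor.preservesFiniteLimits_of_preservesHomology _
  have := preservesFiniteColimits_op (baseChangeFunctor A B)
  have := preservesFiniteLimits_op (baseChangeFunctor A B)
  infer_instance

variable {A} in
/-- The comparison `B ⊗ Hom(X, A) → Hom(B ⊗ X, B)`. -/
noncomputable def homBaseChangeApp (X : ModuleCat.{u} A) :
    B ⊗[A] (X ⟶ ModuleCat.of A A) →ₗ[B]
      ((baseChangeFunctor A B).obj X ⟶ ModuleCat.of B B) :=
  (ModuleCat.homLinearEquiv (S := B)
    (M := (baseChangeFunctor A B).obj X) (N := ModuleCat.of B B)).symm.toLinearMap ∘ₗ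
  (IsBaseChange.linearMapLeftRightHom (TensorProduct.isBaseChange A X B)
    (Algebra.linearMap A B)).liftBaseChange B ∘ₗ
  ((ModuleCat.homLinearEquiv (S := A)).toLinearMap.baseChange B)

variable {A B} in
lemma homBaseChangeApp_tmul (X : ModuleCat.{u} A) (b : B) (φ : X ⟶ ModuleCat.of A A) (b' : B)
    (x : X) :
    (homBaseChangeApp B X (b ⊗ₜ φ)).hom (b' ⊗ₜ[A] x) = b * b' * algebraMap A B (φ.hom x) := by
  have h : (b' ⊗ₜ[A] x : B ⊗[A] X) = b' • (TensorProduct.mk A B X 1 x) := by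
    simp [TensorProduct.smul_tmul']
  have := IsBaseChange.linearMapLeftRightHom_comp_apply (TensorProduct.isBaseChange A X B)
    (Algebra.linearMap A B) φ.hom x
  rw [h]
  refine (map_smul _ _ _).trans ?_
  have h2 : (homBaseChangeApp B X (b ⊗ₜ φ)).hom = b • IsBaseChange.linearMapLeftRightHom
    (TensorProduct.isBaseChange A X B) (Algebra.linearMap A B) φ.hom := rfl
  rw [h2]
  refine (congr(b' • (b • $this))).trans ?_
  change b' * (b * algebraMap A B (φ.hom x)) = _
  ring

lemma homBaseChangeApp_bijective (X : ModuleCat.{u} A) [Module.Free A X] [Module.Finite A X] :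
    Function.Bijective (homBaseChangeApp B X) := by
  have h := IsBaseChange.linearMapLeftRight (TensorProduct.isBaseChange A X B)
    (IsBaseChange.linearMap A B)
  have h2 : (IsBaseChange.linearMapLeftRightHom (TensorProduct.isBaseChange A X B)
    (Algebra.linearMap A B)).liftBaseChange B = h.equiv.toLinearMap := by
    ext; simp
  unfold homBaseChangeApp
  rw [h2]
  exact (ModuleCat.homLinearEquiv (S := B)
    (M := (baseChangeFunctor A B).obj X) (N := ModuleCat.of B B)).symm.bijective.comp
    (h.equiv.bijective.comp
      (((ModuleCat.homLinearEquiv (S := A) (M := X) (N := ModuleCat.of A A)).baseChange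
        A B _ _).bijective))

/-- The comparison `B ⊗ Hom(X, A) → Hom(B ⊗ X, B)` as a natural transformation. -/
noncomputable def homBaseChange :
    baseChangeFunctor A B ⋙ ((linearYoneda B (ModuleCat.{u} B)).obj (ModuleCat.of B B)).rightOp ⟶
      ((linearYoneda A (ModuleCat.{u} A)).obj (ModuleCat.of A A)).rightOp ⋙
        (baseChangeFunctor A B).op where
  app X := Quiver.Hom.op (ModuleCat.ofHom (homBaseChangeApp B X))
  naturality X Y f := by
    apply Quiver.Hom.unop_inj
    ext x
    refine TensorProduct.induction_on x ?_ (fun b φ => ?_) fun x y hx hy => ?_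
    · exact (map_zero _).trans (map_zero _).symm
    · apply ModuleCat.hom_ext
      apply LinearMap.ext
      intro z
      refine TensorProduct.induction_on z ?_ (fun b' z => ?_) fun x y hx hy => ?_
      · exact (map_zero _).trans (map_zero _).symm
      · exact (homBaseChangeApp_tmul Y b φ b' (f.hom z)).trans
          (homBaseChangeApp_tmul X b (f ≫ φ) b' z).symm
      · exact (map_add _ _ _).trans (congr($hx + $hy).trans (map_add _ _ _).symm)
    · exact (map_add _ _ _).trans (congr($hx + $hy).trans (map_add _ _ _).symm)

lemma homBaseChange_app_isIso (X : ModuleCat.{u} A) [Module.Free A X] [Module.Finite A X] :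
    IsIso ((homBaseChange A B).app X) := by
  have : IsIso (ModuleCat.ofHom (homBaseChangeApp B X)) :=
    (ConcreteCategory.isIso_iff_bijective _).mpr (homBaseChangeApp_bijective A B X)
  exact inferInstanceAs (IsIso (Quiver.Hom.op (ModuleCat.ofHom (homBaseChangeApp B X))))

end BaseChangeFunctor

section FiniteResolution

open Limits

universe u

variable (A : Type u) [CommRing A]

lemma exists_epi_from_fin (X : FGModuleCat.{u} A) :
    ∃ (n : ℕ) (f : FGModuleCat.of A (Fin n → A) ⟶ X), Function.Surjective f.hom.hom := by
  obtain ⟨n, f, hf⟩ := Module.Finite.exists_fin' A X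
  exact ⟨n, FGModuleCat.ofHom f, hf⟩

variable [IsNoetherianRing A]

instance (n : ℕ) : Projective (FGModuleCat.of A (Fin n → A)) where
  factors {E X} f e he := by
    have h : Epi ((forget₂ (FGModuleCat A) (ModuleCat A)).map e) := inferInstance
    rw [ModuleCat.epi_iff_surjective] at h
    obtain ⟨g, hg⟩ := Module.projective_lifting_property e.hom.hom f.hom.hom h
    exact ⟨FGModuleCat.ofHom g, by
      apply ConcreteCategory.hom_ext; intro x; exact congr($hg x)⟩

instance : EnoughProjectives (FGModuleCat.{u} A) where
  presentation X := by
    obtain ⟨n, f, hf⟩ := exists_epi_from_fin A X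
    have : Epi f := ConcreteCategory.epi_of_surjective _ hf
    exact ⟨{ p := _, projective := inferInstance, f := f, epi := this }⟩

instance : (forget₂ (FGModuleCat.{u} A) (ModuleCat.{u} A)).PreservesProjectiveObjects where
  projective_obj {X} hX := by
    obtain ⟨n, f, hf⟩ := exists_epi_from_fin A X
    have : Epi f := ConcreteCategory.epi_of_surjective _ hf
    have : Module.Projective A X := by
      refine Module.Projective.of_split (M := Fin n → A) (Projective.factorThru (𝟙 X) f).hom.hom
        f.hom.hom ?_
      have := Projective.factorThru_comp (𝟙 X) f
      ext x
      exact congr($(this).hom.hom x)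
    exact (IsProjective.iff_projective (R := A) (P := X)).mp this

/-- A finitely generated module over a noetherian ring has a resolution by finitely generated
projective modules. -/
lemma exists_finite_projectiveResolution (X : ModuleCat.{u} A) [Module.Finite A X] :
    ∃ P : ProjectiveResolution X, ∀ i, Module.Finite A (P.complex.X i) := by
  let Q := projectiveResolution (FGModuleCat.of A X)
  exact ⟨(forget₂ (FGModuleCat.{u} A) (ModuleCat.{u} A)).mapProjectiveResolution Q,
    fun i => inferInstanceAs (Module.Finite A (Q.complex.X i))⟩

end FiniteResolution

section LocalCohomologyBaseChange

open Limits TensorProduct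

universe u

section Quotient

variable {A : Type u} (B : Type u) [CommRing A] [CommRing B] [Algebra A B]

lemma exists_quotient_baseChange_iso (I : Ideal A) (K : Ideal B)
    (hK : K = I.map (algebraMap A B)) :
    ∃ e : ModuleCat.of B (B ⧸ K) ≅ (baseChangeFunctor A B).obj (ModuleCat.of A (A ⧸ I)),
      ∀ b : B, e.hom.hom (Ideal.Quotient.mk K b) = b ⊗ₜ[A] (1 : A ⧸ I) := by
  subst hK
  refine ⟨(Algebra.TensorProduct.quotIdealMapEquivTensorQuot B I).toLinearEquiv.toModuleIso,
    fun b => ?_⟩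
  exact Algebra.TensorProduct.quotIdealMapEquivTensorQuot_mk _ _ _

/-- Base change of the quotient by a power of an ideal. -/
noncomputable def quotientPowBaseChangeIso (I : Ideal A) (t : ℕ) :
    ModuleCat.of B (B ⧸ (I.map (algebraMap A B)) ^ t) ≅
      (baseChangeFunctor A B).obj (ModuleCat.of A (A ⧸ I ^ t)) :=
  (exists_quotient_baseChange_iso B (I ^ t) ((I.map (algebraMap A B)) ^ t)
    (Ideal.map_pow _ _ _).symm).choose

lemma quotientPowBaseChangeIso_hom_mk (I : Ideal A) (t : ℕ) (b : B) :
    (quotientPowBaseChangeIso B I t).hom.hom (Ideal.Quotient.mk _ b) =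
      b ⊗ₜ[A] (1 : A ⧸ I ^ t) :=
  (exists_quotient_baseChange_iso B (I ^ t) ((I.map (algebraMap A B)) ^ t)
    (Ideal.map_pow _ _ _).symm).choose_spec b

lemma quotientPowBaseChangeIso_naturality (I : Ideal A) {s t : ℕᵒᵖ} (f : s ⟶ t) :
    (localCohomology.ringModIdeals (localCohomology.idealPowersDiagram
        (I.map (algebraMap A B)))).map f ≫ (quotientPowBaseChangeIso B I t.unop).hom =
      (quotientPowBaseChangeIso B I s.unop).hom ≫ (baseChangeFunctor A B).map
        ((localCohomology.ringModIdeals (localCohomology.idealPowersDiagram I)).map f) := by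
  apply ConcreteCategory.hom_ext
  intro x
  obtain ⟨b, rfl⟩ := Ideal.Quotient.mk_surjective x
  refine (quotientPowBaseChangeIso_hom_mk B I t.unop b).trans ?_
  exact congr((baseChangeFunctor A B).map
    ((localCohomology.ringModIdeals (localCohomology.idealPowersDiagram I)).map f)
      $(quotientPowBaseChangeIso_hom_mk B I s.unop b)).symm

end Quotient

set_option linter.unusedSectionVars false

variable (A B : Type u) [CommRing A] [IsNoetherianRing A] [IsLocalRing A] [CommRing B]
  [Algebra A B] [Module.Flat A B]

/-- A chosen resolution by finitely generated projective modules. -/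
noncomputable def finiteProjectiveResolution (X : ModuleCat.{u} A) [Module.Finite A X] :
    ProjectiveResolution X :=
  (exists_finite_projectiveResolution A X).choose

lemma homBaseChange_isIso_finiteProjectiveResolution (X : ModuleCat.{u} A) [Module.Finite A X]
    (i : ℕ) : IsIso ((homBaseChange A B).app ((finiteProjectiveResolution A X).complex.X i)) := by
  have h1 : Module.Finite A ((finiteProjectiveResolution A X).complex.X i) :=
    (exists_finite_projectiveResolution A X).choose_spec i
  have h2 : Module.Projective A ((finiteProjectiveResolution A X).complex.X i) :=
    (IsProjective.iff_projective (R := A) _).mpr ((finiteProjectiveResolution A X).projective i)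
  have h3 : Module.Free A ((finiteProjectiveResolution A X).complex.X i) :=
    Module.free_of_flat_of_isLocalRing
  exact homBaseChange_app_isIso A B _

/-- The base change map for `Ext`. -/
noncomputable def extBaseChange (n : ℕ) (X : ModuleCat.{u} A) [Module.Finite A X] :
    (baseChangeFunctor A B).obj
      (((Ext A (ModuleCat.{u} A) n).obj (Opposite.op X)).obj (ModuleCat.of A A)) ⟶
    ((Ext B (ModuleCat.{u} B) n).obj (Opposite.op ((baseChangeFunctor A B).obj X))).obj
      (ModuleCat.of B B) :=
  (leftDerivedComparison (baseChangeFunctor A B)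
    ((linearYoneda A (ModuleCat.{u} A)).obj (ModuleCat.of A A)).rightOp
    ((linearYoneda B (ModuleCat.{u} B)).obj (ModuleCat.of B B)).rightOp
    (baseChangeFunctor A B).op (homBaseChange A B) n (finiteProjectiveResolution A X)).unop

instance extBaseChange_isIso (n : ℕ) (X : ModuleCat.{u} A) [Module.Finite A X] :
    IsIso (extBaseChange A B n X) := by
  have := leftDerivedComparison_isIso (baseChangeFunctor A B)
    ((linearYoneda A (ModuleCat.{u} A)).obj (ModuleCat.of A A)).rightOp
    ((linearYoneda B (ModuleCat.{u} B)).obj (ModuleCat.of B B)).rightOp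
    (baseChangeFunctor A B).op (homBaseChange A B) n (finiteProjectiveResolution A X)
    (homBaseChange_isIso_finiteProjectiveResolution A B X)
  exact isIso_unop _

lemma extBaseChange_naturality (n : ℕ) {X Y : ModuleCat.{u} A} [Module.Finite A X]
    [Module.Finite A Y] (f : X ⟶ Y) :
    (baseChangeFunctor A B).map
      (((Ext A (ModuleCat.{u} A) n).map f.op).app (ModuleCat.of A A)) ≫ extBaseChange A B n X =
    extBaseChange A B n Y ≫
      ((Ext B (ModuleCat.{u} B) n).map ((baseChangeFunctor A B).map f).op).app
        (ModuleCat.of B B) :=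
  congr(($(leftDerivedComparison_naturality (baseChangeFunctor A B)
    ((linearYoneda A (ModuleCat.{u} A)).obj (ModuleCat.of A A)).rightOp
    ((linearYoneda B (ModuleCat.{u} B)).obj (ModuleCat.of B B)).rightOp
    (baseChangeFunctor A B).op (homBaseChange A B) n f (finiteProjectiveResolution A X)
    (finiteProjectiveResolution A Y))).unop).symm

variable {A B}

/-- Base change for `Ext`, with a prescribed model of the base change of the first argument. -/
noncomputable def extBaseChangeIso (n : ℕ) {X : ModuleCat.{u} A} [Module.Finite A X]
    {X' : ModuleCat.{u} B} (e : X' ≅ (baseChangeFunctor A B).obj X) :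
    (baseChangeFunctor A B).obj
      (((Ext A (ModuleCat.{u} A) n).obj (Opposite.op X)).obj (ModuleCat.of A A)) ≅
    ((Ext B (ModuleCat.{u} B) n).obj (Opposite.op X')).obj (ModuleCat.of B B) :=
  asIso (extBaseChange A B n X) ≪≫
    ((Ext B (ModuleCat.{u} B) n).mapIso e.op).app (ModuleCat.of B B)

lemma extBaseChangeIso_naturality (n : ℕ) {X Y : ModuleCat.{u} A} [Module.Finite A X]
    [Module.Finite A Y] {X' Y' : ModuleCat.{u} B} (eX : X' ≅ (baseChangeFunctor A B).obj X)
    (eY : Y' ≅ (baseChangeFunctor A B).obj Y) (f : X ⟶ Y) (g : X' ⟶ Y')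
    (h : g ≫ eY.hom = eX.hom ≫ (baseChangeFunctor A B).map f) :
    (baseChangeFunctor A B).map
      (((Ext A (ModuleCat.{u} A) n).map f.op).app (ModuleCat.of A A)) ≫
        (extBaseChangeIso n eX).hom =
    (extBaseChangeIso n eY).hom ≫
      ((Ext B (ModuleCat.{u} B) n).map g.op).app (ModuleCat.of B B) := by
  have h1 := extBaseChange_naturality A B n f
  have h2 : ((Ext B (ModuleCat.{u} B) n).map ((baseChangeFunctor A B).map f).op).app
        (ModuleCat.of B B) ≫ ((Ext B (ModuleCat.{u} B) n).map eX.hom.op).app (ModuleCat.of B B) =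
      ((Ext B (ModuleCat.{u} B) n).map eY.hom.op).app (ModuleCat.of B B) ≫
        ((Ext B (ModuleCat.{u} B) n).map g.op).app (ModuleCat.of B B) := by
    rw [← NatTrans.comp_app, ← NatTrans.comp_app, ← Functor.map_comp, ← Functor.map_comp,
      ← op_comp, ← op_comp, h]
  refine (Category.assoc _ _ _).symm.trans ?_
  refine (congr($h1 ≫ _)).trans ((Category.assoc _ _ _).trans ?_)
  exact (congr(_ ≫ $h2)).trans (Category.assoc _ _ _).symm

variable (B)

instance (I : Ideal A) (t : ℕᵒᵖ) : Module.Finite A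
    ((localCohomology.ringModIdeals (localCohomology.idealPowersDiagram I)).obj t) :=
  inferInstanceAs (Module.Finite A (A ⧸ I ^ t.unop))

/-- Base change of the diagram computing local cohomology. -/
noncomputable def localCohomologyDiagramBaseChange (I : Ideal A) (j : ℕ) :
    (localCohomology.diagram (localCohomology.idealPowersDiagram I) j ⋙
      (evaluation _ _).obj (ModuleCat.of A A)) ⋙ baseChangeFunctor A B ≅
    localCohomology.diagram (localCohomology.idealPowersDiagram (I.map (algebraMap A B))) j ⋙
      (evaluation _ _).obj (ModuleCat.of B B) :=
  NatIso.ofComponents (fun t => extBaseChangeIso j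
      (X := (localCohomology.ringModIdeals (localCohomology.idealPowersDiagram I)).obj t.unop)
      (quotientPowBaseChangeIso B I t.unop.unop))
    (fun f => extBaseChangeIso_naturality j _ _ _ _
      (quotientPowBaseChangeIso_naturality B I f.unop))

/-- Local cohomology commutes with flat base change. -/
noncomputable def localCohomologyBaseChange (I : Ideal A) (j : ℕ) :
    (baseChangeFunctor A B).obj ((localCohomology I j).obj (ModuleCat.of A A)) ≅
      (localCohomology (I.map (algebraMap A B)) j).obj (ModuleCat.of B B) :=
  (baseChangeFunctor A B).mapIso (colimitObjIsoColimitCompEvaluation _ _) ≪≫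
    preservesColimitIso (baseChangeFunctor A B) _ ≪≫
    HasColimit.isoOfNatIso (localCohomologyDiagramBaseChange B I j) ≪≫
    (colimitObjIsoColimitCompEvaluation _ _).symm

/-- Local cohomology commutes with flat base change. -/
noncomputable def localCohomologyBaseChangeEquiv (I : Ideal A) (j : ℕ) :
    B ⊗[A] ((localCohomology I j).obj (ModuleCat.of A A)) ≃ₗ[B]
      (localCohomology (I.map (algebraMap A B)) j).obj (ModuleCat.of B B) :=
  (localCohomologyBaseChange B I j).toLinearEquiv

end LocalCohomologyBaseChange

section RegularLocal

open IsLocalRing RingTheory.Sequence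

open scoped Pointwise

lemma exists_mem_maximalIdeal_notMem_sq_notMem_minimalPrimes {R : Type*} [CommRing R]
    [IsNoetherianRing R] [IsLocalRing R] (h : ringKrullDim R ≠ 0) :
    ∃ x ∈ maximalIdeal R, x ∉ maximalIdeal R ^ 2 ∧ ∀ P ∈ minimalPrimes R, x ∉ P := by
  classical
  have hmin : maximalIdeal R ∉ minimalPrimes R := fun h' => h <| by
    rw [← maximalIdeal_height_eq_ringKrullDim, Ideal.height_eq_zero_iff.mpr h']
    rfl
  by_contra! hc
  let T : Finset (Ideal R) :=
    insert (maximalIdeal R ^ 2) (minimalPrimes.finite_of_isNoetherianRing R).toFinset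
  have hsub : (maximalIdeal R : Set R) ⊆ ⋃ i ∈ (↑T : Set (Ideal R)), (id i : Ideal R) := by
    intro x hx
    by_cases hx2 : x ∈ maximalIdeal R ^ 2
    · exact Set.mem_biUnion (x := maximalIdeal R ^ 2) (by simp [T]) hx2
    · obtain ⟨P, hP, hxP⟩ := hc x hx hx2
      exact Set.mem_biUnion (x := P) (by simp [T, hP]) hxP
  obtain ⟨P, hP, hle⟩ := (Ideal.subset_union_prime (maximalIdeal R ^ 2) (maximalIdeal R ^ 2)
    (fun i hi h1 _ => by
      simp only [T, Finset.mem_insert, h1, Set.Finite.mem_toFinset, false_or] at hi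
      exact hi.1.1)).mp hsub
  simp only [T, Finset.mem_insert, Set.Finite.mem_toFinset, id] at hP hle
  obtain rfl | hP := hP
  · have hbot : maximalIdeal R = ⊥ :=
      Submodule.eq_bot_of_le_smul_of_le_jacobson_bot (maximalIdeal R) _
        (IsNoetherian.noetherian _) (by rwa [smul_eq_mul, ← sq]) (maximalIdeal_le_jacobson _)
    apply hmin
    exact ⟨⟨inferInstance, bot_le⟩, fun q _ _ => hbot ▸ bot_le⟩
  · have : P.IsPrime := hP.1.1
    exact hmin (le_antisymm hle (le_maximalIdeal this.ne_top) ▸ hP)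

lemma exists_finset_span_eq_maximalIdeal_quotient {R : Type*} [CommRing R] [IsLocalRing R]
    {s : Finset R} (hs : Ideal.span (s : Set R) = maximalIdeal R) {n : ℕ} (hn : s.card ≤ n + 1)
    {x : R} (hx : x ∈ maximalIdeal R) (hx2 : x ∉ maximalIdeal R ^ 2) :
    ∃ t : Finset (R ⧸ Ideal.span {x}),
      Ideal.span (t : Set _) = (maximalIdeal R).map (Ideal.Quotient.mk (Ideal.span {x})) ∧
        t.card ≤ n := by
  classical
  rw [← hs] at hx
  obtain ⟨a, ha⟩ := Submodule.mem_span_finset'.mp hx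
  have hunit : ∃ i, IsUnit (a i) := by
    by_contra! hc
    apply hx2
    rw [← ha, sq]
    refine Ideal.sum_mem _ fun i _ => Ideal.mul_mem_mul ((mem_maximalIdeal _).mpr (hc i)) ?_
    exact hs ▸ Ideal.subset_span i.2
  obtain ⟨i, u, hu⟩ := hunit
  refine ⟨(s.erase i).image (Ideal.Quotient.mk _), ?_, ?_⟩
  · rw [Finset.coe_image, ← Ideal.map_span, ← hs]
    refine le_antisymm (Ideal.map_mono (Ideal.span_mono (by simp))) ?_
    rw [Ideal.map_span, Ideal.span_le]
    rintro _ ⟨y, hy, rfl⟩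
    by_cases hyi : y = i
    · subst hyi
      rw [← Finset.add_sum_erase _ _ (Finset.mem_univ i), ← hu] at ha
      have hy : Ideal.Quotient.mk (Ideal.span {x}) i.1 =
          Ideal.Quotient.mk _ (-(↑u⁻¹ * ∑ j ∈ Finset.univ.erase i, a j • j.1)) := by
        rw [Ideal.Quotient.eq, Ideal.mem_span_singleton]
        refine ⟨↑u⁻¹, ?_⟩
        rw [← ha, smul_eq_mul, add_mul, mul_right_comm, Units.mul_inv]
        ring
      rw [hy]
      refine Ideal.mem_map_of_mem _ (neg_mem (Ideal.mul_mem_left _ _ (Ideal.sum_mem _ ?_)))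
      intro j hj
      refine Ideal.mul_mem_left _ _ (Ideal.subset_span ?_)
      simp only [Finset.coe_erase, Set.mem_sdiff, Finset.mem_coe, j.2, true_and,
        Set.mem_singleton_iff]
      exact fun h => (Finset.mem_erase.mp hj).1 (Subtype.ext h)
    · exact Ideal.mem_map_of_mem _ (Ideal.subset_span (by simp_all))
  · refine Finset.card_image_le.trans ?_
    rw [Finset.card_erase_of_mem i.2]
    omega

lemma isDomain_of_isPrime_span_singleton {R : Type*} [CommRing R] [IsNoetherianRing R]
    [IsLocalRing R] {x : R} (hx : x ∈ maximalIdeal R) (hmin : ∀ P ∈ minimalPrimes R, x ∉ P)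
    (hprime : (Ideal.span {x}).IsPrime) : IsDomain R := by
  obtain ⟨P, hP, hle⟩ := Ideal.exists_minimalPrimes_le (bot_le : ⊥ ≤ Ideal.span {x})
  have hPp : P.IsPrime := hP.1.1
  have hbot : P = ⊥ := by
    refine Submodule.eq_bot_of_le_smul_of_le_jacobson_bot (maximalIdeal R) _
        (IsNoetherian.noetherian _) (fun y hy => ?_) (maximalIdeal_le_jacobson _)
    obtain ⟨z, rfl⟩ := Ideal.mem_span_singleton.mp (hle hy)
    exact Ideal.mul_mem_mul hx ((hPp.mem_or_mem hy).resolve_left (hmin P hP))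
  subst hbot
  exact IsDomain.of_bot_isPrime R

theorem isDomain_and_exists_isWeaklyRegular_of_card_le {n : ℕ} : ∀ (R : Type*) [CommRing R]
    [IsNoetherianRing R] [IsLocalRing R] (s : Finset R)
    (_ : Ideal.span (s : Set R) = maximalIdeal R) (_ : s.card ≤ n) (_ : ringKrullDim R = n),
    IsDomain R ∧ ∃ rs : List R, IsWeaklyRegular R rs ∧ Ideal.ofList rs = maximalIdeal R := by
  induction n with
  | zero =>
    intro R _ _ _ s hs hc _
    have hs0 : s = ∅ := by simpa using hc
    subst hs0
    have hbot : maximalIdeal R = ⊥ := by simpa using hs.symm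
    have hdom := (isField_iff_maximalIdeal_eq.mpr hbot).isDomain
    exact ⟨hdom, [], .nil R R, by simp [hbot]⟩
  | succ n ih =>
    intro R _ _ _ s hs hc hd
    obtain ⟨x, hx, hx2, hxmin⟩ :=
      exists_mem_maximalIdeal_notMem_sq_notMem_minimalPrimes (R := R) (by
        rw [hd]; exact_mod_cast n.succ_ne_zero)
    have hnt : Nontrivial (R ⧸ Ideal.span {x}) := Ideal.Quotient.nontrivial_iff.mpr
      (ne_top_of_le_ne_top (maximalIdeal.isMaximal R).ne_top (by simpa [Ideal.span_le] using hx))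
    have hsurj := Ideal.Quotient.mk_surjective (I := Ideal.span {x})
    have hloc : IsLocalRing (R ⧸ Ideal.span {x}) := .of_surjective' _ hsurj
    have hmap : (maximalIdeal R).map (Ideal.Quotient.mk (Ideal.span {x})) = maximalIdeal _ :=
      map_maximalIdeal_of_surjective _ hsurj
    obtain ⟨t, ht, htc⟩ := exists_finset_span_eq_maximalIdeal_quotient hs hc hx hx2
    rw [hmap] at ht
    have hd' : ringKrullDim (R ⧸ Ideal.span {x}) = n := by
      apply le_antisymm
      · refine (ringKrullDim_le_spanFinrank_maximalIdeal _).trans ?_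
        rw [← ht]
        have := Submodule.spanFinrank_span_le_ncard_of_finite (R := R ⧸ Ideal.span {x})
          t.finite_toSet
        rw [Set.ncard_coe_finset] at this
        exact_mod_cast this.trans htc
      · have h1 := ringKrullDim_le_ringKrullDim_quotSMulTop_succ hx
        have h2 : Ideal.span {x} = x • (⊤ : Ideal R) := by
          simp [← Submodule.ideal_span_singleton_smul]
        rw [← h2, hd] at h1
        revert h1
        generalize ringKrullDim (R ⧸ Ideal.span {x}) = e
        induction e using WithBot.recBotCoe with
        | bot => intro h; simp at h
        | coe e =>
          intro h
          have : ((n + 1 : ℕ) : ℕ∞) ≤ e + 1 := by exact_mod_cast h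
          have : (n : ℕ∞) ≤ e := by
            push_cast at this
            exact (ENat.add_le_add_iff_right ENat.one_ne_top).mp this
          exact_mod_cast this
    obtain ⟨hdom, rs', hreg, hrs'⟩ := ih _ t ht htc hd'
    have hdomR : IsDomain R := isDomain_of_isPrime_span_singleton hx hxmin
      ((Ideal.Quotient.isDomain_iff_prime _).mp hdom)
    obtain ⟨rs, rfl⟩ := List.map_surjective_iff.mpr hsurj rs'
    refine ⟨hdomR, x :: rs, ?_, ?_⟩
    · rw [isWeaklyRegular_cons_iff]
      have hx0 : x ≠ 0 := fun h => hxmin ⊥ (IsDomain.minimalPrimes_eq_singleton_bot R ▸ rfl)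
        (h ▸ zero_mem _)
      refine ⟨(IsRegular.of_ne_zero hx0).1.isSMulRegular, ?_⟩
      have h1 : IsWeaklyRegular (R ⧸ Ideal.span {x}) rs :=
        (isWeaklyRegular_map_algebraMap_iff (R ⧸ Ideal.span {x}) _ rs).mp hreg
      exact (LinearEquiv.isWeaklyRegular_congr (Submodule.quotEquivOfEq _ _ (by
        simp [← Submodule.ideal_span_singleton_smul])) rs).mp h1
    · rw [Ideal.ofList_cons]
      rw [← Ideal.map_ofList, ← hmap] at hrs'
      have := congr(Ideal.comap (Ideal.Quotient.mk (Ideal.span {x})) $hrs')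
      rw [Ideal.comap_map_of_surjective _ hsurj, Ideal.comap_map_of_surjective _ hsurj,
        ← RingHom.ker_eq_comap_bot, Ideal.mk_ker] at this
      rw [sup_comm, this, sup_eq_left]
      simpa [Ideal.span_le] using hx

end RegularLocal

section FrobeniusFlat

open IsLocalRing RingTheory.Sequence TensorProduct

open scoped Pointwise

lemma RingTheory.Sequence.IsWeaklyRegular.of_exact {R : Type*} [CommRing R] (rs : List R) :
    ∀ {M M' M'' : Type _} [AddCommGroup M] [AddCommGroup M'] [AddCommGroup M'']
      [Module R M] [Module R M'] [Module R M''] {f : M →ₗ[R] M'} {g : M' →ₗ[R] M''}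
      (_ : Function.Injective f) (_ : Function.Exact f g) (_ : Function.Surjective g)
      (_ : IsWeaklyRegular M rs) (_ : IsWeaklyRegular M'' rs), IsWeaklyRegular M' rs := by
  induction rs with
  | nil => intros; exact .nil R _
  | cons r rs ih =>
    intro M M' M'' _ _ _ _ _ _ f g hf hfg hg h h''
    rw [isWeaklyRegular_cons_iff] at h h'' ⊢
    refine ⟨isSMulRegular_of_range_eq_ker hf (LinearMap.exact_iff.mp hfg).symm h.1 h''.1, ?_⟩
    refine ih (f := QuotSMulTop.map r f) (g := QuotSMulTop.map r g) ?_
      (QuotSMulTop.map_exact r hfg hg) (QuotSMulTop.map_surjective r hg) h.2 h''.2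
    have := QuotSMulTop.map_first_exact_on_four_term_exact_of_isSMulRegular_last
      (f₁ := (0 : PUnit →ₗ[R] M)) (f₂ := f) (f₃ := g) (r := r)
      (by rw [LinearMap.exact_zero_iff_injective]; exact hf) hfg h''.1
    rw [map_zero] at this
    exact (LinearMap.exact_zero_iff_injective _ _).mp this

lemma RingTheory.Sequence.IsWeaklyRegular.quotSMulTop_pow {R M : Type*} [CommRing R]
    [AddCommGroup M] [Module R M] {x : R} {rs : List R} (hx : IsSMulRegular M x)
    (h : IsWeaklyRegular (QuotSMulTop x M) rs) (n : ℕ) :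
    IsWeaklyRegular (QuotSMulTop (x ^ n) M) rs := by
  induction n with
  | zero =>
    have : Subsingleton (QuotSMulTop (x ^ 0) M) :=
      Submodule.Quotient.subsingleton_iff.mpr (by simp)
    exact ⟨fun _ _ => Function.injective_of_subsingleton _⟩
  | succ n ih =>
    have hle1 : x ^ n • (⊤ : Submodule R M) ≤
        (x ^ (n + 1) • (⊤ : Submodule R M)).comap (LinearMap.lsmul R M x) := by
      rintro _ ⟨m, -, rfl⟩
      exact ⟨m, trivial, by simp [pow_succ', mul_smul, smul_comm x]⟩
    have hle2 : x ^ (n + 1) • (⊤ : Submodule R M) ≤ x • (⊤ : Submodule R M) := by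
      rintro _ ⟨m, -, rfl⟩
      exact ⟨x ^ n • m, trivial, by simp [pow_succ', mul_smul, smul_comm x]⟩
    refine .of_exact rs (f := Submodule.mapQ _ _ _ hle1) (g := Submodule.factor hle2)
      ?_ ?_ (Submodule.factor_surjective hle2) ih h
    · rw [injective_iff_map_eq_zero]
      intro y hy
      obtain ⟨m, rfl⟩ := Submodule.mkQ_surjective _ y
      obtain ⟨m', -, hm'⟩ := (Submodule.Quotient.mk_eq_zero _).mp hy
      refine (Submodule.Quotient.mk_eq_zero _).mpr ⟨m', trivial, hx ?_⟩
      simpa [pow_succ', mul_smul] using hm'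
    · intro y
      obtain ⟨m, rfl⟩ := Submodule.mkQ_surjective _ y
      constructor
      · intro hy
        obtain ⟨m', -, rfl⟩ := (Submodule.Quotient.mk_eq_zero _).mp hy
        exact ⟨Submodule.mkQ _ m', rfl⟩
      · rintro ⟨z, hz⟩
        obtain ⟨m', rfl⟩ := Submodule.mkQ_surjective _ z
        rw [← hz]
        exact (Submodule.Quotient.mk_eq_zero _).mpr ⟨m', trivial, rfl⟩

lemma RingTheory.Sequence.IsWeaklyRegular.map_pow {R : Type*} [CommRing R] (n : ℕ) (rs : List R) :
    ∀ {M : Type _} [AddCommGroup M] [Module R M] (_ : IsWeaklyRegular M rs),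
      IsWeaklyRegular M (rs.map (· ^ n)) := by
  induction rs with
  | nil => intros; exact .nil R _
  | cons x rs ih =>
    intro M _ _ h
    rw [isWeaklyRegular_cons_iff] at h
    rw [List.map_cons, isWeaklyRegular_cons_iff]
    exact ⟨h.1.pow n, ih (.quotSMulTop_pow h.1 h.2 n)⟩

lemma exists_lTensor_sup_span_singleton_eq {A N : Type*} [CommRing A] [AddCommGroup N]
    [Module A N] (J : Ideal A) (x : A) (t : N ⊗[A] (J ⊔ Ideal.span {x} : Ideal A)) :
    ∃ (s : N ⊗[A] J) (n : N), t = (Submodule.inclusion le_sup_left).lTensor N s +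
      n ⊗ₜ ⟨x, Ideal.mem_sup_right (Ideal.mem_span_singleton_self x)⟩ := by
  induction t with
  | zero => exact ⟨0, 0, by simp⟩
  | add t₁ t₂ h₁ h₂ =>
    obtain ⟨s₁, n₁, rfl⟩ := h₁
    obtain ⟨s₂, n₂, rfl⟩ := h₂
    exact ⟨s₁ + s₂, n₁ + n₂, by rw [map_add, add_tmul]; abel⟩
  | tmul n y =>
    obtain ⟨y, hy⟩ := y
    obtain ⟨j, hj, z, hz, rfl⟩ := Submodule.mem_sup.mp hy
    obtain ⟨a, rfl⟩ := Ideal.mem_span_singleton'.mp hz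
    refine ⟨n ⊗ₜ ⟨j, hj⟩, a • n, ?_⟩
    rw [LinearMap.lTensor_tmul, smul_tmul, ← tmul_add]
    rfl

lemma rid_lTensor_subtype_mem {A N : Type*} [CommRing A] [AddCommGroup N]
    [Module A N] (J : Ideal A) (t : N ⊗[A] J) :
    TensorProduct.rid A N (J.subtype.lTensor N t) ∈ J • (⊤ : Submodule A N) := by
  induction t with
  | zero => simp
  | add t₁ t₂ h₁ h₂ => simpa using add_mem h₁ h₂
  | tmul n y => simpa using Submodule.smul_mem_smul y.2 (Submodule.mem_top (x := n))

/-- An ideal generated by a sequence that is weakly regular on `N` has no relations on `N`. -/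
lemma lTensor_subtype_injective_of_isWeaklyRegular {A N : Type*} [CommRing A] [AddCommGroup N]
    [Module A N] (rs : List A) (h : IsWeaklyRegular N rs) :
    Function.Injective ((Ideal.ofList rs).subtype.lTensor N) := by
  induction rs using List.reverseRecOn with
  | nil =>
    have : Subsingleton (Ideal.ofList ([] : List A)) := by
      rw [Ideal.ofList_nil]; infer_instance
    have : Subsingleton (N ⊗[A] Ideal.ofList ([] : List A)) := inferInstance
    exact Function.injective_of_subsingleton _
  | append_singleton rs x ih =>
    rw [isWeaklyRegular_append_iff, isWeaklyRegular_singleton_iff] at h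
    rw [Ideal.ofList_append, Ideal.ofList_singleton, injective_iff_map_eq_zero]
    intro t ht
    obtain ⟨s, n, rfl⟩ := exists_lTensor_sup_span_singleton_eq _ _ t
    have hcomp (s) : (Submodule.subtype _).lTensor N
        ((Submodule.inclusion (le_sup_left : Ideal.ofList rs ≤ Ideal.ofList rs ⊔ Ideal.span {x})
          ).lTensor N s) = (Ideal.ofList rs).subtype.lTensor N s := by
      rw [← LinearMap.lTensor_comp_apply]
      rfl
    have hn : n ∈ Ideal.ofList rs • (⊤ : Submodule A N) := by
      refine mem_of_isSMulRegular_quotient_of_smul_mem h.2 ?_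
      have h1 := congr(TensorProduct.rid A N $ht)
      rw [map_add, hcomp, map_add, map_zero, LinearMap.lTensor_tmul, rid_tmul] at h1
      rw [show x • n = _ from eq_neg_of_add_eq_zero_right h1]
      exact neg_mem (rid_lTensor_subtype_mem _ _)
    have hn' : ∃ s' : N ⊗[A] Ideal.ofList rs, (Submodule.inclusion le_sup_left).lTensor N s' =
        n ⊗ₜ[A] (⟨x, Ideal.mem_sup_right (Ideal.mem_span_singleton_self x)⟩ :
          (Ideal.ofList rs ⊔ Ideal.span {x} : Ideal A)) := by
      clear ht
      induction hn using Submodule.smul_induction_on' with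
      | smul j hj m _ =>
        refine ⟨m ⊗ₜ ⟨j * x, Ideal.mul_mem_right _ _ hj⟩, ?_⟩
        rw [LinearMap.lTensor_tmul, smul_tmul]
        rfl
      | add m₁ _ m₂ _ h₁ h₂ =>
        obtain ⟨s₁, h₁⟩ := h₁
        obtain ⟨s₂, h₂⟩ := h₂
        exact ⟨s₁ + s₂, by rw [map_add, h₁, h₂, add_tmul]⟩
    obtain ⟨s', hs'⟩ := hn'
    rw [← hs', ← map_add] at ht ⊢
    rw [hcomp] at ht
    rw [(injective_iff_map_eq_zero _).mp (ih h.1) _ ht, map_zero]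

lemma exists_lTensor_colon_eq {A N : Type*} [CommRing A] [AddCommGroup N] [Module A N]
    (J : Ideal A) (f : A) (t : N ⊗[A] J)
    (ht : (Submodule.inclusion (le_sup_left : J ≤ J ⊔ Ideal.span {f})).lTensor N t = 0) :
    ∃ s : N ⊗[A] (Submodule.comap (LinearMap.lsmul A A f) J : Ideal A),
      (Submodule.subtype _).lTensor N s = 0 ∧
      (LinearMap.restrict (LinearMap.lsmul A A f) (fun _ h => h) :
        (Submodule.comap (LinearMap.lsmul A A f) J : Ideal A) →ₗ[A] J).lTensor N s = t := by
  let K : Ideal A := Submodule.comap (LinearMap.lsmul A A f) J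
  let m : K →ₗ[A] J := LinearMap.restrict (LinearMap.lsmul A A f) (fun _ h => h)
  let u : K →ₗ[A] J × A := m.prod (-K.subtype)
  let v : J × A →ₗ[A] (J ⊔ Ideal.span {f} : Ideal A) :=
    (Submodule.inclusion le_sup_left).coprod (LinearMap.toSpanSingleton A _
      ⟨f, Ideal.mem_sup_right (Ideal.mem_span_singleton_self f)⟩)
  have huv : Function.Exact u v := by
    rintro ⟨⟨y, hy⟩, a⟩
    have hv : v (⟨y, hy⟩, a) = 0 ↔ y + a * f = 0 := Subtype.ext_iff
    rw [hv]
    constructor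
    · intro h
      have h' : f * -a = y := by linear_combination -h
      exact ⟨⟨-a, show f * -a ∈ J from h' ▸ hy⟩, Prod.ext (Subtype.ext h') (neg_neg a)⟩
    · rintro ⟨c, hc⟩
      have h1 : f * c.1 = y := congr(($hc).1.1)
      have h2 : -c.1 = a := congr(($hc).2)
      rw [← h1, ← h2]
      ring
  have hv : Function.Surjective v := by
    rintro ⟨y, hy⟩
    obtain ⟨j, hj, z, hz, rfl⟩ := Submodule.mem_sup.mp hy
    obtain ⟨a, rfl⟩ := Ideal.mem_span_singleton'.mp hz
    exact ⟨(⟨j, hj⟩, a), rfl⟩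
  obtain ⟨s, hs⟩ := (lTensor_exact N huv hv ((LinearMap.inl A J A).lTensor N t)).mp (by
    rw [← LinearMap.lTensor_comp_apply, LinearMap.coprod_inl, ht])
  refine ⟨s, ?_, ?_⟩
  · have := congr((LinearMap.snd A J A).lTensor N $hs)
    rw [← LinearMap.lTensor_comp_apply, ← LinearMap.lTensor_comp_apply, LinearMap.snd_prod,
      LinearMap.snd_comp_inl, LinearMap.lTensor_neg, LinearMap.lTensor_zero] at this
    simpa using this
  · have := congr((LinearMap.fst A J A).lTensor N $hs)
    rw [← LinearMap.lTensor_comp_apply, ← LinearMap.lTensor_comp_apply, LinearMap.fst_prod,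
      LinearMap.fst_comp_inl, LinearMap.lTensor_id] at this
    exact this

theorem flat_of_isWeaklyRegular {A B : Type*} [CommRing A] [IsNoetherianRing A] [IsLocalRing A]
    [CommRing B] [IsNoetherianRing B] [IsLocalRing B] [Algebra A B] [IsLocalHom (algebraMap A B)]
    (rs : List A) (hrs : Ideal.ofList rs = maximalIdeal A) (h : IsWeaklyRegular B rs) :
    Module.Flat A B := by
  rw [Module.Flat.iff_lTensor_injective']
  by_contra! hc
  obtain ⟨J, hJ, hmax⟩ := set_has_maximal_iff_noetherian.mpr ‹IsNoetherianRing A›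
    {J : Ideal A | ¬ Function.Injective (J.subtype.lTensor B)} hc
  have hmax' (J' : Ideal A) (hJ' : J < J') : Function.Injective (J'.subtype.lTensor B) := by
    by_contra h
    exact hmax J' h hJ'
  have hJtop : J ≠ ⊤ := by
    rintro rfl
    exact hJ (LinearEquiv.lTensor B (Submodule.topEquiv (R := A) (M := A))).injective
  have hJm : ¬ maximalIdeal A ≤ J := fun hle => hJ <| by
    rw [(maximalIdeal.isMaximal A).eq_of_le hJtop hle |>.symm, ← hrs]
    exact lTensor_subtype_injective_of_isWeaklyRegular rs h
  obtain ⟨f, hf, hfJ⟩ := Set.not_subset.mp hJm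
  let T : Submodule B (B ⊗[A] J) := LinearMap.ker (AlgebraTensorModule.lTensor B B J.subtype)
  have hT (t) : t ∈ T ↔ J.subtype.lTensor B t = 0 := Iff.rfl
  have hTbot : T = ⊥ := by
    refine Submodule.eq_bot_of_le_smul_of_le_jacobson_bot (maximalIdeal B) _
        (IsNoetherian.noetherian _) (fun t ht => ?_) (maximalIdeal_le_jacobson _)
    obtain ⟨s, hs, rfl⟩ := exists_lTensor_colon_eq J f t (by
      refine (injective_iff_map_eq_zero _).mp (hmax' (J ⊔ Ideal.span {f}) ?_) _ ?_
      · exact lt_of_le_not_ge le_sup_left fun hle =>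
          hfJ (hle (Ideal.mem_sup_right (Ideal.mem_span_singleton_self f)))
      · rw [← LinearMap.lTensor_comp_apply]
        exact (hT t).mp ht)
    by_cases hK : Submodule.comap (LinearMap.lsmul A A f) J ≤ J
    · have : (LinearMap.restrict (LinearMap.lsmul A A f) (fun _ h => h) :
          (Submodule.comap (LinearMap.lsmul A A f) J : Ideal A) →ₗ[A] J) =
            f • Submodule.inclusion hK := rfl
      rw [this, LinearMap.lTensor_smul, LinearMap.smul_apply, ← algebraMap_smul B f]
      refine Submodule.smul_mem_smul (map_nonunit (algebraMap A B) f hf) ?_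
      rw [hT, ← LinearMap.lTensor_comp_apply]
      exact hs
    · rw [(injective_iff_map_eq_zero _).mp (hmax' _ (lt_of_le_not_ge
        (fun y hy => Ideal.mul_mem_left _ f hy) hK)) s hs, map_zero]
      exact zero_mem _
  refine hJ ((injective_iff_map_eq_zero _).mpr fun t ht => ?_)
  have : t ∈ T := ht
  rwa [hTbot] at this

end FrobeniusFlat

section FrobeniusFlatLocalization

open IsLocalRing RingTheory.Sequence TensorProduct

lemma RingHom.flat_of_isWeaklyRegular_map {A B : Type*} [CommRing A] [IsNoetherianRing A]
    [IsLocalRing A] [CommRing B] [IsNoetherianRing B] [IsLocalRing B] (f : A →+* B) [IsLocalHom f]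
    (rs : List A) (hrs : Ideal.ofList rs = maximalIdeal A) (h : IsWeaklyRegular B (rs.map f)) :
    f.Flat := by
  algebraize [f]
  have : IsLocalHom (algebraMap A B) := ‹_›
  exact flat_of_isWeaklyRegular rs hrs ((isWeaklyRegular_map_algebraMap_iff B B rs).mp h)

/-- The easy direction of Kunz's theorem. -/
theorem frobenius_flat_of_card_le {R : Type*} [CommRing R] [IsNoetherianRing R] [IsLocalRing R]
    (p : ℕ) [Fact p.Prime] [CharP R p] (s : Finset R)
    (hs : Ideal.span (s : Set R) = maximalIdeal R) (hc : (s.card : WithBot ℕ∞) = ringKrullDim R) :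
    (frobenius R p).Flat := by
  obtain ⟨-, rs, hreg, hrs⟩ :=
    isDomain_and_exists_isWeaklyRegular_of_card_le R s hs le_rfl hc.symm
  have : IsLocalHom (frobenius R p) :=
    ⟨fun a ha => (isUnit_pow_iff (Fact.out : p.Prime).ne_zero).mp ha⟩
  exact RingHom.flat_of_isWeaklyRegular_map _ rs hrs (hreg.map_pow p)

lemma RingHom.Flat.of_comp_algebraMap {A L B : Type*} [CommRing A] [CommRing L] [CommRing B]
    [Algebra A L] (S : Submonoid A) [IsLocalization S L] (g : L →+* B)
    (h : (g.comp (algebraMap A L)).Flat) : g.Flat := by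
  algebraize [g, g.comp (algebraMap A L)]
  exact (Module.flat_iff_of_isLocalization L S B).mpr h

lemma frobenius_flat_of_isLocalization {A : Type*} (L : Type*) [CommRing A] [CommRing L]
    [Algebra A L] (S : Submonoid A) [IsLocalization S L] (p : ℕ) [ExpChar A p] [ExpChar L p]
    (h : (frobenius A p).Flat) : (frobenius L p).Flat := by
  refine RingHom.Flat.of_comp_algebraMap S _ ?_
  rw [← RingHom.frobenius_comm]
  exact h.comp (RingHom.flat_algebraMap_iff.mpr (IsLocalization.flat L S))

end FrobeniusFlatLocalization

section InjectiveDimension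

open Abelian

universe u

variable {A : Type u} [CommRing A]

lemma hasInjectiveDimensionLT_of_ext_quotient (n : ℕ) (N : ModuleCat.{u} A)
    (h : ∀ (J : Ideal A) (i : ℕ), n + 1 ≤ i →
      Subsingleton (Ext (ModuleCat.of A (A ⧸ J)) N i)) :
    HasInjectiveDimensionLT N (n + 1) := by
  induction n generalizing N with
  | zero =>
    rw [zero_add, ← injective_iff_hasInjectiveDimensionLT_one,
      ← Module.injective_iff_injective_object]
    refine Module.Baer.injective fun J g ↦ ?_
    let S : ShortComplex (ModuleCat.{u} A) :=
      ModuleCat.shortComplexOfCompEqZero J.subtype J.mkQ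
        (LinearMap.exact_subtype_mkQ J).linearMap_comp_eq_zero
    have hS : S.ShortExact := ModuleCat.shortComplex_shortExact S
      (LinearMap.exact_subtype_mkQ J) (Submodule.injective_subtype J) (Submodule.mkQ_surjective _)
    have := h J 1 le_rfl
    obtain ⟨x, hx⟩ := Ext.contravariant_sequence_exact₁ hS N
      (Ext.mk₀ (ModuleCat.ofHom g)) (n₁ := 1) rfl (Subsingleton.elim _ _)
    obtain ⟨y, rfl⟩ := (Ext.mk₀_bijective _ _).2 x
    rw [Ext.mk₀_comp_mk₀, (Ext.mk₀_bijective _ _).1.eq_iff] at hx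
    refine ⟨y.hom, fun a ha ↦ ?_⟩
    exact congr($(hx).hom ⟨a, ha⟩)
  | succ n ih =>
    obtain ⟨E, _, f, _⟩ := EnoughInjectives.presentation N
    let S := ShortComplex.mk f (Limits.cokernel.π f) (Limits.cokernel.condition f)
    have hS : S.ShortExact := { exact := ShortComplex.exact_cokernel f }
    refine (hS.hasInjectiveDimensionLT_X₃_iff n ‹_›).mp (ih _ fun J i hi ↦ ⟨fun x y ↦ ?_⟩)
    have := h J (i + 1) (by omega)
    suffices ∀ x : Ext (ModuleCat.of A (A ⧸ J)) S.X₃ i, x = 0 from (this x).trans (this y).symm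
    intro x
    obtain ⟨z, rfl⟩ := Ext.covariant_sequence_exact₃ _ hS x (n₁ := i + 1) rfl
      (Subsingleton.elim (α := Ext (ModuleCat.of A (A ⧸ J)) N (i + 1)) _ _)
    obtain _ | i := i
    · omega
    rw [Ext.eq_zero_of_injective z, Ext.zero_comp]

/-- The complex `A ⧸ J' → A ⧸ J → A ⧸ (J + (f))`, where `J' = (J : f)`. -/
noncomputable abbrev colonShortComplex (J J' : Ideal A) (f : A) (h : ∀ x, x ∈ J' ↔ f * x ∈ J) :
    ShortComplex (ModuleCat.{u} A) :=
  ModuleCat.shortComplexOfCompEqZero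
    (Submodule.mapQ J' J (LinearMap.lsmul A A f) fun x hx ↦ (h x).mp hx)
    (Submodule.factor (le_sup_left : J ≤ J ⊔ Ideal.span {f})) (by
      ext
      refine (Submodule.Quotient.mk_eq_zero _).mpr ?_
      exact Ideal.mul_mem_right _ _ (Ideal.mem_sup_right (Ideal.mem_span_singleton_self f)))

lemma colonShortComplex_shortExact (J J' : Ideal A) (f : A) (h : ∀ x, x ∈ J' ↔ f * x ∈ J) :
    (colonShortComplex J J' f h).ShortExact := by
  refine ModuleCat.shortComplex_shortExact _ ?_ ?_ ?_
  · rintro x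
    refine ⟨fun hx ↦ ?_, ?_⟩
    · obtain ⟨x, rfl⟩ := Submodule.mkQ_surjective _ x
      have : x ∈ J ⊔ Ideal.span {f} := (Submodule.Quotient.mk_eq_zero _).mp hx
      obtain ⟨y, hy, z, hz, rfl⟩ := Submodule.mem_sup.mp this
      obtain ⟨c, rfl⟩ := Ideal.mem_span_singleton.mp hz
      refine ⟨Submodule.Quotient.mk c, ?_⟩
      refine (Submodule.Quotient.eq J).mpr ?_
      simpa using hy
    · rintro ⟨y, rfl⟩
      exact congr($((colonShortComplex J J' f h).zero).hom y)
  · refine (injective_iff_map_eq_zero _).mpr fun x hx ↦ ?_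
    obtain ⟨x, rfl⟩ := Submodule.mkQ_surjective _ x
    exact (Submodule.Quotient.mk_eq_zero _).mpr ((h x).mpr ((Submodule.Quotient.mk_eq_zero _).mp hx))
  · exact Submodule.factor_surjective le_sup_left

variable [IsNoetherianRing A] [IsLocalRing A]

lemma subsingleton_ext_quotient_of_residue (N : ModuleCat.{u} A) [Module.Finite A N] (n : ℕ)
    (h : ∀ i, n ≤ i →
      Subsingleton (Ext (ModuleCat.of A (A ⧸ IsLocalRing.maximalIdeal A)) N i))
    (J : Ideal A) : ∀ i, n ≤ i → Subsingleton (Ext (ModuleCat.of A (A ⧸ J)) N i) := by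
  induction J using WellFoundedGT.induction with
  | ind J ih =>
  by_cases hJ : J = ⊤
  · intro i _
    subst hJ
    have : Limits.IsZero (ModuleCat.of A (A ⧸ (⊤ : Ideal A))) :=
      ModuleCat.isZero_of_subsingleton _
    have := this.hasProjectiveDimensionLT_zero
    exact HasProjectiveDimensionLT.subsingleton _ 0 i (Nat.zero_le i) N
  by_cases hJm : J = IsLocalRing.maximalIdeal A
  · rwa [hJm]
  obtain ⟨f, hfm, hfJ⟩ := SetLike.exists_of_lt ((IsLocalRing.le_maximalIdeal hJ).lt_of_ne hJm)
  have hlt : J < J ⊔ Ideal.span {f} := by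
    refine lt_of_le_of_ne le_sup_left fun h ↦ hfJ ?_
    rw [h]
    exact Ideal.mem_sup_right (Ideal.mem_span_singleton_self f)
  obtain ⟨J', hJ'⟩ : ∃ J' : Ideal A, ∀ x, x ∈ J' ↔ f * x ∈ J :=
    ⟨Submodule.comap (LinearMap.lsmul A A f) J, fun x ↦ Iff.rfl⟩
  have hS := colonShortComplex_shortExact J J' f hJ'
  have h₃ := ih _ hlt
  intro i hi
  by_cases hJJ : J' = J
  · subst hJJ
    have : Subsingleton (Ext (colonShortComplex J' J' f hJ').X₃ N (i + 1)) := h₃ _ (by omega)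
    by_contra! ntr
    have hf : f ∈ (Module.annihilator A (Ext (ModuleCat.of A (A ⧸ J')) N i)).jacobson :=
      (IsLocalRing.maximalIdeal_le_jacobson _) hfm
    refine absurd ?_ (Submodule.top_ne_pointwise_smul_of_mem_jacobson_annihilator hf)
    rw [eq_comm, eq_top_iff]
    intro y hy
    obtain ⟨z, hz⟩ := Ext.contravariant_sequence_exact₁ hS N y (add_comm 1 i)
      (Subsingleton.elim _ _)
    have hfs : (colonShortComplex J' J' f hJ').f = f • 𝟙 _ := by
      ext
      rfl
    rw [hfs, Ext.mk₀_smul, Ext.smul_comp, Ext.mk₀_id_comp] at hz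
    rw [← hz]
    exact Submodule.smul_mem_pointwise_smul _ _ ⊤ trivial
  · have hlt' : J < J' :=
      lt_of_le_of_ne (fun x hx ↦ (hJ' x).mpr (J.mul_mem_left f hx)) (Ne.symm hJJ)
    have h₁ := ih _ hlt' i hi
    have h₃ := h₃ i hi
    suffices ∀ x : Ext (ModuleCat.of A (A ⧸ J)) N i, x = 0 from
      ⟨fun x y ↦ (this x).trans (this y).symm⟩
    intro x
    obtain ⟨z, rfl⟩ := Ext.contravariant_sequence_exact₂ hS N x
      (Subsingleton.elim (α := Ext (ModuleCat.of A (A ⧸ J')) N i) _ _)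
    rw [Subsingleton.elim (α := Ext (ModuleCat.of A (A ⧸ (J ⊔ Ideal.span {f}))) N i) z 0,
      Ext.comp_zero]

lemma hasInjectiveDimensionLT_of_ext_residue (N : ModuleCat.{u} A) [Module.Finite A N] (n : ℕ)
    (h : ∀ i, n + 1 ≤ i →
      Subsingleton (Ext (ModuleCat.of A (A ⧸ IsLocalRing.maximalIdeal A)) N i)) :
    HasInjectiveDimensionLT N (n + 1) :=
  hasInjectiveDimensionLT_of_ext_quotient n N
    fun J ↦ subsingleton_ext_quotient_of_residue N (n + 1) h J

end InjectiveDimension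

section RegularInjectiveDimension

open Abelian RingTheory.Sequence

universe u

variable {A : Type u} [CommRing A] [IsNoetherianRing A] [IsLocalRing A]

lemma hasProjectiveDimensionLT_quotient_ofList {rs : List A} (reg : IsRegular A rs) :
    HasProjectiveDimensionLT (ModuleCat.of A (A ⧸ Ideal.ofList rs)) (rs.length + 1) := by
  have h := (projectiveDimension_le_iff _ _).mp
    (ModuleCat.projectiveDimension_quotient_eq_length rs reg).le
  exact hasProjectiveDimensionLT_of_iso (Shrink.linearEquiv A _).toModuleIso _

lemma length_le_ringKrullDim_of_isRegular {rs : List A} (reg : IsRegular A rs) :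
    (rs.length : WithBot ℕ∞) ≤ ringKrullDim A := by
  rw [← ringKrullDim_add_length_eq_ringKrullDim_of_isRegular rs reg]
  have : Nontrivial (A ⧸ Ideal.ofList rs) :=
    Ideal.Quotient.nontrivial_iff.mpr fun h ↦ reg.top_ne_smul (by simp [h])
  exact le_add_of_nonneg_left ringKrullDim_nonneg_of_nontrivial

lemma exists_injective_residue_of_isRegular :
    ∃ rs : List A, IsRegular A rs ∧
      ∃ f : (A ⧸ IsLocalRing.maximalIdeal A) →ₗ[A] (A ⧸ Ideal.ofList rs),
        Function.Injective f := by
  by_contra! hcon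
  have hext : ∀ n : ℕ, ∃ rs : List A, IsRegular A rs ∧ rs.length = n := by
    intro n
    induction n with
    | zero => exact ⟨[], .nil A A, rfl⟩
    | succ n ih =>
      obtain ⟨rs, reg, rfl⟩ := ih
      have hsub : Subsingleton
          ((A ⧸ IsLocalRing.maximalIdeal A) →ₗ[A] (A ⧸ Ideal.ofList rs)) := by
        suffices ∀ f : (A ⧸ IsLocalRing.maximalIdeal A) →ₗ[A] (A ⧸ Ideal.ofList rs), f = 0 from
          ⟨fun f g ↦ (this f).trans (this g).symm⟩
        intro f
        have : IsSimpleModule A (A ⧸ IsLocalRing.maximalIdeal A) :=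
          isSimpleModule_iff_isCoatom.mpr
            (Ideal.isMaximal_def.mp (IsLocalRing.maximalIdeal.isMaximal A))
        exact (LinearMap.injective_or_eq_zero f).resolve_left (hcon rs reg f)
      obtain ⟨r, hr, hreg⟩ := IsSMulRegular.subsingleton_linearMap_iff.mp hsub
      rw [Ideal.annihilator_quotient] at hr
      refine ⟨rs ++ [r], IsRegular.of_isWeaklyRegular_of_mem_maximalIdeal A ?_ ?_, by simp⟩
      · simp only [List.mem_append, List.mem_singleton]
        rintro x (hx | rfl)
        · refine IsLocalRing.le_maximalIdeal reg.2.symm ?_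
          simpa using (Ideal.mem_span x).mpr fun p a ↦ a hx
        · exact hr
      · rw [isWeaklyRegular_append_iff, isWeaklyRegular_singleton_iff]
        refine ⟨reg.1, ?_⟩
        exact ((Submodule.quotEquivOfEq _ _ (by simp)).isSMulRegular_congr r).mp hreg
  obtain ⟨N, hN⟩ : ∃ N : ℕ, ringKrullDim A < N := by
    obtain ⟨N, hN⟩ := ENat.ne_top_iff_exists.mp
      (Ideal.height_ne_top (IsLocalRing.maximalIdeal.isMaximal A).ne_top)
    refine ⟨N + 1, ?_⟩
    rw [← IsLocalRing.maximalIdeal_height_eq_ringKrullDim, ← hN]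
    exact_mod_cast Nat.lt_succ_self N
  obtain ⟨rs, reg, hlen⟩ := hext N
  have := length_le_ringKrullDim_of_isRegular reg
  rw [hlen] at this
  exact absurd this (not_le.mpr hN)

lemma hasInjectiveDimensionLT_of_ringKrullDim_lt {n : ℕ}
    (h : HasInjectiveDimensionLT (ModuleCat.of A A) n) (j : ℕ) (hj : ringKrullDim A < j) :
    HasInjectiveDimensionLT (ModuleCat.of A A) j := by
  obtain ⟨rs, reg, f, hf⟩ := exists_injective_residue_of_isRegular (A := A)
  have hlen : rs.length < j := by
    exact_mod_cast (length_le_ringKrullDim_of_isRegular reg).trans_lt hj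
  by_cases hnj : n ≤ j
  · exact hasInjectiveDimensionLT_of_ge _ n j hnj
  have key : ∀ i, rs.length < i → HasInjectiveDimensionLT (ModuleCat.of A A) (i + 1) →
      HasInjectiveDimensionLT (ModuleCat.of A A) i := by
    intro i hi hi'
    obtain ⟨i, rfl⟩ : ∃ i', i = i' + 1 := ⟨i - 1, by omega⟩
    refine hasInjectiveDimensionLT_of_ext_residue _ _ fun k hk ↦ ?_
    have hS : (ModuleCat.shortComplexOfCompEqZero f f.range.mkQ
      (LinearMap.exact_map_mkQ_range f).linearMap_comp_eq_zero).ShortExact :=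
      ModuleCat.shortComplex_shortExact _ (LinearMap.exact_map_mkQ_range f) hf
        (Submodule.mkQ_surjective _)
    have := hasProjectiveDimensionLT_quotient_ofList reg
    suffices ∀ x : Ext (ModuleCat.of A (A ⧸ IsLocalRing.maximalIdeal A)) (ModuleCat.of A A) k,
      x = 0 from ⟨fun x y ↦ (this x).trans (this y).symm⟩
    intro x
    obtain ⟨y, rfl⟩ := Ext.contravariant_sequence_exact₁ hS _ x (add_comm 1 k)
      (Ext.eq_zero_of_hasInjectiveDimensionLT _ (i + 1 + 1) (by omega))
    have hy : y = 0 := Ext.eq_zero_of_hasProjectiveDimensionLT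
      (X := ModuleCat.of A (A ⧸ Ideal.ofList rs)) y (rs.length + 1) (by omega)
    rw [hy, Ext.comp_zero]
  obtain ⟨d, rfl⟩ := Nat.exists_eq_add_of_le (le_of_not_ge hnj)
  clear hnj
  induction d with
  | zero => exact h
  | succ d ih => exact ih (key _ (by omega) h)

end RegularInjectiveDimension

section Vanishing

open Abelian RingTheory.Sequence

universe u

variable {A : Type u} [CommRing A]

lemma isZero_ext_of_subsingleton (X Y : ModuleCat.{u} A) (n : ℕ)
    (h : Subsingleton (Abelian.Ext X Y (n + 1))) :
    Limits.IsZero (((_root_.Ext A (ModuleCat.{u} A) (n + 1)).obj (Opposite.op X)).obj Y) := by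
  let P := projectiveResolution X
  refine Limits.IsZero.of_iso ?_ (P.isoExt (R := A) (n + 1) Y)
  rw [← HomologicalComplex.exactAt_iff_isZero_homology,
    HomologicalComplex.exactAt_iff' _ n (n + 1) (n + 2) (by simp) (by simp),
    ShortComplex.moduleCat_exact_iff]
  intro f hf
  have h0 : P.extMk (n := n + 1) f (n + 2) rfl hf = 0 := Subsingleton.elim _ _
  exact (P.extMk_eq_zero_iff (n := n + 1) f (n + 2) rfl hf n rfl).mp h0

lemma subsingleton_localCohomology_of_ext (J : Ideal A) (j : ℕ) (hj : 0 < j)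
    (N : ModuleCat.{u} A)
    (h : ∀ t : ℕ, Subsingleton (Abelian.Ext (ModuleCat.of A (A ⧸ J ^ t)) N j)) :
    Subsingleton ((localCohomology J j).obj N) := by
  obtain ⟨j, rfl⟩ : ∃ i, j = i + 1 := ⟨j - 1, by omega⟩
  rw [← ModuleCat.isZero_iff_subsingleton]
  have := localCohomology.hasColimitDiagram.{u, 0} (localCohomology.idealPowersDiagram J) (j + 1)
  refine Limits.IsZero.of_iso ?_ (Limits.colimitObjIsoColimitCompEvaluation
    (localCohomology.diagram (localCohomology.idealPowersDiagram J) (j + 1)) N)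
  rw [Limits.IsZero.iff_id_eq_zero]
  exact Limits.colimit.hom_ext fun t ↦
    Limits.IsZero.eq_of_src (isZero_ext_of_subsingleton _ _ j (h t.unop.unop)) _ _

lemma subsingleton_localCohomology_top (j : ℕ) (hj : 0 < j) (N : ModuleCat.{u} A) :
    Subsingleton ((localCohomology (⊤ : Ideal A) j).obj N) := by
  refine subsingleton_localCohomology_of_ext _ j hj N fun t ↦ ?_
  have h : Subsingleton (A ⧸ (⊤ : Ideal A) ^ t) :=
    Ideal.Quotient.subsingleton_iff.mpr (Ideal.top_pow A t)
  have := (ModuleCat.isZero_of_iff_subsingleton (R := A) |>.mpr h).hasProjectiveDimensionLT_zero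
  exact HasProjectiveDimensionLT.subsingleton _ 0 j (Nat.zero_le j) N

variable [IsNoetherianRing A]

lemma hasInjectiveDimensionLE_localization (S : Submonoid A) (n : ℕ)
    (h : HasInjectiveDimensionLE (ModuleCat.of A A) n) :
    HasInjectiveDimensionLE (ModuleCat.of (Localization S) (Localization S)) n := by
  have := ModuleCat.localizedModule_hasInjectiveDimensionLE n S (ModuleCat.of A A)
  exact (ModuleCat.hasInjectiveDimensionLE_iff_of_linearEquiv (Shrink.linearEquiv _ _) n).mp this

variable [IsLocalRing A]

theorem exists_hasInjectiveDimensionLE_of_maximalIdeal_eq_ofList (rs : List A)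
    (hrs : IsWeaklyRegular A rs) (hm : Ideal.ofList rs = IsLocalRing.maximalIdeal A) :
    ∃ n, HasInjectiveDimensionLE (ModuleCat.of A A) n := by
  refine ⟨rs.length, hasInjectiveDimensionLT_of_ext_residue _ _ fun i hi ↦ ?_⟩
  have reg : IsRegular A rs := ⟨hrs, by
    simpa [hm] using (IsLocalRing.maximalIdeal.isMaximal A).ne_top.symm⟩
  have := hasProjectiveDimensionLT_quotient_ofList reg
  rw [← hm]
  exact HasProjectiveDimensionLT.subsingleton _ (rs.length + 1) i hi _

theorem subsingleton_localCohomology_of_ringKrullDim_lt (J : Ideal A) (j : ℕ)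
    (hj : ringKrullDim A < j) (h : ∃ n, HasInjectiveDimensionLE (ModuleCat.of A A) n) :
    Subsingleton ((localCohomology J j).obj (ModuleCat.of A A)) := by
  obtain ⟨n, hn⟩ := h
  have := hasInjectiveDimensionLT_of_ringKrullDim_lt hn j hj
  refine subsingleton_localCohomology_of_ext J j ?_ _
    fun t ↦ HasInjectiveDimensionLT.subsingleton _ j j le_rfl _
  exact_mod_cast ringKrullDim_nonneg_of_nontrivial.trans_lt hj

end Vanishing

section HomBaseChange

open TensorProduct

universe u

section

variable {A B : Type u} [CommRing A] [CommRing B] [Algebra A B] [Module.Flat A B]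
  [IsNoetherianRing A]

/-- Flat base change for `Hom(A ⧸ I, M)`. -/
noncomputable def homQuotientBaseChangeEquiv (I : Ideal A) {M N : Type*} [AddCommGroup M]
    [Module A M] [AddCommGroup N] [Module B N] (e : B ⊗[A] M ≃ₗ[B] N) :
    B ⊗[A] ((A ⧸ I) →ₗ[A] M) ≃ₗ[B] ((B ⧸ I.map (algebraMap A B)) →ₗ[B] N) :=
  have : Module.FinitePresentation A (A ⧸ I) := Module.finitePresentation_of_finite A _
  (Module.FinitePresentation.isBaseChange_map A (A ⧸ I) M B).equiv ≪≫ₗ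
    LinearEquiv.arrowCongr
      (Algebra.TensorProduct.quotIdealMapEquivTensorQuot B I).toLinearEquiv.symm e

end

section LocalCohomology

variable {A B : Type u} [CommRing A] [CommRing B] [IsNoetherianRing A] [IsLocalRing A]

lemma finite_hom_localCohomology_of_flat {f : A →+* B} (hf : f.Flat) (I J : Ideal A) (j : ℕ)
    (h : Module.Finite A ((A ⧸ I) →ₗ[A] ((localCohomology J j).obj (ModuleCat.of A A)))) :
    Module.Finite B ((B ⧸ I.map f) →ₗ[B]
      ((localCohomology (J.map f) j).obj (ModuleCat.of B B))) := by
  algebraize [f]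
  exact Module.Finite.equiv
    (homQuotientBaseChangeEquiv I (localCohomologyBaseChangeEquiv B J j))

lemma nonempty_hom_localCohomology_equiv_of_flat {f : A →+* B} (hf : f.Flat) (I J : Ideal A)
    (j n : ℕ)
    (h : Nonempty (((A ⧸ I) →ₗ[A] ((localCohomology J j).obj (ModuleCat.of A A))) ≃ₗ[A]
      (Fin n → A ⧸ I))) :
    Nonempty (((B ⧸ I.map f) →ₗ[B] ((localCohomology (J.map f) j).obj (ModuleCat.of B B))) ≃ₗ[B]
      (Fin n → B ⧸ I.map f)) := by
  algebraize [f]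
  obtain ⟨e⟩ := h
  exact ⟨(homQuotientBaseChangeEquiv I (localCohomologyBaseChangeEquiv B J j)).symm ≪≫ₗ
    e.baseChange A B ≪≫ₗ TensorProduct.piRight A B B _ ≪≫ₗ
    LinearEquiv.piCongrRight fun _ ↦
      (Algebra.TensorProduct.quotIdealMapEquivTensorQuot B I).toLinearEquiv.symm⟩

lemma Ideal.radical_map_frobenius {A : Type*} [CommRing A] (p : ℕ) [ExpChar A p] (J : Ideal A) :
    (J.map (frobenius A p)).radical = J.radical := by
  refine le_antisymm (Ideal.radical_mono (Ideal.map_le_iff_le_comap.mpr fun x hx ↦ ?_))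
    (Ideal.radical_le_radical_iff.mpr fun x hx ↦ ⟨p, Ideal.mem_map_of_mem (frobenius A p) hx⟩)
  exact Ideal.pow_mem_of_mem J hx p (expChar_pos A p)

lemma nonempty_hom_localCohomology_equiv_frobenius (p : ℕ) [ExpChar A p]
    (hf : (frobenius A p).Flat) (I J : Ideal A) (j n : ℕ)
    (h : Nonempty (((A ⧸ I) →ₗ[A] ((localCohomology J j).obj (ModuleCat.of A A))) ≃ₗ[A]
      (Fin n → A ⧸ I))) :
    Nonempty (((A ⧸ I.map (frobenius A p)) →ₗ[A]
      ((localCohomology J j).obj (ModuleCat.of A A))) ≃ₗ[A]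
      (Fin n → A ⧸ I.map (frobenius A p))) := by
  obtain ⟨e⟩ := nonempty_hom_localCohomology_equiv_of_flat hf I J j n h
  exact ⟨LinearEquiv.congrRight ((localCohomology.isoOfSameRadical
    (J.radical_map_frobenius p).symm j).app (ModuleCat.of A A)).toLinearEquiv ≪≫ₗ e⟩

end LocalCohomology

end HomBaseChange

section FrobeniusLength

universe u v

section LengthHom

variable {A : Type u} [CommRing A] (H : Type v) [AddCommGroup H] [Module A H]

lemma Module.length_linearMap_le_add {M : Type*} [AddCommGroup M] [Module A M]
    (N : Submodule A M) :
    Module.length A (M →ₗ[A] H) ≤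
      Module.length A ((M ⧸ N) →ₗ[A] H) + Module.length A (N →ₗ[A] H) := by
  have hl : Function.Injective (LinearMap.lcomp A H N.mkQ) := fun f g hfg ↦
    Submodule.linearMap_qext _ hfg
  have he : Function.Exact (LinearMap.lcomp A H N.mkQ)
      (LinearMap.lcomp A H N.subtype).rangeRestrict := by
    intro f
    rw [← LinearMap.mem_ker, LinearMap.ker_rangeRestrict, LinearMap.mem_ker]
    constructor
    · intro h
      have hN : N ≤ LinearMap.ker f := fun x hx ↦ LinearMap.congr_fun h ⟨x, hx⟩
      exact ⟨N.liftQ f hN, N.liftQ_mkQ f hN⟩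
    · rintro ⟨g, rfl⟩
      ext x
      simp [(Submodule.Quotient.mk_eq_zero N).mpr x.2]
  rw [Module.length_eq_add_of_exact _ _ hl (LinearMap.surjective_rangeRestrict _) he]
  gcongr
  exact Module.length_le_of_injective _ (Submodule.subtype_injective _)

lemma Module.length_linearMap_le_of_surjective {M P : Type*} [AddCommGroup M] [Module A M]
    [AddCommGroup P] [Module A P] (f : M →ₗ[A] P) (hf : Function.Surjective f) :
    Module.length A (P →ₗ[A] H) ≤ Module.length A (M →ₗ[A] H) :=
  Module.length_le_of_injective (LinearMap.lcomp A H f) fun _ _ hgh ↦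
    (LinearMap.cancel_right hf).mp hgh

variable [IsLocalRing A]

lemma Module.length_linearMap_le_of_isFiniteLength {n : ℕ∞}
    (hn : Module.length A ((A ⧸ IsLocalRing.maximalIdeal A) →ₗ[A] H) ≤ n) (M : Type*)
    [AddCommGroup M] [Module A M] (hM : IsFiniteLength A M) :
    Module.length A (M →ₗ[A] H) ≤ n * Module.length A M := by
  induction hM with
  | of_subsingleton => simp [Module.length_eq_zero]
  | @of_simple_quotient M _ _ N _ _ ih =>
    rw [Module.length_eq_add_of_exact N.subtype N.mkQ N.subtype_injective N.mkQ_surjective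
      (LinearMap.exact_subtype_mkQ N), Module.length_eq_one A (M ⧸ N), mul_add, mul_one, add_comm]
    refine (Module.length_linearMap_le_add H N).trans (add_le_add ?_ ih)
    obtain ⟨I, hI, ⟨e⟩⟩ := isSimpleModule_iff_quot_maximal.mp ‹IsSimpleModule A (M ⧸ N)›
    obtain rfl := IsLocalRing.eq_maximalIdeal hI
    rwa [(LinearEquiv.congrLeft H A e).length_eq]


lemma IsFiniteLength.of_pow_maximalIdeal_smul [IsNoetherianRing A] (M : Type*) [AddCommGroup M]
    [Module A M] [Module.Finite A M] (c : ℕ)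
    (hc : Module.IsTorsionBySet A M (IsLocalRing.maximalIdeal A ^ c : Ideal A)) :
    IsFiniteLength A M := by
  let B := A ⧸ IsLocalRing.maximalIdeal A ^ c
  have hB : IsArtinianRing B := by
    refine isArtinianRing_iff_krullDimLE_zero.mpr (Ring.KrullDimLE.mk₀ fun P hP ↦ ?_)
    have hcomap : IsLocalRing.maximalIdeal A =
        P.comap (Ideal.Quotient.mk (IsLocalRing.maximalIdeal A ^ c)) := by
      refine (IsLocalRing.maximalIdeal.isMaximal A).eq_of_le (Ideal.comap_ne_top _ hP.ne_top)
        (Ideal.IsPrime.le_of_pow_le (n := c) fun x hx ↦ ?_)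
      rw [Ideal.mem_comap, Ideal.Quotient.eq_zero_iff_mem.mpr hx]
      exact P.zero_mem
    have := IsLocalRing.maximalIdeal.isMaximal A
    rw [hcomap] at this
    rw [← Ideal.map_comap_of_surjective _ Ideal.Quotient.mk_surjective P]
    exact (Ideal.map_eq_top_or_isMaximal_of_surjective _ Ideal.Quotient.mk_surjective
      this).resolve_left fun h ↦ hP.ne_top <| by
        rwa [Ideal.map_comap_of_surjective _ Ideal.Quotient.mk_surjective] at h
  let _ : Module B M := hc.module
  have : IsScalarTower A B M := hc.isScalarTower
  have : Module.Finite B M := .of_restrictScalars_finite A B M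
  rw [← Module.length_ne_top_iff, Module.length_eq_of_surjective (R := B)
    Ideal.Quotient.mk_surjective]
  exact Module.length_ne_top


lemma exists_maximalIdeal_pow_le_of_length_le [IsNoetherianRing A] (J : Ideal A) {L : ℕ∞}
    (hL : L ≠ ⊤)
    (h : ∀ t : ℕ, Module.length A (A ⧸ (J ⊔ IsLocalRing.maximalIdeal A ^ t)) ≤ L) :
    ∃ N : ℕ, IsLocalRing.maximalIdeal A ^ N ≤ J := by
  by_contra! hJ
  refine hL (ENat.eq_top_iff_forall_ge.mpr fun t ↦ le_trans ?_ (h t))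
  induction t with
  | zero => simp
  | succ t ih =>
    refine le_trans (add_le_add_left ih 1) ?_
    rw [Module.length_quotient, Module.length_quotient]
    refine Order.coheight_add_one_le (lt_of_le_of_ne
      (sup_le_sup_left (Ideal.pow_le_pow_right t.le_succ) J) fun heq ↦ hJ t ?_)
    refine Submodule.le_of_le_smul_of_le_jacobson_bot (I := IsLocalRing.maximalIdeal A)
      (IsNoetherian.noetherian _) (IsLocalRing.maximalIdeal_le_jacobson _) ?_
    rw [smul_eq_mul, ← pow_succ', heq]
    exact le_sup_right

end LengthHom

section Frobenius

variable {A : Type u} [CommRing A] [IsLocalRing A] (H : Type v) [AddCommGroup H] [Module A H]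

lemma nontrivial_linearMap_residue [Nontrivial H]
    (hH : ∀ h : H, ∃ t : ℕ, ∀ a ∈ IsLocalRing.maximalIdeal A ^ t, a • h = 0) :
    Nontrivial ((A ⧸ IsLocalRing.maximalIdeal A) →ₗ[A] H) := by
  classical
  obtain ⟨h, hh⟩ := exists_ne (0 : H)
  set t := Nat.find (hH h) with ht
  have hs := Nat.find_spec (hH h)
  have hpos : t ≠ 0 := fun h0 ↦ hh <| by
    refine (one_smul A h).symm.trans (hs 1 ?_)
    rw [← ht, h0, pow_zero, Ideal.one_eq_top]
    exact Submodule.mem_top (R := A) (x := (1 : A))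
  obtain ⟨u, hu⟩ := Nat.exists_eq_succ_of_ne_zero hpos
  have hmin := Nat.find_min (hH h) (m := u) (by omega)
  push Not at hmin
  obtain ⟨a, ha, hne⟩ := hmin
  refine ⟨(Submodule.liftQ _ (LinearMap.toSpanSingleton A H (a • h)) fun x hx ↦ ?_), 0,
    fun heq ↦ hne ?_⟩
  · rw [LinearMap.mem_ker, LinearMap.toSpanSingleton_apply, smul_smul]
    refine hs _ ?_
    rw [← ht, hu, pow_succ']
    exact Ideal.mul_mem_mul hx ha
  · have := LinearMap.congr_fun heq (Submodule.Quotient.mk 1)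
    rwa [Submodule.liftQ_apply, LinearMap.toSpanSingleton_apply, one_smul] at this


variable [IsNoetherianRing A]

lemma exists_linearEquiv_pi_residue (J : Ideal A) (hJ : J ≤ IsLocalRing.maximalIdeal A)
    (hfin : Module.Finite A ((A ⧸ J) →ₗ[A] H)) :
    ∃ n : ℕ, Nonempty (((A ⧸ IsLocalRing.maximalIdeal A) →ₗ[A] H) ≃ₗ[A]
      (Fin n → A ⧸ IsLocalRing.maximalIdeal A)) := by
  let K := A ⧸ IsLocalRing.maximalIdeal A
  let _ : Field K := Ideal.Quotient.field _
  have : Module.Finite A (K →ₗ[A] H) :=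
    Module.Finite.of_injective (LinearMap.lcomp A H (Submodule.factor hJ)) fun _ _ h ↦
      (LinearMap.cancel_right (Submodule.factor_surjective hJ)).mp h
  have ht : Module.IsTorsionBySet A (K →ₗ[A] H) (IsLocalRing.maximalIdeal A : Set A) := by
    intro f a
    refine LinearMap.ext fun x ↦ ?_
    obtain ⟨x, rfl⟩ := Ideal.Quotient.mk_surjective x
    rw [LinearMap.smul_apply, ← map_smul]
    have : (a : A) • Ideal.Quotient.mk (IsLocalRing.maximalIdeal A) x = 0 :=
      Ideal.Quotient.eq_zero_iff_mem.mpr (Ideal.mul_mem_right x _ a.2)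
    rw [this, map_zero, LinearMap.zero_apply]
  let _ : Module K (K →ₗ[A] H) := ht.module
  have : IsScalarTower A K (K →ₗ[A] H) := ht.isScalarTower
  have : Module.Finite K (K →ₗ[A] H) := .of_restrictScalars_finite A K _
  exact ⟨_, ⟨(Module.finBasis K (K →ₗ[A] H)).equivFun.restrictScalars A⟩⟩

lemma Ideal.map_frobenius_le_mul_self {A : Type*} [CommRing A] (p : ℕ) [Fact p.Prime] [CharP A p]
    (I : Ideal A) : I.map (frobenius A p) ≤ I * I := by
  refine Ideal.map_le_iff_le_comap.mpr fun x hx ↦ ?_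
  rw [Ideal.mem_comap, frobenius_def, ← pow_two]
  exact Ideal.pow_le_pow_right (Fact.out : p.Prime).two_le (Ideal.pow_mem_pow hx p)

/-- A module over a local ring of characteristic `p`, all of whose elements are killed by a power
of the maximal ideal, and whose `Hom` from `A ⧸ J` is finite, forces `J` to be primary to the
maximal ideal, as soon as it is compatible with Frobenius. -/
lemma exists_maximalIdeal_pow_le_of_frobenius (p : ℕ) [Fact p.Prime] [CharP A p] (J : Ideal A)
    (hJ : J ≤ IsLocalRing.maximalIdeal A) (hfin : Module.Finite A ((A ⧸ J) →ₗ[A] H))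
    [Nontrivial H] (hH : ∀ h : H, ∃ t : ℕ, ∀ a ∈ IsLocalRing.maximalIdeal A ^ t, a • h = 0)
    (hF : ∀ (I : Ideal A) (n : ℕ), Nonempty (((A ⧸ I) →ₗ[A] H) ≃ₗ[A] (Fin n → A ⧸ I)) →
      Nonempty (((A ⧸ I.map (frobenius A p)) →ₗ[A] H) ≃ₗ[A]
        (Fin n → A ⧸ I.map (frobenius A p)))) :
    ∃ N : ℕ, IsLocalRing.maximalIdeal A ^ N ≤ J := by
  set m := IsLocalRing.maximalIdeal A with hm
  have hfl (I : Ideal A) (hI : ∃ c, m ^ c ≤ I) (M : Type u) [AddCommGroup M] [Module A M]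
      [Module.Finite A M] (ht : Module.IsTorsionBySet A M I) : IsFiniteLength A M :=
    hI.elim fun c hc ↦ .of_pow_maximalIdeal_smul M c fun x a ↦ @ht x ⟨a, hc a.2⟩
  have htor (I : Ideal A) : Module.IsTorsionBySet A (A ⧸ I) I := by
    intro x a
    obtain ⟨x, rfl⟩ := Ideal.Quotient.mk_surjective x
    exact Ideal.Quotient.eq_zero_iff_mem.mpr (Ideal.mul_mem_right x _ a.2)
  obtain ⟨n, hn⟩ := exists_linearEquiv_pi_residue H J hJ hfin
  have := nontrivial_linearMap_residue H hH
  have hn0 : n ≠ 0 := by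
    rintro rfl
    exact not_subsingleton _ hn.some.toEquiv.subsingleton
  let q : ℕ → Ideal A := fun e ↦ (Ideal.map (frobenius A p))^[e] m
  have hq (e : ℕ) : q (e + 1) = (q e).map (frobenius A p) := Function.iterate_succ_apply' ..
  have hqn (e : ℕ) : Nonempty (((A ⧸ q e) →ₗ[A] H) ≃ₗ[A] (Fin n → A ⧸ q e)) := by
    induction e with
    | zero => exact hn
    | succ e ih => rw [hq]; exact hF _ _ ih
  have hqle (e : ℕ) : q e ≤ m ^ (e + 1) := by
    induction e with
    | zero => simp [q]
    | succ e ih =>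
      rw [hq]
      refine (Ideal.map_frobenius_le_mul_self p _).trans ((Ideal.mul_mono ih ih).trans ?_)
      rw [← pow_add]
      exact Ideal.pow_le_pow_right (by omega)
  have hqrad (e : ℕ) : (q e).radical = m := by
    induction e with
    | zero => exact (IsLocalRing.maximalIdeal.isMaximal A).isPrime.radical
    | succ e ih => rw [hq, Ideal.radical_map_frobenius, ih]
  have hqpow (e : ℕ) : ∃ c, m ^ c ≤ q e :=
    Ideal.exists_pow_le_of_le_radical_of_fg (hqrad e).ge (IsNoetherian.noetherian _)
  have hnm : Module.length A ((A ⧸ m) →ₗ[A] H) ≤ n := by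
    have hfield : IsSimpleModule A (A ⧸ m) :=
      isSimpleModule_iff_isCoatom.mpr (IsLocalRing.maximalIdeal.isMaximal A).out
    rw [hn.some.length_eq, Module.length_pi_of_fintype]
    simp
  have hbound (e : ℕ) : Module.length A (A ⧸ (J ⊔ q e)) ≤ Module.length A ((A ⧸ J) →ₗ[A] H) := by
    have hfq : IsFiniteLength A (A ⧸ q e) := hfl (q e) (hqpow e) _ (htor _)
    let N : Submodule A (A ⧸ q e) := Submodule.map (q e).mkQ (J ⊔ q e)
    have hfN : IsFiniteLength A N := hfq.of_injective N.subtype_injective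
    let ε : ((A ⧸ q e) ⧸ N) ≃ₗ[A] A ⧸ (J ⊔ q e) :=
      Submodule.quotientQuotientEquivQuotient (q e) (J ⊔ q e) le_sup_right
    have h₁ := Module.length_linearMap_le_add H N
    rw [(hqn e).some.length_eq, Module.length_pi_of_fintype, Finset.sum_const, Finset.card_univ,
      Fintype.card_fin, nsmul_eq_mul,
      Module.length_eq_add_of_exact N.subtype N.mkQ N.subtype_injective N.mkQ_surjective
      (LinearMap.exact_subtype_mkQ N), mul_add, add_comm, ε.length_eq] at h₁
    have h₂ := Module.length_linearMap_le_of_isFiniteLength H hnm N hfN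
    have h₃ := Module.length_linearMap_le_of_surjective H
      (ε.symm.toLinearMap ∘ₗ Submodule.factor (le_sup_left : J ≤ J ⊔ q e))
      (ε.symm.surjective.comp (Submodule.factor_surjective _))
    have hne : (n : ℕ∞) * Module.length A N ≠ ⊤ :=
      WithTop.mul_ne_top (ENat.natCast_ne_top n) (Module.length_ne_top_iff.mpr hfN)
    refine le_trans ?_ ((WithTop.add_le_add_iff_right hne).mp (h₁.trans (add_le_add h₃ h₂)))
    exact le_mul_of_one_le_left zero_le (by exact_mod_cast Nat.one_le_iff_ne_zero.mpr hn0)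
  have hkill : ∃ c, Module.IsTorsionBySet A ((A ⧸ J) →ₗ[A] H) (m ^ c : Ideal A) := by
    obtain ⟨s, hs⟩ := hfin.fg_top
    choose t ht using hH
    refine ⟨s.sup fun f ↦ t (f 1), ?_⟩
    rw [Module.isTorsionBySet_iff_torsionBySet_eq_top, eq_top_iff, ← hs, Submodule.span_le]
    intro f hf
    rw [SetLike.mem_coe, Submodule.mem_torsionBySet_iff]
    rintro ⟨a, ha⟩
    refine LinearMap.ext fun x ↦ ?_
    obtain ⟨x, rfl⟩ := Ideal.Quotient.mk_surjective x
    have : Ideal.Quotient.mk J x = x • 1 := by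
      rw [Algebra.smul_def, mul_one]
      rfl
    rw [this, map_smul, LinearMap.smul_apply, LinearMap.zero_apply, ht (f 1) a
      (Ideal.pow_le_pow_right (Finset.le_sup (f := fun f : (A ⧸ J) →ₗ[A] H ↦ t (f 1)) hf) ha),
      smul_zero]
  obtain ⟨c, hc⟩ := hkill
  refine exists_maximalIdeal_pow_le_of_length_le J
    (Module.length_ne_top_iff.mpr (.of_pow_maximalIdeal_smul _ c hc)) fun t ↦ le_trans ?_ (hbound t)
  have hle : J ⊔ q t ≤ J ⊔ m ^ t :=
    sup_le_sup_left ((hqle t).trans (Ideal.pow_le_pow_right t.le_succ)) J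
  exact Module.length_le_of_surjective _ (Submodule.factor_surjective hle)

end Frobenius

end FrobeniusLength

section MinimalSupport

open TensorProduct

variable {R : Type*} [CommRing R] (Q : Ideal R) [Q.IsPrime]

lemma mem_minimalPrimes_of_maximalIdeal_pow_le (I : Ideal R) (hI : I ≤ Q) (N : ℕ)
    (h : IsLocalRing.maximalIdeal (Localization.AtPrime Q) ^ N ≤
      I.map (algebraMap R (Localization.AtPrime Q))) : Q ∈ I.minimalPrimes := by
  refine ⟨⟨inferInstance, hI⟩, fun P ⟨hP, hIP⟩ hPQ ↦ ?_⟩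
  have hd : Disjoint (Q.primeCompl : Set R) P :=
    Set.disjoint_left.mpr fun x hx hxP ↦ hx (hPQ hxP)
  have := IsLocalization.isPrime_of_isPrime_disjoint Q.primeCompl (Localization.AtPrime Q) P hP hd
  have hle := Ideal.IsPrime.le_of_pow_le (h.trans (Ideal.map_mono hIP))
  rw [← Localization.AtPrime.map_eq_maximalIdeal, Ideal.map_le_iff_le_comap] at hle
  exact hle.trans_eq
    (IsLocalization.under_map_of_isPrime_disjoint Q.primeCompl (Localization.AtPrime Q) hP hd)

lemma nontrivial_localization_tensorProduct
    (M : Type*) [AddCommGroup M] [Module R M]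
    (h : (⟨Q, inferInstance⟩ : PrimeSpectrum R) ∈ Module.support R M) :
    Nontrivial (Localization.AtPrime Q ⊗[R] M) := by
  obtain ⟨m, hm⟩ := Module.mem_support_iff'.mp h
  refine ⟨1 ⊗ₜ m, 0, fun h0 ↦ ?_⟩
  obtain ⟨s, hs⟩ := (IsLocalizedModule.eq_zero_iff Q.primeCompl
    (TensorProduct.mk R (Localization.AtPrime Q) M 1)).mp h0
  exact hm s s.2 hs

variable [IsNoetherianRing R]

lemma exists_maximalIdeal_pow_le_map_of_eq (J : Ideal R)
    (h : ∀ P : Ideal R, P.IsPrime → J ≤ P → P ≤ Q → P = Q) :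
    ∃ t : ℕ, IsLocalRing.maximalIdeal (Localization.AtPrime Q) ^ t ≤
      J.map (algebraMap R (Localization.AtPrime Q)) := by
  refine Ideal.exists_pow_le_of_le_radical_of_fg ?_ (IsNoetherian.noetherian _)
  rw [Ideal.radical_eq_sInf]
  refine le_sInf fun P ⟨hP, hPp⟩ ↦ ?_
  have hQ : P.comap (algebraMap R (Localization.AtPrime Q)) = Q := by
    refine h _ (hPp.comap _) (Ideal.map_le_iff_le_comap.mp hP) ?_
    refine (Ideal.comap_mono (IsLocalRing.le_maximalIdeal hPp.ne_top)).trans_eq ?_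
    exact IsLocalization.AtPrime.under_maximalIdeal _ Q
  rw [← Localization.AtPrime.map_eq_maximalIdeal]
  exact Ideal.map_le_iff_le_comap.mpr hQ.ge

variable (M : Type*) [AddCommGroup M] [Module R M]

lemma exists_maximalIdeal_pow_smul_eq_zero_of_minimal_support
    (h : ∀ P : PrimeSpectrum R, P ∈ Module.support R M → P.asIdeal ≤ Q → P.asIdeal = Q)
    (x : Localization.AtPrime Q ⊗[R] M) :
    ∃ t : ℕ, ∀ a ∈ IsLocalRing.maximalIdeal (Localization.AtPrime Q) ^ t, a • x = 0 := by
  obtain ⟨⟨y, s⟩, hs⟩ := IsLocalizedModule.surj Q.primeCompl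
    (TensorProduct.mk R (Localization.AtPrime Q) M 1) x
  obtain ⟨t, ht⟩ := exists_maximalIdeal_pow_le_map_of_eq Q (R ∙ y).annihilator fun P hP hle ↦
    h ⟨P, hP⟩ (Module.mem_support_iff_exists_annihilator.mpr ⟨y, hle⟩)
  have hy : (R ∙ y).annihilator.map (algebraMap R (Localization.AtPrime Q)) ≤
      Ideal.torsionOf _ _ ((1 : Localization.AtPrime Q) ⊗ₜ[R] y) := by
    refine Ideal.map_le_iff_le_comap.mpr fun r hr ↦ ?_
    rw [Submodule.mem_annihilator_span_singleton] at hr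
    rw [Ideal.mem_comap, Ideal.mem_torsionOf_iff, algebraMap_smul, ← tmul_smul, hr, tmul_zero]
  refine ⟨t, fun a ha ↦ ?_⟩
  have h0 : a • ((1 : Localization.AtPrime Q) ⊗ₜ[R] y) = 0 :=
    (Ideal.mem_torsionOf_iff _ _).mp (hy (ht ha))
  refine IsLocalizedModule.smul_injective (TensorProduct.mk R (Localization.AtPrime Q) M 1) s ?_
  simp only
  rw [smul_comm, hs, smul_zero]
  exact h0

lemma exists_minimal_mem_support [Nontrivial M] :
    ∃ P : PrimeSpectrum R, P ∈ Module.support R M ∧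
      ∀ P' : PrimeSpectrum R, P' ∈ Module.support R M → P'.asIdeal ≤ P.asIdeal →
        P'.asIdeal = P.asIdeal := by
  obtain ⟨P, hP, hmin⟩ := exists_minimalFor_of_wellFoundedLT (· ∈ Module.support R M)
    (fun P : PrimeSpectrum R ↦ Order.height P) (Module.nonempty_support_of_nontrivial (R := R))
  refine ⟨P, hP, fun P' hP' hle ↦ by_contra fun hne ↦ ?_⟩
  have hlt : P' < P := lt_of_le_of_ne hle fun h ↦ hne congr(($h).asIdeal)
  have hfin : Order.height P' < ⊤ := by
    rw [← P'.height_eq_orderHeight]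
    exact Ideal.height_lt_top_of_isPrime
  exact ((Order.height_strictMono hlt hfin).trans_le
    (hmin hP' (Order.height_mono hle))).false

end MinimalSupport

/-- **Huneke–Koh.** Let `R` be a regular local ring (regularity: the maximal ideal is generated
by `dim R` many elements) containing a field of prime characteristic `p`, let `I` be an ideal,
and let `b` be the biggest height of any minimal prime of `I`.  If `j > b` is such that
`Hom_R(R/I, H^j_I(R))` is a finitely generated `R`-module, then `H^j_I(R) = 0`. -/
theorem huneke_koh_cofiniteness
    (R : Type) [CommRing R] [IsNoetherianRing R] [IsLocalRing R]
    (hreg : ∃ s : Finset R, Ideal.span (s : Set R) = IsLocalRing.maximalIdeal R ∧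
      (s.card : WithBot ℕ∞) = ringKrullDim R)
    (p : ℕ) (hp : p.Prime) [CharP R p]
    (k : Type) [Field k] [Algebra k R]
    (I : Ideal R) (b : ℕ)
    (hbub : ∀ P : PrimeSpectrum R, P.asIdeal ∈ I.minimalPrimes → Order.height P ≤ (b : ℕ∞))
    (hbmax : ∃ P : PrimeSpectrum R, P.asIdeal ∈ I.minimalPrimes ∧ Order.height P = (b : ℕ∞))
    (j : ℕ) (hj : b < j)
    (hfin : Module.Finite R
      ((R ⧸ I) →ₗ[R] ((localCohomology I j).obj (ModuleCat.of R R)))) :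
    Subsingleton ((localCohomology I j).obj (ModuleCat.of R R)) := by
  by_contra hH
  rw [not_subsingleton_iff_nontrivial] at hH
  have : Fact p.Prime := ⟨hp⟩
  obtain ⟨s, hs, hc⟩ := hreg
  obtain ⟨Q, hQ, hmin⟩ := exists_minimal_mem_support (R := R)
    ((localCohomology I j).obj (ModuleCat.of R R))
  let A := Localization.AtPrime Q.asIdeal
  let J := I.map (algebraMap R A)
  let e := localCohomologyBaseChangeEquiv A I j
  obtain ⟨_, rs, hrs, hrsm⟩ := isDomain_and_exists_isWeaklyRegular_of_card_le R s hs le_rfl hc.symm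
  have : CharP A p := charP_of_injective_algebraMap
    (IsLocalization.injective A Q.asIdeal.primeCompl_le_nonZeroDivisors) p
  have hflat : (frobenius A p).Flat := frobenius_flat_of_isLocalization A Q.asIdeal.primeCompl p
    (frobenius_flat_of_card_le p s hs hc)
  have hnt : Nontrivial ((localCohomology J j).obj (ModuleCat.of A A)) :=
    have := nontrivial_localization_tensorProduct Q.asIdeal _ hQ
    e.symm.toEquiv.nontrivial
  have hJ : J ≤ IsLocalRing.maximalIdeal A := by
    refine IsLocalRing.le_maximalIdeal fun htop ↦ not_subsingleton
      ((localCohomology J j).obj (ModuleCat.of A A)) ?_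
    rw [htop]
    exact subsingleton_localCohomology_top j (by omega) _
  obtain ⟨N, hN⟩ := exists_maximalIdeal_pow_le_of_frobenius _ p J hJ
    (finite_hom_localCohomology_of_flat
      (RingHom.flat_algebraMap_iff.mpr (IsLocalization.flat A Q.asIdeal.primeCompl)) I I j hfin)
    (fun h ↦ by
      obtain ⟨t, ht⟩ := exists_maximalIdeal_pow_smul_eq_zero_of_minimal_support Q.asIdeal _ hmin
        (e.symm h)
      exact ⟨t, fun a ha ↦ e.symm.injective (by rw [map_smul, ht a ha, map_zero])⟩)
    (fun 𝔞 n ↦ nonempty_hom_localCohomology_equiv_frobenius p hflat 𝔞 J j n)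
  have hIQ : I ≤ Q.asIdeal := by
    refine (Ideal.map_le_iff_le_comap.mp hJ).trans_eq ?_
    exact IsLocalization.AtPrime.under_maximalIdeal _ Q.asIdeal
  have hQmin := mem_minimalPrimes_of_maximalIdeal_pow_le Q.asIdeal I hIQ N hN
  have hdim : ringKrullDim A < j := by
    rw [IsLocalization.AtPrime.ringKrullDim_eq_height Q.asIdeal A, Q.height_eq_orderHeight]
    have := (hbub Q hQmin).trans_lt (Nat.cast_lt.mpr hj)
    exact_mod_cast this
  obtain ⟨n, hn⟩ := exists_hasInjectiveDimensionLE_of_maximalIdeal_eq_ofList rs hrs hrsm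
  exact not_subsingleton _ (subsingleton_localCohomology_of_ringKrullDim_lt J j hdim
    ⟨n, hasInjectiveDimensionLE_localization Q.asIdeal.primeCompl n hn⟩)
end

section
/- (Marley) Let (A,m) be a commutative Noetherian local ring with dim A ≤ 3. Then for every ideal I of A, every finitely generated A-module M, and every integer j, the set of associated primes Ass_A(H^j_I(M)) is finite. -/
open CategoryTheory

namespace localCohomology

variable {A : Type} [CommRing A]

/-- The map of complexes `Hom(P, Y) ⟶ Hom(Q, Y)` induced by a map of resolutions. -/
noncomputable def yonedaMap {X X' : ModuleCat.{0} A} {P : ProjectiveResolution X}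
    {P' : ProjectiveResolution X'} (Φ : P'.complex ⟶ P.complex) (Y : ModuleCat.{0} A) :
    P.complex.linearYonedaObj A Y ⟶ P'.complex.linearYonedaObj A Y :=
  (HomologicalComplex.unopFunctor _ _).map
    ((((linearYoneda A (ModuleCat.{0} A)).obj Y).rightOp.mapHomologicalComplex _).map Φ).op

lemma comp_eq_of_squares {C : Type*} [Category* C] {E₁ E₂ L₁ L₂ R₁ R₂ : C} {α : E₁ ⟶ E₂}
    {l₁ : E₁ ⟶ L₁} {l₂ : E₂ ⟶ L₂} {β : L₁ ⟶ L₂} {r₁ : R₁ ≅ L₁} {r₂ : R₂ ≅ L₂} {γ : R₁ ⟶ R₂}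
    (h₁ : α ≫ l₂ = l₁ ≫ β) (h₂ : r₁.hom ≫ β = γ ≫ r₂.hom) :
    α ≫ (l₂ ≫ r₂.inv) = (l₁ ≫ r₁.inv) ≫ γ := by
  rw [← Category.assoc, h₁, Category.assoc, Category.assoc]
  congr 1
  rw [Iso.comp_inv_eq, Category.assoc, ← h₂, Iso.inv_hom_id_assoc]

lemma isoExt_naturality {X X' : ModuleCat.{0} A} (φ : X' ⟶ X) (P : ProjectiveResolution X)
    (P' : ProjectiveResolution X') (Φ : P'.complex ⟶ P.complex)
    (comm : Φ.f 0 ≫ P.π.f 0 = P'.π.f 0 ≫ φ) (n : ℕ) (Y : ModuleCat.{0} A) :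
    ((Ext A (ModuleCat.{0} A) n).map φ.op).app Y ≫ (P'.isoExt n Y).hom =
      (P.isoExt n Y).hom ≫ HomologicalComplex.homologyMap (yonedaMap Φ Y) n :=
  comp_eq_of_squares (β := (((((linearYoneda A (ModuleCat A)).obj Y).rightOp.mapHomologicalComplex
      (ComplexShape.down ℕ)) ⋙ HomologicalComplex.homologyFunctor (ModuleCat A)ᵒᵖ
        (ComplexShape.down ℕ) n).map Φ).unop)
    (l₁ := (P.isoLeftDerivedObj ((linearYoneda A (ModuleCat A)).obj Y).rightOp n).inv.unop)
    (l₂ := (P'.isoLeftDerivedObj ((linearYoneda A (ModuleCat A)).obj Y).rightOp n).inv.unop)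
    (r₁ := ((P.complex.linearYonedaObj A Y).homologyOp n).unop)
    (r₂ := ((P'.complex.linearYonedaObj A Y).homologyOp n).unop)
    (congrArg Quiver.Hom.unop (ProjectiveResolution.isoLeftDerivedObj_inv_naturality φ P' P
      Φ comm ((linearYoneda A (ModuleCat.{0} A)).obj Y).rightOp n))
    (congrArg Quiver.Hom.unop (HomologicalComplex.homologyOp_hom_naturality (yonedaMap Φ Y) n))

/-- The cochain `f` is a cocycle representing the class `x`. -/
def RepresentsExt {X : ModuleCat.{0} A} (P : ProjectiveResolution X) {n : ℕ} {Y : ModuleCat.{0} A}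
    (x : ((Ext A (ModuleCat.{0} A) n).obj (Opposite.op X)).obj Y) (f : P.complex.X n ⟶ Y) : Prop :=
  ∃ z : (P.complex.linearYonedaObj A Y).cycles n,
    (P.complex.linearYonedaObj A Y).homologyπ n z = (P.isoExt (R := A) n Y).hom x ∧
      (P.complex.linearYonedaObj A Y).iCycles n z = f

lemma exists_representsExt {X : ModuleCat.{0} A} (P : ProjectiveResolution X) {n : ℕ}
    {Y : ModuleCat.{0} A} (x : ((Ext A (ModuleCat.{0} A) n).obj (Opposite.op X)).obj Y) :
    ∃ f : P.complex.X n ⟶ Y, P.complex.d (n + 1) n ≫ f = 0 ∧ RepresentsExt P x f := by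
  set K := P.complex.linearYonedaObj A Y
  obtain ⟨z, hz⟩ := (ModuleCat.epi_iff_surjective _).1 (inferInstance :
    Epi (K.homologyπ n)) ((P.isoExt n Y).hom x)
  exact ⟨K.iCycles n z, congr($(K.iCycles_d n (n + 1)) z), z, hz, rfl⟩

lemma exists_ext_representsExt {X : ModuleCat.{0} A} (P : ProjectiveResolution X) {n : ℕ}
    {Y : ModuleCat.{0} A} (f : P.complex.X n ⟶ Y) (hf : P.complex.d (n + 1) n ≫ f = 0) :
    ∃ x : ((Ext A (ModuleCat.{0} A) n).obj (Opposite.op X)).obj Y, RepresentsExt P x f := by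
  set K := P.complex.linearYonedaObj A Y
  have h : (ShortComplex.mk _ _ (K.iCycles_d n (n + 1))).Exact :=
    ShortComplex.exact_of_f_is_kernel _ (K.cyclesIsKernel n (n + 1) (by simp))
  obtain ⟨z, hz⟩ := (ShortComplex.moduleCat_exact_iff _).1 h f hf
  refine ⟨(P.isoExt n Y).inv (K.homologyπ n z), z, ?_, hz⟩
  exact congr($((P.isoExt n Y).inv_hom_id) _).symm

/-- The pullback of a class vanishes if and only if the pullback of a representing cocycle is a
coboundary. -/
lemma RepresentsExt.map_smul_eq_zero_iff {X X' : ModuleCat.{0} A} {P : ProjectiveResolution X}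
    {n : ℕ} {Y : ModuleCat.{0} A} {x : ((Ext A (ModuleCat.{0} A) n).obj (Opposite.op X)).obj Y}
    {f : P.complex.X n ⟶ Y} (hx : RepresentsExt P x f) (φ : X' ⟶ X) (P' : ProjectiveResolution X')
    (Φ : P'.complex ⟶ P.complex) (comm : Φ.f 0 ≫ P.π.f 0 = P'.π.f 0 ≫ φ) (s : A) :
    ((Ext A (ModuleCat.{0} A) n).map φ.op).app Y (s • x) = 0 ↔
      ∃ (m : ℕ) (g : P'.complex.X m ⟶ Y), P'.complex.d n m ≫ g = s • (Φ.f n ≫ f) := by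
  obtain ⟨z, hz, rfl⟩ := hx
  set K := P.complex.linearYonedaObj A Y
  set K' := P'.complex.linearYonedaObj A Y
  have e₁ : (P'.isoExt n Y).hom (((Ext A (ModuleCat.{0} A) n).map φ.op).app Y (s • x)) =
      HomologicalComplex.homologyMap (yonedaMap Φ Y) n (s • K.homologyπ n z) := by
    rw [hz, ← map_smul]
    exact congr($(isoExt_naturality φ P P' Φ comm n Y) (s • x))
  have e₂ : K'.homologyι n (HomologicalComplex.homologyMap (yonedaMap Φ Y) n
      (s • K.homologyπ n z)) = K'.pOpcycles n (s • (yonedaMap Φ Y).f n (K.iCycles n z)) := by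
    simp only [map_smul]
    congr 1
    have h₁ := congr($(HomologicalComplex.homologyι_naturality (yonedaMap Φ Y) n)
      (K.homologyπ n z))
    have h₂ := congr($(K.homology_π_ι n) z)
    have h₃ := congr($(HomologicalComplex.p_opcyclesMap (yonedaMap Φ Y) n) (K.iCycles n z))
    simp only [ConcreteCategory.comp_apply] at h₁ h₂ h₃
    exact h₁.trans ((congrArg _ h₂).trans h₃)
  have i₁ : Function.Injective (P'.isoExt (R := A) n Y).hom :=
    (ModuleCat.mono_iff_injective (P'.isoExt (R := A) n Y).hom).1 inferInstance
  have i₂ : Function.Injective (K'.homologyι n) :=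
    (ModuleCat.mono_iff_injective (K'.homologyι n)).1 inferInstance
  rw [← map_eq_zero_iff _ i₁, e₁, ← map_eq_zero_iff _ i₂, e₂]
  refine (ShortComplex.moduleCat_pOpcycles_eq_zero_iff (K'.sc n) _).trans ⟨?_, ?_⟩
  · rintro ⟨g, hg⟩
    exact ⟨_, g, hg⟩
  · rintro ⟨m, g, hg⟩
    by_cases hm : m + 1 = n
    · obtain rfl : (ComplexShape.up ℕ).prev n = m := (ComplexShape.up ℕ).prev_eq' hm
      exact ⟨g, hg⟩
    · rw [P'.complex.shape _ _ hm, Limits.zero_comp] at hg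
      exact ⟨0, (map_zero _).trans hg⟩


/-- The module `A ⧸ I ^ k`. -/
abbrev quotPow (I : Ideal A) (k : ℕ) : ModuleCat.{0} A :=
  (ringModIdeals (idealPowersDiagram I)).obj (Opposite.op k)

/-- The transition map `A ⧸ I ^ l ⟶ A ⧸ I ^ k`. -/
abbrev quotPowMap (I : Ideal A) {k l : ℕ} (h : k ≤ l) : quotPow I l ⟶ quotPow I k :=
  (ringModIdeals (idealPowersDiagram I)).map (homOfLE h).op

/-- A projective resolution of `A ⧸ I ^ k`. -/
noncomputable abbrev res (I : Ideal A) (k : ℕ) : ProjectiveResolution (quotPow I k) :=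
  projectiveResolution _

/-- The cochain `f` represents the class `h`, as far as annihilators are concerned. -/
def Represents (I : Ideal A) {j : ℕ} {M : ModuleCat.{0} A} (h : (localCohomology I j).obj M)
    {k : ℕ} (f : (res I k).complex.X j ⟶ M) : Prop :=
  ∀ s : A, s • h = 0 ↔ ∃ (l : ℕ) (w : k ≤ l) (Φ : (res I l).complex ⟶ (res I k).complex),
    Φ.f 0 ≫ (res I k).π.f 0 = (res I l).π.f 0 ≫ quotPowMap I w ∧
      ∃ (m : ℕ) (g : (res I l).complex.X m ⟶ M), (res I l).complex.d j m ≫ g = s • (Φ.f j ≫ f)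

variable {I : Ideal A} {j : ℕ} {M : ModuleCat.{0} A}

/-- The local cohomology of `M` as a colimit of modules. -/
noncomputable def isColimit (I : Ideal A) (j : ℕ) (M : ModuleCat.{0} A) :
    Limits.IsColimit (((evaluation (ModuleCat.{0} A) (ModuleCat.{0} A)).obj M).mapCocone
      (Limits.colimit.cocone (diagram (idealPowersDiagram I) j))) :=
  Limits.isColimitOfPreserves _ (Limits.colimit.isColimit _)

lemma represents_ι {k : ℕ}
    {x : ((Ext A (ModuleCat.{0} A) j).obj (Opposite.op (quotPow I k))).obj M}
    {f : (res I k).complex.X j ⟶ M} (hx : RepresentsExt _ x f) :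
    Represents I (((Limits.colimit.ι (diagram (idealPowersDiagram I) j)
      (Opposite.op (Opposite.op k))).app M) x : (localCohomology I j).obj M) f := by
  intro s
  let F : (((Ext A (ModuleCat A) j).obj (Opposite.op (quotPow I k))).obj M) →ₗ[A]
      (localCohomology I j).obj M := ((Limits.colimit.ι (diagram (idealPowersDiagram I) j)
      (Opposite.op (Opposite.op k))).app M).hom
  have hι : F (s • x) = F 0 ↔ _ :=
    Limits.Concrete.isColimit_rep_eq_iff_exists _ (isColimit I j M)
      (i := Opposite.op (Opposite.op k)) (j := Opposite.op (Opposite.op k)) (s • x) 0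
  rw [map_smul, map_zero] at hι
  refine hι.trans ?_
  constructor
  · rintro ⟨⟨⟨l⟩⟩, φ, ψ, hφ⟩
    have w : k ≤ l := leOfHom φ.unop.unop
    obtain rfl : φ = (homOfLE w).op.op := rfl
    refine ⟨l, w, ProjectiveResolution.lift (quotPowMap I w) _ _,
      ProjectiveResolution.lift_commutes_zero _ _ _, ?_⟩
    rw [← hx.map_smul_eq_zero_iff (quotPowMap I w) _ _
      (ProjectiveResolution.lift_commutes_zero _ _ _)]
    exact hφ.trans (map_zero _)
  · rintro ⟨l, w, Φ, comm, hg⟩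
    rw [← hx.map_smul_eq_zero_iff (quotPowMap I w) _ _ comm] at hg
    exact ⟨Opposite.op (Opposite.op l), (homOfLE w).op.op, (homOfLE w).op.op,
      hg.trans (map_zero _).symm⟩

lemma exists_represents (h : (localCohomology I j).obj M) :
    ∃ (k : ℕ) (f : (res I k).complex.X j ⟶ M), (res I k).complex.d (j + 1) j ≫ f = 0 ∧
      Represents I h f := by
  obtain ⟨⟨⟨k⟩⟩, x, rfl⟩ := Limits.Concrete.isColimit_exists_rep _ (isColimit I j M) h
  obtain ⟨f, hf, hx⟩ := exists_representsExt (res I k) x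
  exact ⟨k, f, hf, represents_ι hx⟩

lemma exists_class {k : ℕ} (f : (res I k).complex.X j ⟶ M)
    (hf : (res I k).complex.d (j + 1) j ≫ f = 0) :
    ∃ h : (localCohomology I j).obj M, Represents I h f := by
  obtain ⟨x, hx⟩ := exists_ext_representsExt (res I k) f hf
  exact ⟨_, represents_ι hx⟩

section DimensionShift

lemma exists_comp_eq_of_succ {X M : ModuleCat.{0} A} (P : ProjectiveResolution X) {j : ℕ}
    {t : P.complex.X (j + 1) ⟶ M} (h : ∃ (m : ℕ) (g : P.complex.X m ⟶ M),
      P.complex.d (j + 1) m ≫ g = t) :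
    ∃ g : P.complex.X j ⟶ M, P.complex.d (j + 1) j ≫ g = t := by
  obtain ⟨m, g, hg⟩ := h
  by_cases hm : m + 1 = j + 1
  · obtain rfl : m = j := by omega
    exact ⟨g, hg⟩
  · rw [P.complex.shape _ _ hm, Limits.zero_comp] at hg
    exact ⟨0, by rw [Limits.comp_zero, hg]⟩

lemma exists_comp_eq_of_injective {X E M : ModuleCat.{0} A} [Injective E]
    (P : ProjectiveResolution X) {j : ℕ} (f : P.complex.X (j + 1) ⟶ M)
    (hf : P.complex.d (j + 2) (j + 1) ≫ f = 0) (i : M ⟶ E) :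
    ∃ g : P.complex.X j ⟶ E, P.complex.d (j + 1) j ≫ g = f ≫ i := by
  have hi : P.complex.d (j + 2) (j + 1) ≫ f ≫ i = 0 := by
    rw [← Category.assoc, hf, Limits.zero_comp]
  exact ⟨(P.exact_succ j).descToInjective (f ≫ i) hi,
    (P.exact_succ j).comp_descToInjective (f ≫ i) hi⟩

/-- The augmentation of a projective resolution. -/
noncomputable def aug {X : ModuleCat.{0} A} (P : ProjectiveResolution X) : P.complex.X 0 ⟶ X :=
  P.π.f 0

instance {X : ModuleCat.{0} A} (P : ProjectiveResolution X) : Epi (aug P) :=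
  inferInstanceAs (Epi (P.π.f 0))

lemma d_comp_aug {X : ModuleCat.{0} A} (P : ProjectiveResolution X) :
    P.complex.d 1 0 ≫ aug P = 0 :=
  P.complex_d_comp_π_f_zero

lemma exists_aug_comp_eq {X M : ModuleCat.{0} A} (P : ProjectiveResolution X)
    (f : P.complex.X 0 ⟶ M) (hf : P.complex.d 1 0 ≫ f = 0) :
    ∃ t : X ⟶ M, aug P ≫ t = f := by
  have : Epi (ShortComplex.mk _ _ P.complex_d_comp_π_f_zero).g :=
    inferInstanceAs (Epi (P.π.f 0))
  exact ⟨P.exact₀.desc f hf, P.exact₀.g_desc f hf⟩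

lemma exists_lift {T : ShortComplex (ModuleCat.{0} A)} (hT : T.ShortExact) {X : ModuleCat.{0} A}
    (u : X ⟶ T.X₂) (hu : u ≫ T.g = 0) : ∃ q : X ⟶ T.X₁, q ≫ T.f = u := by
  have := hT.mono_f
  exact ⟨hT.exact.lift u hu, hT.exact.lift_f u hu⟩

/-- Every element of `H^j_I(M)` is annihilated by an element of `S`. -/
def Van (S : Submonoid A) (I : Ideal A) (j : ℕ) (M : ModuleCat.{0} A) : Prop :=
  ∀ h : (localCohomology I j).obj M, ∃ s ∈ S, s • h = 0

variable {T : ShortComplex (ModuleCat.{0} A)} (hT : T.ShortExact) [Injective T.X₂]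
include hT

lemma Van.succ {S : Submonoid A} {I : Ideal A} {j : ℕ} (hV : Van S I (j + 1) T.X₃) :
    Van S I (j + 2) T.X₁ := by
  have := hT.mono_f
  have := hT.epi_g
  intro h
  obtain ⟨k, f, hf, hr⟩ := exists_represents h
  obtain ⟨g, hg⟩ := exists_comp_eq_of_injective (res I k) f hf T.f
  obtain ⟨h', hr'⟩ := exists_class (I := I) (g ≫ T.g)
    (by rw [← Category.assoc, hg, Category.assoc, T.zero, Limits.comp_zero])
  obtain ⟨s, hs, hsh⟩ := hV h'
  obtain ⟨l, w, Φ, comm, hm⟩ := (hr' s).1 hsh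
  obtain ⟨g', hg'⟩ := exists_comp_eq_of_succ _ hm
  obtain ⟨g'', rfl⟩ : ∃ g'', g'' ≫ T.g = g' :=
    ⟨Projective.factorThru g' T.g, Projective.factorThru_comp g' T.g⟩
  obtain ⟨q, hq⟩ := exists_lift hT (s • (Φ.f (j + 1) ≫ g) - (res I l).complex.d (j + 1) j ≫ g'')
    (by
      rw [Preadditive.sub_comp, Linear.smul_comp, Category.assoc, Category.assoc, hg', sub_self])
  refine ⟨s, hs, (hr s).2 ⟨l, w, Φ, comm, j + 1, q, ?_⟩⟩
  rw [← cancel_mono T.f, Category.assoc, hq, Preadditive.comp_sub,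
    HomologicalComplex.d_comp_d_assoc, Limits.zero_comp, sub_zero, Linear.comp_smul,
    ← HomologicalComplex.Hom.comm_assoc, hg, Linear.smul_comp, Category.assoc]

omit hT [Injective T.X₂] in
lemma quotPow_hom_ext {I : Ideal A} {k : ℕ} {M : ModuleCat.{0} A} {f g : quotPow I k ⟶ M}
    (h : f (Ideal.Quotient.mk (I ^ k) 1 : A ⧸ I ^ k) =
      g (Ideal.Quotient.mk (I ^ k) 1 : A ⧸ I ^ k)) :
    f = g := by
  ext x
  obtain ⟨a, rfl⟩ := Ideal.Quotient.mk_surjective (I := I ^ k) x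
  have e : (Ideal.Quotient.mk (I ^ k) a) = a • (Ideal.Quotient.mk (I ^ k) 1 : A ⧸ I ^ k) := by
    rw [map_one]
    exact ((Algebra.smul_def a (1 : A ⧸ I ^ k)).trans (mul_one _)).symm
  have e₁ : ∀ f : quotPow I k ⟶ M, f (Ideal.Quotient.mk (I ^ k) a : A ⧸ I ^ k) =
      a • f (Ideal.Quotient.mk (I ^ k) 1 : A ⧸ I ^ k) := fun f => by
    rw [e]; exact map_smul f.hom a _
  exact (e₁ f).trans ((congrArg (a • ·) h).trans (e₁ g).symm)

omit hT [Injective T.X₂] in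
lemma smul_quotPow_hom_apply_one {I : Ideal A} {k : ℕ} {M : ModuleCat.{0} A} (f : quotPow I k ⟶ M)
    {a : A} (ha : a ∈ I ^ k) : a • f (Ideal.Quotient.mk (I ^ k) 1 : A ⧸ I ^ k) = 0 := by
  refine (map_smul f.hom a (Ideal.Quotient.mk (I ^ k) 1 : A ⧸ I ^ k)).symm.trans ?_
  have : a • (Ideal.Quotient.mk (I ^ k) 1 : A ⧸ I ^ k) = 0 := by
    rw [map_one]
    exact ((Algebra.smul_def a (1 : A ⧸ I ^ k)).trans (mul_one _)).trans
      (Ideal.Quotient.eq_zero_iff_mem.2 ha)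
  rw [this]
  exact map_zero f.hom

omit hT [Injective T.X₂] in
lemma exists_quotPow_hom {I : Ideal A} {k : ℕ} {M : ModuleCat.{0} A} (e : M)
    (he : ∀ a ∈ I ^ k, a • e = 0) :
    ∃ f : quotPow I k ⟶ M, f (Ideal.Quotient.mk (I ^ k) 1 : A ⧸ I ^ k) = e :=
  ⟨ModuleCat.ofHom (Submodule.liftQ _ (LinearMap.toSpanSingleton A M e) fun a ha => he a ha),
    one_smul A e⟩

omit hT [Injective T.X₂] in
/-- Annihilators in `H^0_I(M)` are annihilators of elements of `M`. -/
lemma exists_smul_eq_zero_iff_zero {I : Ideal A} {M : ModuleCat.{0} A}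
    (h : (localCohomology I 0).obj M) : ∃ m : M, ∀ s : A, s • h = 0 ↔ s • m = 0 := by
  obtain ⟨k, f, hf, hr⟩ := exists_represents h
  obtain ⟨t, rfl⟩ := exists_aug_comp_eq _ f hf
  refine ⟨t (Ideal.Quotient.mk (I ^ k) 1 : A ⧸ I ^ k), fun s => (hr s).trans ⟨?_, fun hs => ?_⟩⟩
  · rintro ⟨l, w, Φ, comm, m, g, hg⟩
    replace comm : Φ.f 0 ≫ aug (res I k) = aug (res I l) ≫ quotPowMap I w := comm
    rw [(res I l).complex.shape _ _ (by simp), Limits.zero_comp, ← Category.assoc, comm,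
      Category.assoc, ← Linear.comp_smul, ← Limits.comp_zero (f := aug (res I l)),
      cancel_epi] at hg
    exact congr($hg (Ideal.Quotient.mk (I ^ l) 1 : A ⧸ I ^ l)).symm
  · refine ⟨k, le_rfl, 𝟙 _, ?_, 0, 0, ?_⟩
    · have : quotPowMap I (le_refl k) = 𝟙 _ := quotPow_hom_ext rfl
      rw [this]
      exact (Category.id_comp _).trans (Category.comp_id _).symm
    · have : s • t = 0 := quotPow_hom_ext hs
      rw [Limits.comp_zero, HomologicalComplex.id_f, Category.id_comp, ← Linear.comp_smul, this,
        Limits.comp_zero]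

/-- `H^1_I(T.X₁)` is the cokernel of `Γ_I(T.X₂) → Γ_I(T.X₃)`, as far as annihilators are
concerned. -/
lemma exists_smul_eq_zero_iff_one {I : Ideal A} (h : (localCohomology I 1).obj T.X₁) :
    ∃ (c : T.X₃) (k : ℕ), (∀ a ∈ I ^ k, a • c = 0) ∧ ∀ s : A, s • h = 0 ↔
      ∃ e : T.X₂, (∃ l : ℕ, ∀ a ∈ I ^ l, a • e = 0) ∧ T.g e = s • c := by
  have := hT.mono_f
  have := hT.epi_g
  obtain ⟨k, f, hf, hr⟩ := exists_represents h
  obtain ⟨g, hg⟩ := exists_comp_eq_of_injective (res I k) f hf T.f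
  obtain ⟨t, ht⟩ := exists_aug_comp_eq (res I k) (g ≫ T.g)
    (by rw [← Category.assoc, hg, Category.assoc, T.zero, Limits.comp_zero])
  refine ⟨t (Ideal.Quotient.mk (I ^ k) 1 : A ⧸ I ^ k), k, fun a ha =>
    smul_quotPow_hom_apply_one t ha, fun s => (hr s).trans ⟨?_, ?_⟩⟩
  · rintro ⟨l, w, Φ, comm, hm⟩
    replace comm : Φ.f 0 ≫ aug (res I k) = aug (res I l) ≫ quotPowMap I w := comm
    obtain ⟨q, hq⟩ := exists_comp_eq_of_succ _ hm
    obtain ⟨v, hv⟩ := exists_aug_comp_eq (res I l) (s • (Φ.f 0 ≫ g) - q ≫ T.f) (by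
      rw [Preadditive.comp_sub, Linear.comp_smul, ← HomologicalComplex.Hom.comm_assoc, hg,
        reassoc_of% hq, Linear.smul_comp, Category.assoc, sub_self])
    refine ⟨v (Ideal.Quotient.mk (I ^ l) 1 : A ⧸ I ^ l),
      ⟨l, fun a ha => smul_quotPow_hom_apply_one v ha⟩, ?_⟩
    have : v ≫ T.g = s • (quotPowMap I w ≫ t) := by
      rw [← cancel_epi (aug (res I l)), ← Category.assoc, hv, Preadditive.sub_comp,
        Category.assoc, T.zero, Limits.comp_zero, sub_zero, Linear.smul_comp, Category.assoc, ← ht,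
        reassoc_of% comm, Linear.comp_smul]
    exact congr($this (Ideal.Quotient.mk (I ^ l) 1 : A ⧸ I ^ l))
  · rintro ⟨e, ⟨l, hl⟩, he⟩
    obtain ⟨v, hv⟩ := exists_quotPow_hom (I := I) (k := max k l) e
      fun a ha => hl a (Ideal.pow_le_pow_right (le_max_right k l) ha)
    have w : k ≤ max k l := le_max_left k l
    have comm := ProjectiveResolution.lift_commutes_zero (quotPowMap I w) (res I _) (res I k)
    set Φ := ProjectiveResolution.lift (quotPowMap I w) (res I _) (res I k)
    have comm' : Φ.f 0 ≫ aug (res I k) = aug (res I _) ≫ quotPowMap I w := comm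
    have h₁ : v ≫ T.g = s • (quotPowMap I w ≫ t) :=
      quotPow_hom_ext ((congrArg T.g hv).trans he)
    obtain ⟨q, hq⟩ := exists_lift hT (s • (Φ.f 0 ≫ g) - aug (res I _) ≫ v) (by
      rw [Preadditive.sub_comp, Category.assoc, h₁, Linear.smul_comp, Category.assoc, ← ht,
        reassoc_of% comm', Linear.comp_smul, sub_self])
    refine ⟨_, w, Φ, comm, 0, q, ?_⟩
    rw [← cancel_mono T.f, Category.assoc, hq, Preadditive.comp_sub, Linear.comp_smul,
      ← HomologicalComplex.Hom.comm_assoc, hg, reassoc_of% (d_comp_aug (res I (max k l))),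
      Limits.zero_comp, sub_zero, Linear.smul_comp, Category.assoc]

end DimensionShift

section Injective

variable {E : Type} [AddCommGroup E] [Module A E] [Module.Injective A E]

lemma exists_comp_eq_of_ker_le {N P : Type} [AddCommGroup N] [Module A N] [AddCommGroup P]
    [Module A P] (p : N →ₗ[A] P) (q : N →ₗ[A] E) (h : p.ker ≤ q.ker) :
    ∃ r : P →ₗ[A] E, ∀ n, r (p n) = q n := by
  obtain ⟨r, hr⟩ := Module.Injective.out (p.ker.liftQ p le_rfl)
    (LinearMap.ker_eq_bot.1 (Submodule.ker_liftQ_eq_bot _ _ _ le_rfl)) (p.ker.liftQ q h)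
  exact ⟨r, fun n => hr (Submodule.Quotient.mk n)⟩

variable [IsNoetherianRing A]

lemma exists_pow_add_smul_eq (x : A) (n : ℕ) (e : E) :
    ∃ (m : ℕ) (e' : E), x ^ (n + m) • e' = x ^ m • e := by
  obtain ⟨m, hm⟩ := monotone_stabilizes_iff_noetherian.2 (inferInstance : IsNoetherian A A)
    ⟨fun i => LinearMap.ker (LinearMap.toSpanSingleton A A (x ^ i)), by
      intro i j hij a ha
      rw [LinearMap.mem_ker, LinearMap.toSpanSingleton_apply, smul_eq_mul] at ha ⊢
      rw [← Nat.add_sub_cancel' hij, pow_add, ← mul_assoc, ha, zero_mul]⟩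
  obtain ⟨r, hr⟩ := exists_comp_eq_of_ker_le (LinearMap.toSpanSingleton A A (x ^ (n + m)))
    (LinearMap.toSpanSingleton A E (x ^ m • e)) fun a ha => by
      have := (hm (n + m) (Nat.le_add_left _ _)).symm.le ha
      change a • x ^ m = 0 at this
      rw [LinearMap.mem_ker, LinearMap.toSpanSingleton_apply, ← smul_assoc, this, zero_smul]
  refine ⟨m, r 1, ?_⟩
  have := hr 1
  simp only [LinearMap.toSpanSingleton_apply, one_smul] at this
  rw [← this, ← map_smul, smul_eq_mul, mul_one]

/-- The first local cohomology of an injective module with respect to `(x, y)` vanishes. -/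
lemma exists_pow_smul_eq_of_smul_eq_smul {x y : A} {U V : E} (h : y • U = x • V) :
    ∃ (m : ℕ) (e : E), x ^ (1 + m) • e = x ^ m • U ∧ y ^ (1 + m) • e = y ^ m • V := by
  let J : Ideal A := Ideal.span {x, y}
  have hx : x ∈ J := Ideal.subset_span (by simp)
  have hy : y ∈ J := Ideal.subset_span (by simp)
  let κ : A × A →ₗ[A] A := (LinearMap.toSpanSingleton A A x).coprod
    (LinearMap.toSpanSingleton A A y)
  let ψ : A × A →ₗ[A] E := (LinearMap.toSpanSingleton A E U).coprod
    (LinearMap.toSpanSingleton A E V)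
  have hψ : J • κ.ker ≤ ψ.ker := by
    rw [Submodule.smul_le]
    rintro r hr ⟨a, b⟩ hab
    replace hab : a * x + b * y = 0 := hab
    obtain ⟨c, d, rfl⟩ := Ideal.mem_span_pair.1 hr
    change ((c * x + d * y) * a) • U + ((c * x + d * y) * b) • V = 0
    have e₁ : ((c * x + d * y) * a) • U + ((c * x + d * y) * b) • V =
      (c * (a * x + b * y)) • U + (d * (a * x + b * y)) • V
        + (d * a - c * b) • (y • U - x • V) := by
      module
    rw [e₁, hab, h, sub_self]
    simp
  obtain ⟨k, hk⟩ := J.exists_pow_inf_eq_pow_smul κ.ker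
  set m := k + 1
  obtain ⟨r, hr⟩ := exists_comp_eq_of_ker_le (E := E)
    ((LinearMap.toSpanSingleton A A (x ^ (1 + m))).coprod
      (LinearMap.toSpanSingleton A A (y ^ (1 + m))))
    ((LinearMap.toSpanSingleton A E (x ^ m • U)).coprod
      (LinearMap.toSpanSingleton A E (y ^ m • V))) (by
      rintro ⟨a, b⟩ hab
      replace hab : a * x ^ (1 + m) + b * y ^ (1 + m) = 0 := hab
      have h₁ : (a * x ^ m, b * y ^ m) ∈ J ^ m • (⊤ : Submodule A (A × A)) ⊓ κ.ker := by
        refine ⟨?_, ?_⟩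
        · have : (a * x ^ m, b * y ^ m) = x ^ m • (a, (0 : A)) + y ^ m • ((0 : A), b) := by
            simp [mul_comm]
          rw [this]
          exact add_mem (Submodule.smul_mem_smul (Ideal.pow_mem_pow hx m) trivial)
            (Submodule.smul_mem_smul (Ideal.pow_mem_pow hy m) trivial)
        · change a * x ^ m * x + b * y ^ m * y = 0
          rw [← hab]
          ring
      rw [hk m (Nat.le_succ k), Nat.add_sub_cancel_left, pow_one] at h₁
      have h₂ : (a * x ^ m) • U + (b * y ^ m) • V = 0 :=
        hψ (Submodule.smul_mono le_rfl inf_le_right h₁)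
      change a • x ^ m • U + b • y ^ m • V = 0
      rw [← h₂, mul_smul, mul_smul])
  refine ⟨m, r 1, ?_, ?_⟩
  · have := hr (1, 0)
    simp only [LinearMap.coprod_apply, LinearMap.toSpanSingleton_apply, one_smul, zero_smul,
      add_zero] at this
    rw [← this, ← map_smul, smul_eq_mul, mul_one]
  · have := hr (0, 1)
    simp only [LinearMap.coprod_apply, LinearMap.toSpanSingleton_apply, one_smul, zero_smul,
      zero_add] at this
    rw [← this, ← map_smul, smul_eq_mul, mul_one]

end Injective

section Vanishing

/-- An embedding of `M` into an injective module, with its cokernel. -/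
noncomputable def embed (M : ModuleCat.{0} A) : ShortComplex (ModuleCat.{0} A) :=
  .mk (Injective.ι M) (Limits.cokernel.π (Injective.ι M)) (Limits.cokernel.condition _)

instance (M : ModuleCat.{0} A) : Injective (embed M).X₂ :=
  inferInstanceAs (Injective (Injective.under M))

instance (M : ModuleCat.{0} A) : Module.Injective A (embed M).X₂ :=
  have : Injective (ModuleCat.of A (embed M).X₂) := inferInstanceAs (Injective (embed M).X₂)
  Module.injective_module_of_injective_object A _

lemma embed_shortExact (M : ModuleCat.{0} A) : (embed M).ShortExact where
  exact := ShortComplex.exact_cokernel _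
  mono_f := inferInstanceAs (Mono (Injective.ι M))
  epi_g := inferInstanceAs (Epi (Limits.cokernel.π (Injective.ι M)))

/-- A condition on `M` that makes the second local cohomology with support in `(x, y)` vanish
after inverting `S`. -/
def Semidivisible (S : Submonoid A) (x y : A) (M : Type) [AddCommGroup M] [Module A M] : Prop :=
  ∀ (n : ℕ) (μ : M), ∃ (K : ℕ), ∃ s ∈ S, ∃ a b : M,
    (s * (x * y) ^ K) • μ = x ^ (K + n) • a + y ^ (K + n) • b

lemma exists_pow_smul_eq_zero {x y : A} {I : Ideal A} {s₀ : A} {N : ℕ}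
    (hI : ∀ a ∈ I ^ N, s₀ * a ∈ Ideal.span {x, y}) {Z : Type} [AddCommGroup Z] [Module A Z]
    {z : Z} {p : ℕ} (hx : x ^ p • z = 0) (hy : y ^ p • z = 0) :
    ∃ t, ∀ a ∈ I ^ (N * t), a • s₀ ^ t • z = 0 := by
  have h : Ideal.span {x, y} ≤ Ideal.radical (LinearMap.toSpanSingleton A Z z).ker := by
    rw [Ideal.span_le]
    rintro _ (rfl | rfl)
    exacts [⟨p, hx⟩, ⟨p, hy⟩]
  obtain ⟨t, ht⟩ := Ideal.exists_pow_le_of_le_radical_of_fg h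
    (Submodule.fg_span (Set.toFinite _))
  refine ⟨t, fun a ha => ?_⟩
  have h₁ : Ideal.span {s₀} * I ^ N ≤ Ideal.span {x, y} := by
    rw [Ideal.span_singleton_mul_le_iff]
    exact hI
  have h₂ : s₀ ^ t * a ∈ (Ideal.span {s₀} * I ^ N) ^ t := by
    rw [mul_pow, ← pow_mul, Ideal.span_singleton_pow]
    exact Ideal.mul_mem_mul (Ideal.mem_span_singleton_self _) ha
  have h₃ : (s₀ ^ t * a) • z = 0 := ht (Ideal.pow_right_mono h₁ t h₂)
  rw [← mul_smul, mul_comm, h₃]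

variable {S : Submonoid A} {I : Ideal A} {M : ModuleCat.{0} A}

lemma van_one_of_mem {s : A} (hs : s ∈ S) (hI : s ∈ I) : Van S I 1 M := by
  intro h
  obtain ⟨c, k, hk, hc⟩ := exists_smul_eq_zero_iff_one (embed_shortExact M) h
  refine ⟨s ^ k, pow_mem hs k, (hc _).2 ⟨0, ⟨0, fun a _ => smul_zero a⟩, ?_⟩⟩
  rw [hk _ (Ideal.pow_mem_pow hI k), map_zero]

lemma van_succ_of_mem {s : A} (hs : s ∈ S) (hI : s ∈ I) (j : ℕ) : Van S I (j + 1) M := by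
  induction j generalizing M with
  | zero => exact van_one_of_mem hs hI
  | succ j ih => exact ih.succ (embed_shortExact M)

lemma exact_embed : Function.Exact (embed M).f.hom (embed M).g.hom :=
  (ShortComplex.ShortExact.moduleCat_exact_iff_function_exact _).1 (embed_shortExact M).exact

variable [IsNoetherianRing A] {x y : A}

lemma exists_torsion_lift {M E C E' C' : Type} [AddCommGroup M] [Module A M] [AddCommGroup E]
    [Module A E] [AddCommGroup C] [Module A C] [AddCommGroup E'] [Module A E'] [AddCommGroup C']
    [Module A C'] [Module.Injective A E] {f : M →ₗ[A] E} {g : E →ₗ[A] C} {f' : C →ₗ[A] E'}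
    {g' : E' →ₗ[A] C'} (h : Function.Exact f g) (h' : Function.Exact f' g')
    (hg : Function.Surjective g) (hf' : Function.Injective f') (hg' : Function.Surjective g')
    (hx : x ∈ I) (hy : y ∈ I) {s₀ : A} (hs₀ : s₀ ∈ S) {N : ℕ}
    (hI : ∀ a ∈ I ^ N, s₀ * a ∈ Ideal.span {x, y}) (hM : Semidivisible S x y M) {c : C'} {k : ℕ}
    (hk : ∀ a ∈ I ^ k, a • c = 0) :
    ∃ s ∈ S, ∃ e : E', (∃ l : ℕ, ∀ a ∈ I ^ l, a • e = 0) ∧ g' e = s • c := by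
  obtain ⟨e', rfl⟩ := hg' c
  obtain ⟨u, hu⟩ := (h' (x ^ k • e')).1 (by rw [map_smul]; exact hk _ (Ideal.pow_mem_pow hx k))
  obtain ⟨v, hv⟩ := (h' (y ^ k • e')).1 (by rw [map_smul]; exact hk _ (Ideal.pow_mem_pow hy k))
  obtain ⟨u, rfl⟩ := hg u
  obtain ⟨v, rfl⟩ := hg v
  obtain ⟨μ, hμ⟩ := (h (y ^ k • u - x ^ k • v)).1 (hf' (by
    rw [map_sub, map_smul, map_smul, map_sub, map_smul, map_smul, hu, hv, map_zero, smul_comm,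
      sub_self]))
  obtain ⟨K, s, hs, a, b, hab⟩ := hM k μ
  replace hab := congrArg f hab
  rw [map_smul, hμ, map_add, map_smul, map_smul] at hab
  obtain ⟨m, e, he₁, he₂⟩ := exists_pow_smul_eq_of_smul_eq_smul (x := x ^ (K + k))
    (y := y ^ (K + k)) (U := (x ^ K * s) • u - f b) (V := (y ^ K * s) • v + f a) (by
    rw [← sub_eq_zero, ← sub_eq_zero.2 hab]
    simp only [pow_add, mul_pow]
    module)
  replace he₁ := congrArg (fun z => f' (g z)) he₁
  replace he₂ := congrArg (fun z => f' (g z)) he₂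
  simp only [map_smul, map_sub, map_add, h.apply_apply_eq_zero, sub_zero, add_zero, hu, hv]
    at he₁ he₂
  obtain ⟨t, ht⟩ := exists_pow_smul_eq_zero (z := s • e' - f' (g e)) (p := (K + k) * (1 + m)) hI
    (by
      rw [smul_sub, pow_mul, he₁, sub_eq_zero]
      simp only [pow_add]
      module)
    (by
      rw [smul_sub, pow_mul, he₂, sub_eq_zero]
      simp only [pow_add]
      module)
  refine ⟨s₀ ^ t * s, mul_mem (pow_mem hs₀ t) hs, s₀ ^ t • (s • e' - f' (g e)), ⟨_, ht⟩, ?_⟩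
  rw [map_smul, map_sub, map_smul, h'.apply_apply_eq_zero, sub_zero, mul_smul]

lemma van_two (hx : x ∈ I) (hy : y ∈ I) {s₀ : A} (hs₀ : s₀ ∈ S) {N : ℕ}
    (hI : ∀ a ∈ I ^ N, s₀ * a ∈ Ideal.span {x, y}) (hM : Semidivisible S x y M) :
    Van S I 2 M := by
  refine Van.succ (embed_shortExact M) fun h => ?_
  have hE := embed_shortExact (embed M).X₃
  obtain ⟨c, k, hk, hc⟩ := exists_smul_eq_zero_iff_one hE h
  obtain ⟨s, hs, e, he⟩ := exists_torsion_lift (exact_embed (M := M))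
    (exact_embed (M := (embed M).X₃))
    (embed_shortExact M).moduleCat_surjective_g hE.moduleCat_injective_f
    hE.moduleCat_surjective_g hx hy hs₀ hI hM hk
  exact ⟨s, hs, (hc s).2 ⟨e, he⟩⟩

lemma semidivisible_embed : Semidivisible S x y (embed M).X₃ := by
  intro n c
  obtain ⟨e, rfl⟩ := (embed_shortExact M).moduleCat_surjective_g c
  obtain ⟨m, e', he⟩ := exists_pow_add_smul_eq x n e
  refine ⟨m, 1, one_mem _, y ^ m • (embed M).g e', 0, ?_⟩
  have := congrArg (embed M).g he
  rw [map_smul, map_smul] at this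
  rw [smul_zero, add_zero, one_mul, smul_comm, add_comm m n, this, mul_pow, mul_comm, mul_smul]

lemma van_add_three (hx : x ∈ I) (hy : y ∈ I) {s₀ : A} (hs₀ : s₀ ∈ S) {N : ℕ}
    (hI : ∀ a ∈ I ^ N, s₀ * a ∈ Ideal.span {x, y}) (j : ℕ) : Van S I (j + 3) M := by
  induction j generalizing M with
  | zero => exact (van_two hx hy hs₀ hI semidivisible_embed).succ (embed_shortExact M)
  | succ j ih => exact ih.succ (embed_shortExact M)

end Vanishing

section PrimeAvoidance

variable [IsNoetherianRing A]

/-- An element of `I` lies only in those minimal primes of `J` that contain `I`. -/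
lemma exists_mem_forall_minimalPrimes (I J : Ideal A) :
    ∃ x ∈ I, ∀ q ∈ J.minimalPrimes, x ∈ q → I ≤ q := by
  by_contra! h
  have hfin : {q ∈ J.minimalPrimes | ¬ I ≤ q}.Finite :=
    J.finite_minimalPrimes_of_isNoetherianRing.subset (Set.sep_subset _ _)
  obtain ⟨q, hq, hIq⟩ := (I.subset_union_prime_finite hfin (f := id) 0 0
    fun q hq _ _ => hq.1.1.1).1 fun x hx => by
      obtain ⟨q, hq, hxq, hIq⟩ := h x hx
      exact Set.mem_biUnion (x := q) ⟨hq, hIq⟩ hxq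
  exact hq.2 hIq

lemma height_le_of_lt {p q : Ideal A} [p.IsPrime] [q.IsPrime] (h : q < p) {n : ℕ∞}
    (hp : p.height ≤ n + 1) : q.height ≤ n :=
  Order.le_of_lt_add_one ((Ideal.height_strict_mono_of_isPrime_of_isPrime h).trans_le hp)

/-- There are `x, y ∈ I` such that `(x)` and `(x, y)` agree with `I` up to radical at the primes of
height `0` and of height at most `1`. -/
lemma exists_pair (I : Ideal A) : ∃ x ∈ I, ∃ y ∈ I,
    (∀ q : Ideal A, q.IsPrime → q.height ≤ 0 → x ∈ q → I ≤ q) ∧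
      ∀ q : Ideal A, q.IsPrime → q.height ≤ 1 → x ∈ q → y ∈ q → I ≤ q := by
  obtain ⟨x, hxI, hx⟩ := exists_mem_forall_minimalPrimes I ⊥
  obtain ⟨y, hyI, hy⟩ := exists_mem_forall_minimalPrimes I (Ideal.span {x})
  have h₀ : ∀ q : Ideal A, q.IsPrime → q.height ≤ 0 → x ∈ q → I ≤ q := fun q hq hq0 hxq =>
    hx q (Ideal.height_eq_zero_iff.1 (nonpos_iff_eq_zero.1 hq0)) hxq
  refine ⟨x, hxI, y, hyI, h₀, fun q hq hq1 hxq hyq => ?_⟩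
  obtain ⟨q', hq', hle⟩ := Ideal.exists_minimalPrimes_le
    (show Ideal.span {x} ≤ q by rwa [Ideal.span_singleton_le_iff_mem])
  have := hq'.1.1
  have hxq' : x ∈ q' := hq'.1.2 (Ideal.mem_span_singleton_self x)
  rcases hle.eq_or_lt with rfl | hlt
  · exact hy q' hq' hyq
  · exact (h₀ q' this (height_le_of_lt hlt (by simpa using hq1)) hxq').trans hle

lemma exists_mul_pow_le {p : Ideal A} [p.IsPrime] (I J : Ideal A)
    (h : ∀ q : Ideal A, q.IsPrime → q ≤ p → J ≤ q → I ≤ q) :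
    ∃ s ∈ p.primeCompl, ∃ N : ℕ, ∀ a ∈ I ^ N, s * a ∈ J := by
  induction I, IsNoetherian.noetherian I using Submodule.fg_induction with
  | singleton a =>
    by_contra! hJ
    obtain ⟨q, hq, hJq, hd⟩ := J.exists_le_prime_disjoint (p.primeCompl ⊔ Submonoid.powers a) (by
      rw [Set.disjoint_left]
      rintro _ hzJ hz
      obtain ⟨s, hs, _, ⟨N, rfl⟩, rfl⟩ := Submonoid.mem_sup.1 hz
      obtain ⟨b, hb, hsb⟩ := hJ s hs N
      change b ∈ Ideal.span {a} ^ N at hb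
      rw [Ideal.span_singleton_pow, Ideal.mem_span_singleton] at hb
      obtain ⟨c, rfl⟩ := hb
      exact hsb (by rw [← mul_assoc]; exact J.mul_mem_right c hzJ))
    rw [Set.disjoint_left] at hd
    refine hd (h q hq (fun z hz => ?_) hJq (Submodule.mem_span_singleton_self a))
      (Submonoid.mem_sup_right (Submonoid.mem_powers a))
    by_contra hzp
    exact hd hz (Submonoid.mem_sup_left hzp)
  | sup I₁ I₂ _ _ h₁ h₂ =>
    obtain ⟨s, hs, N, hN⟩ := h₁ fun q hq hqp hJ => le_sup_left.trans (h q hq hqp hJ)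
    obtain ⟨t, ht, N', hN'⟩ := h₂ fun q hq hqp hJ => le_sup_right.trans (h q hq hqp hJ)
    refine ⟨s * t, mul_mem hs ht, N + N', fun a ha => ?_⟩
    obtain ⟨b, hb, c, hc, rfl⟩ := Submodule.mem_sup.1 (Ideal.sup_pow_add_le_pow_sup_pow ha)
    rw [show s * t * (b + c) = t * (s * b) + s * (t * c) by ring]
    exact add_mem (J.mul_mem_left _ (hN b hb)) (J.mul_mem_left _ (hN' c hc))

end PrimeAvoidance

section MonomialIdeal

/-- The elements `s` with `s * (x * y) ^ m ∈ (x ^ (m + 1), y ^ (m + 1))` for some `m`. -/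
def monomialIdeal (x y : A) : Ideal A where
  carrier := {s | ∃ (m : ℕ) (a b : A), s * (x * y) ^ m = a * x ^ (m + 1) + b * y ^ (m + 1)}
  zero_mem' := ⟨0, 0, 0, by simp⟩
  add_mem' := by
    rintro s t ⟨m, a, b, h⟩ ⟨n, c, d, h'⟩
    refine ⟨m + n, a * y ^ n + c * y ^ m, b * x ^ n + d * x ^ m, ?_⟩
    rw [mul_pow] at h h'
    linear_combination (x ^ n * y ^ n) * h + (x ^ m * y ^ m) * h'
  smul_mem' := by
    rintro r s ⟨m, a, b, h⟩
    refine ⟨m, r * a, r * b, ?_⟩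
    rw [smul_eq_mul, mul_assoc, h]
    ring

lemma left_mem_monomialIdeal (x y : A) : x ∈ monomialIdeal x y := ⟨0, 1, 0, by ring⟩

lemma right_mem_monomialIdeal (x y : A) : y ∈ monomialIdeal x y := ⟨0, 0, 1, by ring⟩

lemma exists_pow_mul_eq {x y s : A} (h : s ∈ monomialIdeal x y) (n : ℕ) :
    ∃ (K : ℕ) (a b : A), s ^ (2 * n) * (x * y) ^ K = a * x ^ (K + n) + b * y ^ (K + n) := by
  obtain ⟨m, a, b, h⟩ := h
  refine ⟨2 * n * m, ?_⟩
  suffices s ^ (2 * n) * (x * y) ^ (2 * n * m) ∈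
      Ideal.span {x ^ (2 * n * m + n), y ^ (2 * n * m + n)} by
    obtain ⟨c, d, hcd⟩ := Ideal.mem_span_pair.1 this
    exact ⟨c, d, hcd.symm⟩
  rw [show s ^ (2 * n) * (x * y) ^ (2 * n * m) = (s * (x * y) ^ m) ^ (2 * n) by ring, h, add_pow]
  refine Ideal.sum_mem _ fun i hi => Ideal.mul_mem_right _ _ ?_
  replace hi : i ≤ 2 * n := Nat.lt_succ_iff.1 (Finset.mem_range.1 hi)
  obtain ⟨k, hk⟩ := Nat.exists_eq_add_of_le hi
  have hk' : 2 * n - i = k := by omega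
  rw [hk', hk]
  rcases le_total n i with hni | hni
  · obtain ⟨r, rfl⟩ := Nat.exists_eq_add_of_le hni
    rw [show b * y ^ (m + 1) = x ^ m * (s * y ^ m - x * a) by
      rw [mul_pow] at h
      linear_combination -h]
    refine Ideal.mem_of_dvd _ (Dvd.intro (a ^ (n + r) * x ^ r * (s * y ^ m - x * a) ^ k) ?_)
      (Ideal.subset_span (Set.mem_insert _ _))
    generalize s * y ^ m - x * a = t
    ring
  · obtain ⟨r, rfl⟩ : ∃ r, k = n + r := Nat.exists_eq_add_of_le (by omega)
    rw [show a * x ^ (m + 1) = y ^ m * (s * x ^ m - y * b) by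
      rw [mul_pow] at h
      linear_combination -h]
    refine Ideal.mem_of_dvd _ (Dvd.intro (b ^ (n + r) * y ^ r * (s * x ^ m - y * b) ^ i) ?_)
      (Ideal.subset_span (Set.mem_insert_of_mem _ rfl))
    generalize s * x ^ m - y * b = t
    ring

lemma not_monomialIdeal_le {x y s : A} {q : Ideal A} [q.IsPrime] {I : Ideal A} {N : ℕ}
    (hs : s ∈ q.primeCompl) (h : ∀ a ∈ I ^ N, s * a ∈ Ideal.span {x}) (hy : y ∈ I) :
    ¬ monomialIdeal x y ≤ q := by
  intro hle
  obtain ⟨a, ha⟩ := Ideal.mem_span_singleton'.1 (h _ (Ideal.pow_mem_pow hy N))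
  exact hs (hle ⟨N, a, 0, by rw [mul_pow, mul_comm (x ^ N), ← mul_assoc, ← ha]; ring⟩)

end MonomialIdeal

section Torsion

/-- The `I`-torsion submodule. -/
def torsion (I : Ideal A) (M : Type) [AddCommGroup M] [Module A M] : Submodule A M where
  carrier := {m | ∃ l : ℕ, ∀ a ∈ I ^ l, a • m = 0}
  zero_mem' := ⟨0, fun a _ => smul_zero a⟩
  add_mem' := by
    rintro m m' ⟨l, h⟩ ⟨l', h'⟩
    refine ⟨l + l', fun a ha => ?_⟩
    rw [smul_add, h a (Ideal.pow_le_pow_right (Nat.le_add_right _ _) ha),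
      h' a (Ideal.pow_le_pow_right (Nat.le_add_left _ _) ha), add_zero]
  smul_mem' := by
    rintro r m ⟨l, h⟩
    exact ⟨l, fun a ha => by rw [smul_comm, h a ha, smul_zero]⟩

variable {I : Ideal A} {M E C : Type} [AddCommGroup M] [Module A M] [AddCommGroup E] [Module A E]
  [AddCommGroup C] [Module A C]

lemma map_mem_torsion (f : M →ₗ[A] E) {m : M} (h : m ∈ torsion I M) : f m ∈ torsion I E := by
  obtain ⟨l, h⟩ := h
  exact ⟨l, fun a ha => by rw [← map_smul, h a ha, map_zero]⟩

lemma mem_torsion_of_map_mem {f : M →ₗ[A] E} (hf : Function.Injective f) {m : M}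
    (h : f m ∈ torsion I E) : m ∈ torsion I M := by
  obtain ⟨l, h⟩ := h
  exact ⟨l, fun a ha => hf (by rw [map_smul, h a ha, map_zero])⟩

variable [IsNoetherianRing A]

lemma mem_torsion_of_forall_smul_mem {m : M} {n : ℕ} (h : ∀ a ∈ I ^ n, a • m ∈ torsion I M) :
    m ∈ torsion I M := by
  have : I ≤ Ideal.radical (LinearMap.toSpanSingleton A M m).ker := by
    intro a ha
    obtain ⟨l, hl⟩ := h _ (Ideal.pow_mem_pow ha n)
    refine ⟨l + n, ?_⟩
    change a ^ (l + n) • m = 0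
    rw [pow_add, mul_smul, hl _ (Ideal.pow_mem_pow ha l)]
  obtain ⟨l, hl⟩ := Ideal.exists_pow_le_of_le_radical_of_fg this (IsNoetherian.noetherian I)
  exact ⟨l, fun a ha => hl ha⟩

lemma mem_associatedPrimes_iff {p : Ideal A} :
    p ∈ associatedPrimes A M ↔ p.IsPrime ∧ ∃ m : M, ∀ s, s ∈ p ↔ s • m = 0 := by
  rw [AssociatedPrimes.mem_iff, isAssociatedPrime_iff]
  refine and_congr_right fun _ => exists_congr fun m => ?_
  rw [Ideal.ext_iff]
  simp [Submodule.mem_colon_singleton]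

variable [Module.Finite A M]

variable (I M) in
lemma exists_regular_mod_torsion :
    ∃ x ∈ I, ∀ m : M, x • m ∈ torsion I M → m ∈ torsion I M := by
  by_contra! h
  obtain ⟨p, hp, hIp⟩ := (I.subset_union_prime_finite
    (associatedPrimes.finite A (M ⧸ torsion I M)) (f := id) 0 0 fun q hq _ _ => hq.1).1 (by
      intro x hx
      obtain ⟨m, hm, hm'⟩ := h x hx
      simp only [id]
      rw [biUnion_associatedPrimes_eq_zero_divisors]
      refine ⟨Submodule.Quotient.mk m, by rwa [Ne, Submodule.Quotient.mk_eq_zero], ?_⟩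
      rwa [← Submodule.Quotient.mk_smul, Submodule.Quotient.mk_eq_zero])
  obtain ⟨hp', m, hm⟩ := mem_associatedPrimes_iff.1 hp
  obtain ⟨m, rfl⟩ := Submodule.Quotient.mk_surjective _ m
  refine hp'.ne_top ((Ideal.eq_top_iff_one _).2 ((hm 1).2 ?_))
  rw [one_smul, Submodule.Quotient.mk_eq_zero]
  refine mem_torsion_of_forall_smul_mem (n := 1) fun a ha => ?_
  rw [← Submodule.Quotient.mk_eq_zero, Submodule.Quotient.mk_smul]
  exact (hm a).1 (hIp (by rwa [pow_one] at ha))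

omit [Module.Finite A M] in
lemma mem_associatedPrimes_of_forall_mem_iff {f : M →ₗ[A] E} {g : E →ₗ[A] C}
    (hf : Function.Injective f) (h : Function.Exact f g) {x : A} (hxI : x ∈ I)
    (hx : ∀ m : M, x • m ∈ torsion I M → m ∈ torsion I M) {p : Ideal A} (hp : p.IsPrime)
    {e : E} {k : ℕ} (hk : ∀ a ∈ I ^ k, a • g e = 0)
    (hpe : ∀ s, s ∈ p ↔ ∃ e' ∈ torsion I E, g e' = s • g e) :
    p ∈ associatedPrimes A (M ⧸ (torsion I M ⊔ LinearMap.range (LinearMap.lsmul A M x))) := by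
  have hxp : x ∈ p := hp.mem_of_pow_mem k
    ((hpe _).2 ⟨0, zero_mem _, by rw [map_zero, hk _ (Ideal.pow_mem_pow hxI k)]⟩)
  obtain ⟨γ, hγ, hγx⟩ := (hpe x).1 hxp
  obtain ⟨m, hm⟩ := (h (x • e - γ)).1 (by rw [map_sub, map_smul, hγx, sub_self])
  refine mem_associatedPrimes_iff.2 ⟨hp, Submodule.Quotient.mk m, fun s => ?_⟩
  rw [← Submodule.Quotient.mk_smul, Submodule.Quotient.mk_eq_zero, Submodule.mem_sup, hpe]
  constructor
  · rintro ⟨γ', hγ', hs⟩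
    obtain ⟨m', hm'⟩ := (h (s • e - γ')).1 (by rw [map_sub, map_smul, hs, sub_self])
    refine ⟨s • m - x • m', mem_torsion_of_map_mem hf ?_, x • m', ⟨m', rfl⟩, sub_add_cancel _ _⟩
    rw [map_sub, map_smul, map_smul, hm, hm']
    rw [show s • (x • e - γ) - x • (s • e - γ') = x • γ' - s • γ by module]
    exact sub_mem (Submodule.smul_mem _ _ hγ') (Submodule.smul_mem _ _ hγ)
  · rintro ⟨γ', hγ', _, ⟨m', rfl⟩, hs⟩
    refine ⟨s • e - f m', mem_torsion_of_forall_smul_mem (n := k) fun a ha => ?_, ?_⟩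
    · obtain ⟨m'', hm''⟩ := (h (a • (s • e - f m'))).1 (by
        rw [map_smul, map_sub, h.apply_apply_eq_zero, sub_zero, map_smul, smul_comm, hk a ha,
          smul_zero])
      rw [← hm'']
      refine map_mem_torsion f (hx _ (mem_torsion_of_map_mem hf ?_))
      rw [map_smul, hm'']
      have hfs := congrArg f hs
      rw [map_add, map_smul, hm, LinearMap.lsmul_apply, map_smul] at hfs
      rw [show x • a • (s • e - f m') =
          (a * s) • γ + a • f γ' - a • (f γ' + x • f m' - s • (x • e - γ)) by module, hfs,
        sub_self, smul_zero, sub_zero]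
      exact add_mem (Submodule.smul_mem _ _ hγ) (Submodule.smul_mem _ _ (map_mem_torsion f hγ'))
    · rw [map_sub, h.apply_apply_eq_zero, sub_zero, map_smul]

end Torsion

section Finiteness

variable [IsNoetherianRing A] {I : Ideal A} {M : ModuleCat.{0} A}

lemma Van.not_mem_associatedPrimes {j : ℕ} {p : Ideal A} [p.IsPrime]
    (h : Van p.primeCompl I j M) : p ∉ associatedPrimes A ((localCohomology I j).obj M) := by
  intro hp
  obtain ⟨-, m, hm⟩ := mem_associatedPrimes_iff.1 hp
  obtain ⟨s, hs, hsm⟩ := h m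
  exact hs ((hm s).2 hsm)

lemma associatedPrimes_zero_finite [Module.Finite A M] :
    (associatedPrimes A ((localCohomology I 0).obj M)).Finite := by
  refine (associatedPrimes.finite A M).subset fun p hp => ?_
  obtain ⟨hp, h, hh⟩ := mem_associatedPrimes_iff.1 hp
  obtain ⟨m, hm⟩ := exists_smul_eq_zero_iff_zero h
  exact mem_associatedPrimes_iff.2 ⟨hp, m, fun s => (hh s).trans (hm s)⟩

lemma associatedPrimes_one_finite [Module.Finite A M] :
    (associatedPrimes A ((localCohomology I 1).obj M)).Finite := by
  obtain ⟨x, hxI, hx⟩ := exists_regular_mod_torsion I M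
  refine (associatedPrimes.finite A (M ⧸ (torsion I M ⊔
    LinearMap.range (LinearMap.lsmul A M x)))).subset fun p hp => ?_
  obtain ⟨hp, h, hh⟩ := mem_associatedPrimes_iff.1 hp
  obtain ⟨c, k, hk, hc⟩ := exists_smul_eq_zero_iff_one (embed_shortExact M) h
  obtain ⟨e, rfl⟩ := (embed_shortExact M).moduleCat_surjective_g c
  exact mem_associatedPrimes_of_forall_mem_iff (M := M)
    (embed_shortExact M).moduleCat_injective_f exact_embed hxI hx hp hk fun s => (hh s).trans (hc s)

lemma exists_mul_pow_le_span_pair {x y : A}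
    (hxy : ∀ q : Ideal A, q.IsPrime → q.height ≤ 1 → x ∈ q → y ∈ q → I ≤ q)
    {p : Ideal A} [p.IsPrime] (hIp : I ≤ p) (hht : p.height ≤ 2) :
    ∃ s ∈ p.primeCompl, ∃ N : ℕ, ∀ a ∈ I ^ N, s * a ∈ Ideal.span {x, y} := by
  refine exists_mul_pow_le I _ fun q hq hqp hJ => ?_
  rcases hqp.eq_or_lt with rfl | hlt
  · exact hIp
  · exact hxy q hq (height_le_of_lt hlt (hht.trans_eq one_add_one_eq_two.symm))
      (hJ (Ideal.subset_span (Set.mem_insert _ _)))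
      (hJ (Ideal.subset_span (Set.mem_insert_of_mem _ rfl)))

/-- Away from the primes of height at least three, only the minimal primes of the monomial ideal
can be associated primes of the second local cohomology module. -/
lemma mem_minimalPrimes_of_mem_associatedPrimes_two {x y : A} (hxI : x ∈ I) (hyI : y ∈ I)
    (hx : ∀ q : Ideal A, q.IsPrime → q.height ≤ 0 → x ∈ q → I ≤ q)
    (hxy : ∀ q : Ideal A, q.IsPrime → q.height ≤ 1 → x ∈ q → y ∈ q → I ≤ q)
    {p : Ideal A} (hp : p ∈ associatedPrimes A ((localCohomology I 2).obj M))
    (hht : p.height ≤ 2) : p ∈ (monomialIdeal x y).minimalPrimes := by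
  have := hp.1
  have hIp : I ≤ p := by
    by_contra! h
    obtain ⟨s, hsI, hsp⟩ := SetLike.not_le_iff_exists.1 h
    exact (van_succ_of_mem (M := M) (S := p.primeCompl) hsp hsI 1).not_mem_associatedPrimes hp
  have hle : monomialIdeal x y ≤ p := by
    by_contra! h
    obtain ⟨t, ht, htp⟩ := SetLike.not_le_iff_exists.1 h
    obtain ⟨s, hs, N, hN⟩ := exists_mul_pow_le_span_pair hxy hIp hht
    refine (van_two (M := M) hxI hyI hs hN fun n μ => ?_).not_mem_associatedPrimes hp
    obtain ⟨K, a, b, hab⟩ := exists_pow_mul_eq ht n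
    refine ⟨K, t ^ (2 * n), pow_mem (S := p.primeCompl) htp _, a • μ, b • μ, ?_⟩
    rw [hab]
    module
  obtain ⟨q, hq, hqp⟩ := Ideal.exists_minimalPrimes_le hle
  have hq' := hq.1.1
  rcases hqp.eq_or_lt with rfl | hlt
  · exact hq
  have hq1 : q.height ≤ 1 := height_le_of_lt hlt (hht.trans_eq one_add_one_eq_two.symm)
  have hIq : I ≤ q := hxy q hq' hq1 (hq.1.2 (left_mem_monomialIdeal x y))
    (hq.1.2 (right_mem_monomialIdeal x y))
  obtain ⟨s, hs, N, hN⟩ := exists_mul_pow_le (p := q) I (Ideal.span {x}) fun r hr hrq hxr => by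
    rcases hrq.eq_or_lt with rfl | hlt'
    · exact hIq
    · exact hx r hr (height_le_of_lt hlt' (by simpa using hq1))
        (hxr (Ideal.mem_span_singleton_self x))
  exact absurd hq.1.2 (not_monomialIdeal_le hs hN hyI)

lemma van_add_three_primeCompl {x y : A} (hxI : x ∈ I) (hyI : y ∈ I)
    (hxy : ∀ q : Ideal A, q.IsPrime → q.height ≤ 1 → x ∈ q → y ∈ q → I ≤ q)
    {p : Ideal A} [p.IsPrime] (hht : p.height ≤ 2) (j : ℕ) : Van p.primeCompl I (j + 3) M := by
  by_cases hIp : I ≤ p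
  · obtain ⟨s, hs, N, hN⟩ := exists_mul_pow_le_span_pair hxy hIp hht
    exact van_add_three hxI hyI hs hN j
  · obtain ⟨s, hsI, hsp⟩ := SetLike.not_le_iff_exists.1 hIp
    exact van_succ_of_mem hsp hsI (j + 2)

end Finiteness

end localCohomology

/-- **Marley.** Let `(A, 𝔪)` be a Noetherian local ring with `dim A ≤ 3`.  Then for every ideal
`I`, every finitely generated `A`-module `M` and every `j`, the set of associated primes of
`H^j_I(M)` is finite. -/
theorem marley_finiteness_ass_primes
    (A : Type) [CommRing A] [IsNoetherianRing A] [IsLocalRing A]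
    (hdim : ringKrullDim A ≤ (3 : WithBot ℕ∞))
    (I : Ideal A) (M : Type) [AddCommGroup M] [Module A M] [Module.Finite A M]
    (j : ℕ) :
    (associatedPrimes A ((localCohomology I j).obj (ModuleCat.of A M))).Finite := by
  obtain ⟨x, hxI, y, hyI, hx, hxy⟩ := localCohomology.exists_pair I
  have hht : ∀ p : Ideal A, p.IsPrime → p ≠ IsLocalRing.maximalIdeal A → p.height ≤ 2 := by
    intro p hp hpm
    refine localCohomology.height_le_of_lt (q := p) (p := IsLocalRing.maximalIdeal A)
      (lt_of_le_of_ne (IsLocalRing.le_maximalIdeal hp.ne_top) hpm) ?_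
    rw [← WithBot.coe_le_coe, IsLocalRing.maximalIdeal_height_eq_ringKrullDim]
    rw [two_add_one_eq_three]
    exact hdim
  match j with
  | 0 => exact localCohomology.associatedPrimes_zero_finite
  | 1 =>
    have : Module.Finite A (ModuleCat.of A M) := ‹Module.Finite A M›
    exact localCohomology.associatedPrimes_one_finite
  | 2 =>
    refine (((localCohomology.monomialIdeal x y).finite_minimalPrimes_of_isNoetherianRing).insert
      (IsLocalRing.maximalIdeal A)).subset fun p hp => ?_
    by_cases hpm : p = IsLocalRing.maximalIdeal A
    · exact Or.inl hpm
    · exact Or.inr (localCohomology.mem_minimalPrimes_of_mem_associatedPrimes_two hxI hyI hx hxy hp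
        (hht p hp.1 hpm))
  | j + 3 =>
    refine (Set.finite_singleton (IsLocalRing.maximalIdeal A)).subset fun p hp => ?_
    by_contra hpm
    have := hp.1
    exact (localCohomology.van_add_three_primeCompl hxI hyI hxy (hht p hp.1 hpm)
      j).not_mem_associatedPrimes hp
end

section
/- (Hartshorne–Speiser, Lyubeznik) Let (A,m) be a commutative Noetherian local ring of prime characteristic p, let M be an Artinian A-module, and let f : M → M be a Frobenius action, i.e., an additive map with f(a z) = a^p f(z) for all a ∈ A and z ∈ M. If every element z ∈ M is f-nilpotent (for each z there exists t with f^t(z) = 0), then f is nilpotent on M: there is a single integer t with f^t(M) = 0. -/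
open IsLocalRing

/-- In a Noetherian local ring, a decreasing chain of ideals containing an ideal over which the
maximal ideal is minimal is eventually constant. -/
theorem Ideal.exists_eq_of_antitone_of_maximalIdeal_mem_minimalPrimes {R : Type*} [CommRing R]
    [IsNoetherianRing R] [IsLocalRing R] {I : Ideal R}
    (hI : maximalIdeal R ∈ I.minimalPrimes) {J : ℕ → Ideal R} (hJ : Antitone J)
    (hIJ : ∀ n, I ≤ J n) : ∃ n, ∀ m, n ≤ m → J n = J m := by
  have hart : IsArtinianRing (R ⧸ I) :=
    IsLocalRing.quotient_artinian_of_mem_minimalPrimes_of_isLocalRing I hI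
  obtain ⟨n, hn⟩ := IsArtinian.monotone_stabilizes
    (⟨fun n => OrderDual.toDual ((J n).map (Ideal.Quotient.mk I)),
      fun a b hab => Ideal.map_mono (hJ hab)⟩ : ℕ →o (Submodule (R ⧸ I) (R ⧸ I))ᵒᵈ)
  refine ⟨n, fun m hm => ?_⟩
  have h : (J n).map (Ideal.Quotient.mk I) = (J m).map (Ideal.Quotient.mk I) := hn m hm
  have key : ∀ k, ((J k).map (Ideal.Quotient.mk I)).comap (Ideal.Quotient.mk I) = J k := fun k => by
    rw [Ideal.comap_map_of_surjective' _ Ideal.Quotient.mk_surjective, Ideal.mk_ker,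
      sup_eq_left.mpr (hIJ k)]
  rw [← key n, h, key m]

theorem IsLocalRing.maximalIdeal_mem_minimalPrimes_pow {R : Type*} [CommRing R] [IsLocalRing R]
    {n : ℕ} (hn : n ≠ 0) : maximalIdeal R ∈ (maximalIdeal R ^ n).minimalPrimes :=
  ⟨⟨inferInstance, Ideal.pow_le_self hn⟩, fun _ hq _ => hq.1.le_of_pow_le hq.2⟩

/-- A decreasing chain of ideals all containing `C` is eventually constant locally at a minimal
prime `P` of `C`. -/
theorem Ideal.exists_mul_mem_of_antitone_of_mem_minimalPrimes {R : Type*} [CommRing R]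
    [IsNoetherianRing R] {C P : Ideal R} (hP : P ∈ C.minimalPrimes) {J : ℕ → Ideal R}
    (hJ : Antitone J) (hCJ : ∀ n, C ≤ J n) :
    ∃ t₀, ∀ t, t₀ ≤ t → ∃ s ∉ P, ∀ x ∈ J t, s * x ∈ J (t + 1) := by
  have hprime : P.IsPrime := hP.1.1
  have hmin : maximalIdeal (Localization.AtPrime P) ∈
      (C.map (algebraMap R (Localization.AtPrime P))).minimalPrimes := by
    rw [IsLocalization.minimalPrimes_map P.primeCompl]
    simpa [IsLocalization.AtPrime.under_maximalIdeal (Localization.AtPrime P) P] using hP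
  obtain ⟨t₀, ht₀⟩ := Ideal.exists_eq_of_antitone_of_maximalIdeal_mem_minimalPrimes hmin
    (J := fun n => (J n).map (algebraMap R (Localization.AtPrime P)))
    (fun a b hab => Ideal.map_mono (hJ hab)) (fun n => Ideal.map_mono (hCJ n))
  refine ⟨t₀, fun t ht => ?_⟩
  have heq := (ht₀ t ht).symm.trans (ht₀ (t + 1) (by omega))
  have hone : ∀ x ∈ J t, ∃ s ∉ P, s * x ∈ J (t + 1) := by
    intro x hx
    have hx' := Ideal.mem_map_of_mem (algebraMap R (Localization.AtPrime P)) hx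
    rw [heq, IsLocalization.algebraMap_mem_map_algebraMap_iff P.primeCompl] at hx'
    exact hx'
  suffices H : ∀ K : Ideal R, K.FG → K ≤ J t → ∃ s ∉ P, ∀ x ∈ K, s * x ∈ J (t + 1) from
    H (J t) (IsNoetherian.noetherian _) le_rfl
  intro K hK
  induction K, hK using Submodule.fg_induction with
  | singleton x =>
    intro hx
    obtain ⟨s, hs, hsx⟩ := hone x (hx (Submodule.mem_span_singleton_self x))
    refine ⟨s, hs, fun y hy => ?_⟩
    obtain ⟨c, rfl⟩ := Submodule.mem_span_singleton.mp hy
    rw [smul_eq_mul, mul_left_comm]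
    exact Ideal.mul_mem_left _ _ hsx
  | sup K₁ K₂ _ _ h₁ h₂ =>
    intro hK
    obtain ⟨s₁, hs₁, h₁⟩ := h₁ (le_sup_left.trans hK)
    obtain ⟨s₂, hs₂, h₂⟩ := h₂ (le_sup_right.trans hK)
    refine ⟨s₁ * s₂, fun h => (hprime.mem_or_mem h).elim hs₁ hs₂, fun x hx => ?_⟩
    obtain ⟨a, ha, b, hb, rfl⟩ := Submodule.mem_sup.mp hx
    rw [mul_add]
    refine add_mem ?_ ?_
    · rw [mul_comm s₁, mul_assoc]; exact Ideal.mul_mem_left _ _ (h₁ a ha)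
    · rw [mul_assoc]; exact Ideal.mul_mem_left _ _ (h₂ b hb)

/-- Every element of an Artinian module over a Noetherian local ring is killed by a power of the
maximal ideal. -/
theorem IsArtinian.exists_maximalIdeal_pow_smul_eq_zero {R M : Type*} [CommRing R]
    [IsNoetherianRing R] [IsLocalRing R] [AddCommGroup M] [Module R M] [IsArtinian R M] (z : M) :
    ∃ n, ∀ r ∈ maximalIdeal R ^ n, r • z = 0 := by
  let S : ℕ → Submodule R M := fun n => maximalIdeal R ^ n • (R ∙ z)
  have hS : Antitone S := fun a b hab => Submodule.smul_mono_left (Ideal.pow_le_pow_right hab)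
  obtain ⟨n, hn⟩ := IsArtinian.monotone_stabilizes
    (⟨fun n => OrderDual.toDual (S n), fun a b hab => hS hab⟩ : ℕ →o (Submodule R M)ᵒᵈ)
  have h : S n = S (n + 1) := hn (n + 1) (by omega)
  have hbot : S n = ⊥ := by
    refine Submodule.eq_bot_of_le_smul_of_le_jacobson_bot (maximalIdeal R) (S n) ?_ ?_
      (IsLocalRing.maximalIdeal_le_jacobson _)
    · exact Submodule.FG.smul (IsNoetherian.noetherian _) (Submodule.fg_span_singleton z)
    · conv_lhs => rw [h]
      simp only [S]
      rw [pow_succ', mul_smul]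
  refine ⟨n, fun r hr => ?_⟩
  have : r • z ∈ S n := Submodule.smul_mem_smul hr (Submodule.mem_span_singleton_self z)
  rwa [hbot, Submodule.mem_bot] at this

/-- **Chevalley's lemma** for a decreasing chain of ideals in a complete Noetherian local ring. -/
theorem Ideal.exists_le_iInf_sup_maximalIdeal_pow {R : Type*} [CommRing R] [IsNoetherianRing R]
    [IsLocalRing R] [IsPrecomplete (maximalIdeal R) R] {J : ℕ → Ideal R} (hJ : Antitone J)
    (j : ℕ) : ∃ n, J n ≤ (⨅ i, J i) ⊔ maximalIdeal R ^ j := by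
  set m := maximalIdeal R
  have hstab : ∀ i, ∃ s, ∀ n, s ≤ n → J s ⊔ m ^ i = J n ⊔ m ^ i := by
    intro i
    rcases eq_or_ne i 0 with rfl | hi
    · exact ⟨0, by simp⟩
    · exact Ideal.exists_eq_of_antitone_of_maximalIdeal_mem_minimalPrimes
        (IsLocalRing.maximalIdeal_mem_minimalPrimes_pow hi)
        (J := fun n => J n ⊔ m ^ i)
        (fun a b hab => sup_le_sup_right (hJ hab) _) fun n => le_sup_right
  choose s hs using hstab
  have hle : ∀ i n, J (s i) ≤ J n ⊔ m ^ i := by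
    intro i n
    rcases le_total (s i) n with h | h
    · rw [← hs i n h]; exact le_sup_left
    · exact (hJ h).trans le_sup_left
  refine ⟨s j, fun x hx => ?_⟩
  have hstep : ∀ i, ∀ y ∈ J (s i), ∃ y' ∈ J (s (i + 1)), y - y' ∈ m ^ i := by
    intro i y hy
    obtain ⟨a, ha, b, hb, rfl⟩ := Submodule.mem_sup.mp (hle i (s (i + 1)) hy)
    exact ⟨a, ha, by simpa using hb⟩
  choose! g hg hg' using hstep
  let y : ℕ → R := fun i => Nat.rec x (fun k z => g (j + k) z) i
  have hy : ∀ i, y i ∈ J (s (j + i)) := by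
    intro i
    induction i with
    | zero => exact hx
    | succ k ih => exact hg (j + k) _ ih
  have hyy : ∀ a b, a ≤ b → y a - y b ∈ m ^ (j + a) := by
    intro a b hab
    induction b, hab using Nat.le_induction with
    | base => simp
    | succ b hab ih =>
      have := (m ^ (j + a)).add_mem ih
        (Ideal.pow_le_pow_right (by omega) (hg' (j + b) _ (hy b)) : y b - y (b + 1) ∈ _)
      simpa using this
  obtain ⟨L, hL⟩ := IsPrecomplete.prec (I := m) (M := R) inferInstance (f := y) (by
    intro a b hab
    rw [SModEq.sub_mem, smul_eq_mul, Ideal.mul_top]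
    exact Ideal.pow_le_pow_right (by omega) (hyy a b hab))
  have hL' : ∀ a, y a - L ∈ m ^ (j + a) := by
    intro a
    have h := hL (j + a)
    rw [SModEq.sub_mem, smul_eq_mul, Ideal.mul_top] at h
    have := (m ^ (j + a)).add_mem (hyy a (j + a) (by omega)) h
    simpa using this
  have hLJ : L ∈ ⨅ i, J i := by
    rw [Submodule.mem_iInf]
    intro n
    rw [← Ideal.Quotient.eq_zero_iff_mem]
    refine IsHausdorff.haus (inferInstance : IsHausdorff m (R ⧸ J n)) _ fun i => ?_
    have h1 : L ∈ J n ⊔ m ^ i := by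
      have h2 : y i ∈ J n ⊔ m ^ i :=
        (sup_le_sup_left (Ideal.pow_le_pow_right (Nat.le_add_left i j)) (J n)) (hle (j + i) n (hy i))
      have h3 : y i - L ∈ J n ⊔ m ^ i :=
        Ideal.mem_sup_right (Ideal.pow_le_pow_right (by omega) (hL' i))
      simpa using sub_mem h2 h3
    obtain ⟨a, ha, b, hb, hab⟩ := Submodule.mem_sup.mp h1
    rw [SModEq.zero, ← hab, map_add, Ideal.Quotient.eq_zero_iff_mem.mpr ha, zero_add]
    have := Submodule.smul_mem_smul hb (Submodule.mem_top (x := (1 : R ⧸ J n)))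
    rwa [Algebra.smul_def, mul_one] at this
  have : x - L ∈ m ^ j := hL' 0
  simpa using Submodule.add_mem_sup hLJ this

section DoubleAnnihilator

variable {R Q : Type*} [CommRing R] [IsLocalRing R] [AddCommGroup Q] [Module R Q]

/-- Adding to a submodule with the double annihilator property an element of the socle of the
quotient preserves this property, in a module whose socle is generated by `u` and whose nonzero
submodules all contain `u`. -/
theorem Submodule.doubleAnnihilator_sup_span {u : Q}
    (hess : ∀ y : Q, y ≠ 0 → u ∈ R ∙ y)
    (hsoc : ∀ y : Q, (∀ r ∈ maximalIdeal R, r • y = 0) → y ∈ R ∙ u)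
    {N : Submodule R Q} (hN : ∀ z, (∀ r ∈ N.annihilator, r • z = 0) → z ∈ N) {w : Q}
    (hw : ∀ r ∈ maximalIdeal R, r • w ∈ N) (z : Q)
    (hz : ∀ r ∈ (N ⊔ R ∙ w).annihilator, r • z = 0) : z ∈ N ⊔ R ∙ w := by
  have hann : ∀ r, r ∈ N.annihilator → r • w = 0 → r ∈ (N ⊔ R ∙ w).annihilator := by
    intro r h1 h2
    rw [Submodule.mem_annihilator] at h1 ⊢
    intro y hy
    obtain ⟨a, ha, b, hb, rfl⟩ := Submodule.mem_sup.mp hy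
    obtain ⟨c, rfl⟩ := Submodule.mem_span_singleton.mp hb
    rw [smul_add, h1 a ha, smul_comm, h2]
    simp
  by_cases hwN : ∀ r ∈ N.annihilator, r • w = 0
  · exact Submodule.mem_sup_left (hN z fun r hr => hz r (hann r hr (hwN r hr)))
  push Not at hwN
  obtain ⟨r₀, hr₀, hrw₀⟩ := hwN
  obtain ⟨c₀, hc₀⟩ := Submodule.mem_span_singleton.mp (hess _ hrw₀)
  set r := c₀ * r₀ with hrdef
  have hr : r ∈ N.annihilator := Ideal.mul_mem_left _ _ hr₀
  have hrw : r • w = u := by rw [hrdef, mul_smul, hc₀]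
  have hmw : ∀ q ∈ N.annihilator, ∀ a ∈ maximalIdeal R, a • q • w = 0 := by
    intro q hq a ha
    rw [smul_comm]
    exact Submodule.mem_annihilator.mp hq _ (hw a ha)
  have hrz : r • z ∈ R ∙ u := by
    refine hsoc _ fun a ha => ?_
    rw [← mul_smul]
    refine hz _ (hann _ (Ideal.mul_mem_left _ _ hr) ?_)
    rw [mul_smul]; exact hmw r hr a ha
  obtain ⟨c, hc⟩ := Submodule.mem_span_singleton.mp hrz
  have hz' : z - c • w ∈ N := by
    refine hN _ fun q hq => ?_
    obtain ⟨d, hd⟩ := Submodule.mem_span_singleton.mp (hsoc (q • w) (hmw q hq))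
    have h := hz _ (hann (q - d * r) (sub_mem hq (Ideal.mul_mem_left _ _ hr))
      (by rw [sub_smul, mul_smul, hrw, hd, sub_self]))
    rw [sub_smul, mul_smul, sub_eq_zero, ← hc] at h
    rw [smul_sub, h, smul_comm q c w, ← hd, smul_comm d c u, sub_self]
  have := Submodule.add_mem_sup hz' (Submodule.smul_mem _ c (Submodule.mem_span_singleton_self w))
  simpa using this

variable [IsNoetherianRing R]

theorem Submodule.doubleAnnihilator_of_pow_smul_eq_zero {u : Q}
    (hess : ∀ y : Q, y ≠ 0 → u ∈ R ∙ y)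
    (hsoc : ∀ y : Q, (∀ r ∈ maximalIdeal R, r • y = 0) → y ∈ R ∙ u)
    {N : Submodule R Q} {n : ℕ} (hn : maximalIdeal R ^ n ≤ N.annihilator) (z : Q)
    (hz : ∀ r ∈ N.annihilator, r • z = 0) : z ∈ N := by
  rcases Nat.eq_zero_or_pos n with rfl | hpos
  · rw [← one_smul R z, hz 1 (hn (by simp))]; exact zero_mem N
  have hart : IsArtinianRing (R ⧸ maximalIdeal R ^ n) :=
    IsLocalRing.quotient_artinian_of_mem_minimalPrimes_of_isLocalRing _
      (IsLocalRing.maximalIdeal_mem_minimalPrimes_pow hpos.ne')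
  let 𝒮 : Set (Submodule R Q) :=
    {N' | N' ≤ N ∧ ∀ z, (∀ r ∈ N'.annihilator, r • z = 0) → z ∈ N'}
  have hbot : (⊥ : Submodule R Q) ∈ 𝒮 :=
    ⟨bot_le, fun z hz => by
      simpa using hz 1 (by rw [Submodule.annihilator_bot]; exact Submodule.mem_top)⟩
  obtain ⟨_, ⟨N', hN', rfl⟩, hmin⟩ := IsArtinian.set_has_minimal
    (Set.image (fun K : Submodule R Q =>
      K.annihilator.map (Ideal.Quotient.mk (maximalIdeal R ^ n))) 𝒮)
    ⟨_, ⊥, hbot, rfl⟩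
  have hcomap : ∀ K ≤ N, (K.annihilator.map (Ideal.Quotient.mk (maximalIdeal R ^ n))).comap
      (Ideal.Quotient.mk (maximalIdeal R ^ n)) = K.annihilator := fun K hK => by
    rw [Ideal.comap_map_of_surjective' _ Ideal.Quotient.mk_surjective, Ideal.mk_ker,
      sup_eq_left.mpr (hn.trans (Submodule.annihilator_mono hK))]
  suffices h : N' = N by rw [← h] at hz ⊢; exact hN'.2 z hz
  by_contra hne
  obtain ⟨y, hyN, hyN'⟩ := SetLike.exists_of_lt (lt_of_le_of_ne hN'.1 hne)
  have hex : ∃ k, ∀ r ∈ maximalIdeal R ^ k, r • y ∈ N' :=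
    ⟨n, fun r hr => by
      rw [Submodule.mem_annihilator.mp (hn hr) y hyN]; exact zero_mem N'⟩
  classical
  obtain ⟨k, hk⟩ : ∃ k, Nat.find hex = k + 1 := by
    refine Nat.exists_eq_succ_of_ne_zero fun h0 => hyN' ?_
    have := Nat.find_spec hex
    rw [h0] at this
    simpa using this 1 (by simp)
  have hk' := Nat.find_min hex (m := k) (by omega)
  push Not at hk'
  obtain ⟨r, hr, hrN'⟩ := hk'
  have hw : ∀ a ∈ maximalIdeal R, a • r • y ∈ N' := by
    intro a ha
    have := Nat.find_spec hex
    rw [hk] at this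
    rw [← mul_smul]
    exact this _ (by rw [pow_succ']; exact Ideal.mul_mem_mul ha hr)
  have hmem : N' ⊔ R ∙ (r • y) ∈ 𝒮 :=
    ⟨sup_le hN'.1 (by
      rw [Submodule.span_singleton_le_iff_mem]; exact N.smul_mem r hyN),
      Submodule.doubleAnnihilator_sup_span hess hsoc hN'.2 hw⟩
  have hann : (N' ⊔ R ∙ (r • y)).annihilator = N'.annihilator := by
    have hle := Submodule.annihilator_mono (le_sup_left : N' ≤ N' ⊔ R ∙ (r • y))
    have h := hmin _ ⟨_, hmem, rfl⟩
    rw [← hcomap _ hmem.1, ← hcomap _ hN'.1]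
    congr 1
    exact eq_of_le_of_not_lt (Ideal.map_mono hle) h
  refine hrN' (hN'.2 _ fun a ha => ?_)
  rw [← hann, Submodule.mem_annihilator] at ha
  exact ha _ (Submodule.mem_sup_right (Submodule.mem_span_singleton_self _))

/-- Over a complete Noetherian local ring, every submodule of a torsion module whose nonzero
submodules share a common nonzero element is the set of elements killed by its annihilator. -/
theorem Submodule.mem_of_annihilator_smul_eq_zero [IsPrecomplete (maximalIdeal R) R]
    (htors : ∀ z : Q, ∃ n, ∀ r ∈ maximalIdeal R ^ n, r • z = 0) {u : Q} (hu : u ≠ 0)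
    (hess : ∀ y : Q, y ≠ 0 → u ∈ R ∙ y) (N : Submodule R Q) (z : Q)
    (hz : ∀ r ∈ N.annihilator, r • z = 0) : z ∈ N := by
  have hmu : ∀ r ∈ maximalIdeal R, r • u = 0 := by
    intro r hr
    by_contra h
    obtain ⟨c, hc⟩ := Submodule.mem_span_singleton.mp (hess _ h)
    have hunit : IsUnit (1 - c * r) :=
      IsLocalRing.isUnit_one_sub_self_of_mem_nonunits _ (Ideal.mul_mem_left _ c hr)
    apply hu
    rw [← hunit.smul_eq_zero, sub_smul, one_smul, mul_smul, hc, sub_self]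
  have hsoc : ∀ y : Q, (∀ r ∈ maximalIdeal R, r • y = 0) → y ∈ R ∙ u := by
    intro y hy
    by_cases hy0 : y = 0
    · rw [hy0]; exact zero_mem _
    obtain ⟨c, hc⟩ := Submodule.mem_span_singleton.mp (hess y hy0)
    have hcu : IsUnit c := by
      by_contra hcu
      exact hu (by rw [← hc]; exact hy c hcu)
    obtain ⟨v, rfl⟩ := hcu
    exact Submodule.mem_span_singleton.mpr ⟨(↑v⁻¹ : R), by rw [← hc, ← mul_smul]; simp⟩
  let T : ℕ → Submodule R Q := fun n =>
    N ⊓ Submodule.torsionBySet R Q (maximalIdeal R ^ n : Ideal R)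
  have hT : Monotone T := fun a b hab => inf_le_inf_left _
    (Submodule.torsionBySet_le_torsionBySet_of_subset (Ideal.pow_le_pow_right hab))
  have hpow : ∀ n, maximalIdeal R ^ n ≤ (T n).annihilator := by
    intro n r hr
    rw [Submodule.mem_annihilator]
    intro y hy
    exact (Submodule.mem_torsionBySet_iff _ _).mp hy.2 ⟨r, hr⟩
  have hinf : ⨅ n, (T n).annihilator = N.annihilator := by
    rw [← Submodule.annihilator_iSup]
    congr 1
    refine le_antisymm (iSup_le fun _ => inf_le_left) fun y hy => ?_
    obtain ⟨n, hn⟩ := htors y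
    exact Submodule.mem_iSup_of_mem n
      ⟨hy, (Submodule.mem_torsionBySet_iff _ _).mpr fun r => hn r r.2⟩
  obtain ⟨j, hj⟩ := htors z
  obtain ⟨n, hn⟩ := Ideal.exists_le_iInf_sup_maximalIdeal_pow
    (J := fun n => (T n).annihilator) (fun a b hab => Submodule.annihilator_mono (hT hab)) j
  rw [hinf] at hn
  refine (inf_le_left : T n ≤ N)
    (Submodule.doubleAnnihilator_of_pow_smul_eq_zero hess hsoc (hpow n) z fun r hr => ?_)
  obtain ⟨a, ha, b, hb, rfl⟩ := Submodule.mem_sup.mp (hn hr)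
  rw [add_smul, hz a ha, hj b hb, add_zero]

end DoubleAnnihilator

section Chains

variable {R M : Type*} [CommRing R] [AddCommGroup M] [Module R M]

/-- Every increasing chain of submodules above `U` is eventually constant up to multipliers
outside `P`. -/
def Submodule.AlmostStabilizesAbove (U : Submodule R M) (P : Ideal R) : Prop :=
  ∀ N : ℕ → Submodule R M, Monotone N → (∀ t, U ≤ N t) →
    ∃ t₀, ∀ t, t₀ ≤ t → ∃ a ∉ P, ∀ z ∈ N (t + 1), a • z ∈ N t

theorem Submodule.AlmostStabilizesAbove.inf {P : Ideal R} [P.IsPrime] {U V : Submodule R M}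
    (hU : U.AlmostStabilizesAbove P) (hV : V.AlmostStabilizesAbove P) :
    (U ⊓ V).AlmostStabilizesAbove P := by
  intro N hN hle
  obtain ⟨t₁, h₁⟩ := hU (fun t => N t ⊔ U) (fun a b hab => sup_le_sup_right (hN hab) _)
    fun t => le_sup_right
  obtain ⟨t₂, h₂⟩ := hV (fun t => N t ⊓ U ⊔ V)
    (fun a b hab => sup_le_sup_right (inf_le_inf_right _ (hN hab)) _) fun t => le_sup_right
  refine ⟨max t₁ t₂, fun t ht => ?_⟩
  obtain ⟨a, ha, haN⟩ := h₁ t (le_trans (le_max_left _ _) ht)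
  obtain ⟨b, hb, hbN⟩ := h₂ t (le_trans (le_max_right _ _) ht)
  refine ⟨b * a, fun h => (‹P.IsPrime›.mem_or_mem h).elim hb ha, fun z hz => ?_⟩
  obtain ⟨x, hx, y, hy, hxy⟩ := Submodule.mem_sup.mp (haN z (Submodule.mem_sup_left hz))
  have hyN : y ∈ N (t + 1) := by
    rw [← add_sub_cancel_left x y, hxy]
    exact sub_mem (Submodule.smul_mem _ _ hz) (hN (Nat.le_succ t) hx)
  obtain ⟨x', hx', y', hy', hxy'⟩ := Submodule.mem_sup.mp
    (hbN y (Submodule.mem_sup_left ⟨hyN, hy⟩))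
  have hy'N : y' ∈ N t := by
    refine hle t ⟨?_, hy'⟩
    rw [← add_sub_cancel_left x' y', hxy']
    exact sub_mem (Submodule.smul_mem _ _ hy) hx'.2
  rw [mul_smul, ← hxy, smul_add, ← hxy']
  exact add_mem (Submodule.smul_mem _ _ hx) (add_mem hx'.1 hy'N)

variable [IsNoetherianRing R] [IsLocalRing R] [IsPrecomplete (maximalIdeal R) R]

theorem Submodule.AlmostStabilizesAbove.of_maximal {C P : Ideal R} (hP : P ∈ C.minimalPrimes)
    (hC : ∀ r ∈ C, ∀ z : M, r • z = 0)
    (htors : ∀ z : M, ∃ n, ∀ r ∈ maximalIdeal R ^ n, r • z = 0)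
    {u : M} {V : Submodule R M} (hV : Maximal (fun W : Submodule R M => u ∉ W) V) :
    V.AlmostStabilizesAbove P := by
  intro N hN hle
  have hess : ∀ y : M ⧸ V, y ≠ 0 → V.mkQ u ∈ R ∙ y := by
    intro y hy
    obtain ⟨x, rfl⟩ := V.mkQ_surjective y
    have hx : x ∉ V := fun h => hy ((Submodule.Quotient.mk_eq_zero V).mpr h)
    have hux : u ∈ V ⊔ R ∙ x := by
      by_contra h
      exact hx (hV.le_of_ge h le_sup_left
        (Submodule.mem_sup_right (Submodule.mem_span_singleton_self x)))
    obtain ⟨v, hv, w, hw, rfl⟩ := Submodule.mem_sup.mp hux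
    obtain ⟨c, rfl⟩ := Submodule.mem_span_singleton.mp hw
    rw [map_add, show V.mkQ v = 0 from (Submodule.Quotient.mk_eq_zero V).mpr hv, zero_add, map_smul]
    exact Submodule.smul_mem _ _ (Submodule.mem_span_singleton_self _)
  have hu : V.mkQ u ≠ 0 := fun h => hV.prop ((Submodule.Quotient.mk_eq_zero V).mp h)
  obtain ⟨t₀, ht₀⟩ := Ideal.exists_mul_mem_of_antitone_of_mem_minimalPrimes hP
    (J := fun t => V.colon (N t : Set M))
    (fun a b hab r hr => Submodule.mem_colon.mpr fun y hy =>
      Submodule.mem_colon.mp hr y (hN hab hy))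
    (fun t r hr => Submodule.mem_colon.mpr fun y _ => by rw [hC r hr y]; exact zero_mem V)
  refine ⟨t₀, fun t ht => ?_⟩
  obtain ⟨s, hs, hsJ⟩ := ht₀ t ht
  refine ⟨s, hs, fun z hz => ?_⟩
  have hmem : V.mkQ (s • z) ∈ (N t).map V.mkQ := by
    refine Submodule.mem_of_annihilator_smul_eq_zero (fun y => ?_) hu hess _ _ fun r hr => ?_
    · obtain ⟨x, rfl⟩ := V.mkQ_surjective y
      obtain ⟨n, hn⟩ := htors x
      exact ⟨n, fun r hr => by rw [← map_smul, hn r hr, map_zero]⟩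
    · have hrJ : r ∈ V.colon (N t : Set M) := Submodule.mem_colon.mpr fun y hy => by
        have := Submodule.mem_annihilator.mp hr _ (Submodule.mem_map_of_mem hy)
        rw [← map_smul] at this
        exact (Submodule.Quotient.mk_eq_zero V).mp this
      rw [← map_smul, ← mul_smul, mul_comm]
      exact (Submodule.Quotient.mk_eq_zero V).mpr (Submodule.mem_colon.mp (hsJ r hrJ) z hz)
  obtain ⟨y, hy, hyz⟩ := hmem
  have hsub : s • z - y ∈ V := (Submodule.Quotient.eq V).mp hyz.symm
  simpa using add_mem (hle t hsub) hy

/-- In an Artinian module over a complete Noetherian local ring killed by an ideal `C`, every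
increasing chain of submodules is eventually constant up to multipliers outside a given minimal
prime of `C`. -/
theorem IsArtinian.exists_smul_mem_of_monotone [IsArtinian R M] {C P : Ideal R}
    (hP : P ∈ C.minimalPrimes) (hC : ∀ r ∈ C, ∀ z : M, r • z = 0) {N : ℕ → Submodule R M}
    (hN : Monotone N) : ∃ t₀, ∀ t, t₀ ≤ t → ∃ a ∉ P, ∀ z ∈ N (t + 1), a • z ∈ N t := by
  have hprime : P.IsPrime := hP.1.1
  have htop : (⊤ : Submodule R M).AlmostStabilizesAbove P := fun N _ hle =>
    ⟨0, fun t _ => ⟨1, fun h => hprime.ne_top ((Ideal.eq_top_iff_one P).mpr h), fun z _ =>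
      hle t Submodule.mem_top⟩⟩
  obtain ⟨U, hU, hmin⟩ := IsArtinian.set_has_minimal
    {U : Submodule R M | U.AlmostStabilizesAbove P} ⟨⊤, htop⟩
  suffices h : U = ⊥ from hU N hN fun t => h ▸ bot_le
  by_contra hne
  obtain ⟨u, huU, hu⟩ := Submodule.exists_mem_ne_zero_of_ne_bot hne
  obtain ⟨V, -, hV⟩ := zorn_le_nonempty₀ {W : Submodule R M | u ∉ W}
    (fun c hc hchain W hW => ⟨sSup c, fun h => by
      obtain ⟨W', hW', huW'⟩ :=
        (Submodule.mem_sSup_of_directed ⟨W, hW⟩ hchain.directedOn).mp h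
      exact hc hW' huW', fun _ => le_sSup⟩) ⊥ (by simpa using hu)
  have hinf := hU.inf (Submodule.AlmostStabilizesAbove.of_maximal hP hC
    IsArtinian.exists_maximalIdeal_pow_smul_eq_zero hV)
  exact hmin _ hinf (lt_of_le_of_ne inf_le_left fun h => hV.prop (inf_eq_left.mp h huU))

end Chains

section Frobenius

variable {R M : Type*} [CommRing R] [AddCommGroup M] [Module R M]

theorem iterate_smul_of_frobenius {p : ℕ} {f : M →+ M}
    (hf : ∀ (r : R) (z : M), f (r • z) = r ^ p • f z) (t : ℕ) (r : R) (z : M) :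
    f^[t] (r • z) = r ^ p ^ t • f^[t] z := by
  induction t generalizing r z with
  | zero => simp
  | succ t ih => rw [Function.iterate_succ_apply, hf, ih, ← pow_mul, ← pow_succ',
      Function.iterate_succ_apply]

/-- The submodule of elements killed by the `t`-th iterate of a Frobenius action. -/
def frobeniusKer {p : ℕ} {f : M →+ M} (hf : ∀ (r : R) (z : M), f (r • z) = r ^ p • f z)
    (t : ℕ) : Submodule R M where
  carrier := {z | f^[t] z = 0}
  add_mem' {a b} ha hb := by
    simp only [Set.mem_ofPred_eq] at ha hb ⊢
    rw [iterate_map_add, ha, hb, add_zero]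
  zero_mem' := iterate_map_zero f t
  smul_mem' r z hz := by
    simp only [Set.mem_ofPred_eq] at hz ⊢
    rw [iterate_smul_of_frobenius hf, hz, smul_zero]

theorem mem_frobeniusKer {p : ℕ} {f : M →+ M}
    {hf : ∀ (r : R) (z : M), f (r • z) = r ^ p • f z} {t : ℕ} {z : M} :
    z ∈ frobeniusKer hf t ↔ f^[t] z = 0 := Iff.rfl

theorem frobeniusKer_monotone {p : ℕ} {f : M →+ M}
    (hf : ∀ (r : R) (z : M), f (r • z) = r ^ p • f z) : Monotone (frobeniusKer hf) := by
  refine monotone_nat_of_le_succ fun t z hz => ?_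
  rw [mem_frobeniusKer] at hz ⊢
  rw [Function.iterate_succ_apply', hz, map_zero]

variable [IsNoetherianRing R] [IsLocalRing R] [IsArtinian R M]

theorem exists_iterate_eq_zero_of_isPrecomplete [IsPrecomplete (maximalIdeal R) R] {p : ℕ}
    (hp : 2 ≤ p) {f : M →+ M} (hf : ∀ (r : R) (z : M), f (r • z) = r ^ p • f z)
    (hnil : ∀ z : M, ∃ t, f^[t] z = 0) : ∃ t, ∀ z : M, f^[t] z = 0 := by
  set N := frobeniusKer hf
  have hN : Monotone N := frobeniusKer_monotone hf
  let I : ℕ →o Ideal R := ⟨fun t => (N t).colon (N (t + 1) : Set M),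
    monotone_nat_of_le_succ fun t a ha => by
      rw [Submodule.mem_colon] at ha ⊢
      intro z hz
      have h : a • f z ∈ N t := ha (f z) (by
        rwa [SetLike.mem_coe, mem_frobeniusKer, Function.iterate_succ_apply] at hz)
      rw [mem_frobeniusKer, Function.iterate_succ_apply, hf, ← mem_frobeniusKer (hf := hf),

        show a ^ p = a ^ (p - 1) * a by rw [← pow_succ, Nat.sub_add_cancel (by omega)], mul_smul]
      exact Submodule.smul_mem _ _ h⟩
  obtain ⟨t₀, ht₀⟩ := monotone_stabilizes_iff_noetherian.mpr ‹IsNoetherianRing R› I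
  have hsq : ∀ a ∈ I t₀, ∀ t z, z ∈ N (t₀ + t) → a • a • z ∈ N t₀ := by
    intro a ha t
    induction t with
    | zero => exact fun z hz => Submodule.smul_mem _ _ (Submodule.smul_mem _ _ hz)
    | succ t ih =>
      intro z hz
      refine Submodule.mem_colon.mp ha _ ?_
      have h := ih (f z) (by rwa [← add_assoc, mem_frobeniusKer, Function.iterate_succ_apply] at hz)
      rw [SetLike.mem_coe, mem_frobeniusKer, Function.iterate_succ_apply, hf,
        ← mem_frobeniusKer (hf := hf), show a ^ p = a ^ (p - 2) * (a * a) by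
          rw [← pow_two, ← pow_add, Nat.sub_add_cancel hp],
        mul_smul, mul_smul]
      exact Submodule.smul_mem _ _ h
  have hall : ∀ z : M, ∃ t, z ∈ N (t₀ + t) := fun z =>
    let ⟨t, ht⟩ := hnil z
    ⟨t, hN (Nat.le_add_left t t₀) ht⟩
  by_cases hI : I t₀ = ⊤
  · refine ⟨t₀, fun z => ?_⟩
    obtain ⟨t, ht⟩ := hall z
    have h := hsq 1 ((Ideal.eq_top_iff_one _).mp hI) t z ht
    rwa [one_smul, one_smul] at h
  obtain ⟨P, hP⟩ := Ideal.nonempty_minimalPrimes hI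
  set C : Ideal R := (N t₀).colon (Set.univ : Set M)
  have hCI : C ≤ I t₀ := fun r hr => Submodule.mem_colon.mpr fun z _ =>
    Submodule.mem_colon.mp hr z (Set.mem_univ z)
  have hICrad : ∀ a ∈ I t₀, a ^ 2 ∈ C := fun a ha => Submodule.mem_colon.mpr fun z _ => by
    obtain ⟨t, ht⟩ := hall z
    rw [pow_two, mul_smul]
    exact hsq a ha t z ht
  have hPC : P ∈ C.minimalPrimes :=
    ⟨⟨hP.1.1, hCI.trans hP.1.2⟩, fun q hq hle =>
      hP.2 ⟨hq.1, fun a ha => hq.1.mem_of_pow_mem 2 (hq.2 (hICrad a ha))⟩ hle⟩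
  obtain ⟨t₁, ht₁⟩ := IsArtinian.exists_smul_mem_of_monotone (M := M ⧸ N t₀) hPC
    (fun r hr z => by
      obtain ⟨x, rfl⟩ := (N t₀).mkQ_surjective z
      rw [← map_smul]
      exact (Submodule.Quotient.mk_eq_zero _).mpr
        (Submodule.mem_colon.mp hr x (Set.mem_univ x)))
    (N := fun t => (N (t₀ + t)).map (N t₀).mkQ)
    fun a b hab => Submodule.map_mono (hN (by omega))
  obtain ⟨a, haP, ha⟩ := ht₁ t₁ le_rfl
  refine absurd (hP.1.2 ?_) haP
  rw [show I t₀ = I (t₀ + t₁) from ht₀ _ (by omega)]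
  refine Submodule.mem_colon.mpr fun z hz => ?_
  obtain ⟨y, hy, hyz⟩ := ha _ (Submodule.mem_map_of_mem (f := (N t₀).mkQ) hz)
  rw [← map_smul] at hyz
  have hsub : a • z - y ∈ N t₀ := (Submodule.Quotient.eq (N t₀)).mp hyz.symm
  simpa using add_mem (hN (Nat.le_add_right t₀ t₁) hsub) hy

end Frobenius

section Completion

open MvPolynomial (idealOfVars)

theorem MvPolynomial.aeval_mem_pow_of_mem_pow_idealOfVars {σ R : Type*} [CommRing R] {I : Ideal R}
    {x : σ → R} (hx : ∀ i, x i ∈ I) {n : ℕ} {q : MvPolynomial σ R}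
    (hq : q ∈ idealOfVars σ R ^ n) : MvPolynomial.aeval x q ∈ I ^ n := by
  have hle : (idealOfVars σ R).map (MvPolynomial.aeval x : MvPolynomial σ R →ₐ[R] R) ≤ I := by
    rw [MvPolynomial.idealOfVars, Ideal.map_span, Ideal.span_le]
    rintro _ ⟨_, ⟨i, rfl⟩, rfl⟩
    simpa using hx i
  have := Ideal.mem_map_of_mem (MvPolynomial.aeval x : MvPolynomial σ R →ₐ[R] R) hq
  rw [Ideal.map_pow] at this
  exact Ideal.pow_right_mono hle n this

/-- Evaluation of formal power series at elements of `I`, modulo `I ^ n`. -/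
noncomputable def MvPowerSeries.evalQuotientPow {σ R : Type*} [CommRing R] [Finite σ]
    {I : Ideal R} {x : σ → R} (hx : ∀ i, x i ∈ I) (n : ℕ) : MvPowerSeries σ R →+* R ⧸ I ^ n :=
  (Ideal.Quotient.lift (idealOfVars σ R ^ n)
    ((Ideal.Quotient.mk (I ^ n)).comp (MvPolynomial.aeval x : MvPolynomial σ R →ₐ[R] R).toRingHom)
    fun _ hq => Ideal.Quotient.eq_zero_iff_mem.mpr
      (MvPolynomial.aeval_mem_pow_of_mem_pow_idealOfVars hx hq)).comp
    (MvPowerSeries.truncTotalAlgHom σ R n).toRingHom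

theorem MvPowerSeries.factorPow_comp_evalQuotientPow {σ R : Type*} [CommRing R] [Finite σ]
    {I : Ideal R} {x : σ → R} (hx : ∀ i, x i ∈ I) {m n : ℕ} (hle : m ≤ n) :
    (Ideal.Quotient.factorPow I hle).comp (MvPowerSeries.evalQuotientPow hx n) =
      MvPowerSeries.evalQuotientPow hx m := by
  refine RingHom.ext fun q => Ideal.Quotient.eq.mpr ?_
  rw [← map_sub]
  exact MvPolynomial.aeval_mem_pow_of_mem_pow_idealOfVars hx
    (MvPowerSeries.truncTotal_sub_truncTotal_mem_pow_idealOfVars hle le_rfl q)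

/-- Evaluation of formal power series at elements of `I`, with values in the `I`-adic
completion. -/
noncomputable def MvPowerSeries.evalAdicCompletion {σ R : Type*} [CommRing R] [Finite σ]
    {I : Ideal R} {x : σ → R} (hx : ∀ i, x i ∈ I) : MvPowerSeries σ R →+* AdicCompletion I R :=
  AdicCompletion.liftRingHom I (MvPowerSeries.evalQuotientPow hx)
    (MvPowerSeries.factorPow_comp_evalQuotientPow hx)

theorem MvPowerSeries.evalₐ_evalAdicCompletion {σ R : Type*} [CommRing R] [Finite σ]
    {I : Ideal R} {x : σ → R} (hx : ∀ i, x i ∈ I) (n : ℕ) (q : MvPowerSeries σ R) :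
    AdicCompletion.evalₐ I n (MvPowerSeries.evalAdicCompletion hx q) =
      Ideal.Quotient.mk (I ^ n) (MvPolynomial.aeval x (q.truncTotal n)) :=
  AdicCompletion.evalₐ_liftRingHom I _ (MvPowerSeries.factorPow_comp_evalQuotientPow hx) n q

theorem MvPowerSeries.evalAdicCompletion_coe {σ R : Type*} [CommRing R] [Finite σ]
    {I : Ideal R} {x : σ → R} (hx : ∀ i, x i ∈ I) (q : MvPolynomial σ R) :
    MvPowerSeries.evalAdicCompletion hx (q : MvPowerSeries σ R) =
      algebraMap R (AdicCompletion I R) (MvPolynomial.aeval x q) := by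
  refine AdicCompletion.ext_evalₐ fun n => ?_
  have h : MvPowerSeries.truncTotal n (q : MvPowerSeries σ R) - q ∈ idealOfVars σ R ^ n :=
    Ideal.Quotient.eq.mp ((MvPowerSeries.truncTotalAlgHom σ R n).commutes q)
  rw [MvPowerSeries.evalₐ_evalAdicCompletion, AlgHom.commutes]
  refine Ideal.Quotient.eq.mpr ?_
  rw [← map_sub]
  exact MvPolynomial.aeval_mem_pow_of_mem_pow_idealOfVars hx h

/-- The adic completion of a Noetherian ring is Noetherian. -/
theorem AdicCompletion.isNoetherianRing_self {R : Type*} [CommRing R] [IsNoetherianRing R]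
    (I : Ideal R) : IsNoetherianRing (AdicCompletion I R) := by
  have hfg : I.FG := IsNoetherian.noetherian I
  obtain ⟨r, x, hx⟩ := Submodule.fg_iff_exists_fin_generating_family.mp hfg
  have hxI : ∀ i, x i ∈ I := fun i => hx ▸ Submodule.subset_span ⟨i, rfl⟩
  set φ := MvPowerSeries.evalAdicCompletion hxI
  have hmap : (Ideal.span (Set.range MvPowerSeries.X)).map φ =
      I.map (algebraMap R (AdicCompletion I R)) := by
    have hx' : I.map (algebraMap R (AdicCompletion I R)) =
        (Ideal.span (Set.range x)).map (algebraMap R (AdicCompletion I R)) :=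
      congrArg (Ideal.map _) hx.symm
    rw [hx', Ideal.map_span, Ideal.map_span, ← Set.range_comp, ← Set.range_comp]
    congr 2
    funext i
    have := MvPowerSeries.evalAdicCompletion_coe hxI (MvPolynomial.X i)
    simpa using this
  have hcomp := AdicCompletion.isAdicComplete_self I hfg
  rw [← hmap] at hcomp
  have hsurj : Function.Surjective φ := by
    refine surjective_of_mk_map_comp_surjective (I := Ideal.span (Set.range MvPowerSeries.X)) φ ?_
    intro y
    obtain ⟨y, rfl⟩ := Ideal.Quotient.mk_surjective y
    obtain ⟨a, ha⟩ := Ideal.Quotient.mk_surjective (AdicCompletion.evalOneₐ I y)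
    refine ⟨((MvPolynomial.C a : MvPolynomial (Fin r) R) : MvPowerSeries (Fin r) R), ?_⟩
    rw [RingHom.comp_apply, MvPowerSeries.evalAdicCompletion_coe, Ideal.Quotient.mk_eq_mk_iff_sub_mem,
      hmap, ← AdicCompletion.ker_evalOneₐ_eq_map I hfg]
    change AdicCompletion.evalOneₐ I _ = 0
    rw [map_sub, ← ha, AlgHom.commutes]
    simp
  exact isNoetherianRing_of_surjective _ _ φ hsurj

end Completion

section TorsionModule

variable {R M : Type*} [CommRing R] [AddCommGroup M] [Module R M] {I : Ideal R}

/-- The action of the `I`-adic completion on a module all of whose elements are killed by powers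
of `I`. -/
noncomputable def AdicCompletion.torsionSMul (h : ∀ z : M, ∃ n, ∀ r ∈ I ^ n, r • z = 0)
    (r : AdicCompletion I R) (z : M) : M :=
  (Ideal.Quotient.mk_surjective (AdicCompletion.evalₐ I (h z).choose r)).choose • z

theorem AdicCompletion.torsionSMul_eq (h : ∀ z : M, ∃ n, ∀ r ∈ I ^ n, r • z = 0)
    {r : AdicCompletion I R} {z : M} {n : ℕ} (hn : ∀ s ∈ I ^ n, s • z = 0) {a : R}
    (ha : Ideal.Quotient.mk (I ^ n) a = AdicCompletion.evalₐ I n r) :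
    AdicCompletion.torsionSMul h r z = a • z := by
  have hb := (Ideal.Quotient.mk_surjective (AdicCompletion.evalₐ I (h z).choose r)).choose_spec
  have hk := (h z).choose_spec
  rw [AdicCompletion.torsionSMul]
  set b := (Ideal.Quotient.mk_surjective (AdicCompletion.evalₐ I (h z).choose r)).choose
  set k := (h z).choose
  have hfac : ∀ {l i : ℕ} {c : R}, l ≤ i → Ideal.Quotient.mk (I ^ i) c =
      AdicCompletion.evalₐ I i r → Ideal.Quotient.mk (I ^ l) c = AdicCompletion.evalₐ I l r := by
    intro l i c hli hc
    obtain ⟨x, rfl⟩ := AdicCompletion.mk_surjective I R r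
    rw [AdicCompletion.evalₐ_mk] at hc ⊢
    exact (Ideal.Quotient.eq.mpr (Ideal.pow_le_pow_right hli (Ideal.Quotient.eq.mp hc))).trans
      (AdicCompletion.Ideal.mk_eq_mk I hli x)
  rw [← sub_eq_zero, ← sub_smul]
  rcases le_total k n with hkn | hnk
  · exact hk _ (Ideal.Quotient.eq.mp (hb.trans (hfac hkn ha).symm))
  · exact hn _ (Ideal.Quotient.eq.mp ((hfac hnk hb).trans ha.symm))

theorem AdicCompletion.exists_torsionSMul_eq (h : ∀ z : M, ∃ n, ∀ r ∈ I ^ n, r • z = 0)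
    (r : AdicCompletion I R) {z : M} {n : ℕ} (hn : ∀ s ∈ I ^ n, s • z = 0) :
    ∃ a, Ideal.Quotient.mk (I ^ n) a = AdicCompletion.evalₐ I n r ∧
      AdicCompletion.torsionSMul h r z = a • z :=
  let ⟨a, ha⟩ := Ideal.Quotient.mk_surjective (AdicCompletion.evalₐ I n r)
  ⟨a, ha, AdicCompletion.torsionSMul_eq h hn ha⟩

theorem Ideal.exists_pow_smul_eq_zero_pair (h : ∀ z : M, ∃ n, ∀ r ∈ I ^ n, r • z = 0) (y z : M) :
    ∃ n, (∀ r ∈ I ^ n, r • y = 0) ∧ ∀ r ∈ I ^ n, r • z = 0 :=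
  let ⟨k, hk⟩ := h y
  let ⟨l, hl⟩ := h z
  ⟨max k l, fun r hr => hk r (Ideal.pow_le_pow_right (le_max_left k l) hr),
    fun r hr => hl r (Ideal.pow_le_pow_right (le_max_right k l) hr)⟩

/-- A module all of whose elements are killed by powers of `I` is a module over the `I`-adic
completion. -/
noncomputable abbrev AdicCompletion.torsionModule
    (h : ∀ z : M, ∃ n, ∀ r ∈ I ^ n, r • z = 0) : Module (AdicCompletion I R) M where
  smul := AdicCompletion.torsionSMul h
  one_smul z := by
    obtain ⟨n, hn⟩ := h z
    exact (AdicCompletion.torsionSMul_eq h hn (a := 1) (by simp)).trans (one_smul R z)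
  mul_smul r s z := by
    obtain ⟨n, hn⟩ := h z
    obtain ⟨a, ha, -⟩ := AdicCompletion.exists_torsionSMul_eq h r hn
    obtain ⟨b, hb, hbz⟩ := AdicCompletion.exists_torsionSMul_eq h s hn
    have hbn : ∀ c ∈ I ^ n, c • b • z = 0 := fun c hc => by rw [smul_comm, hn c hc, smul_zero]
    change torsionSMul h (r * s) z = torsionSMul h r (torsionSMul h s z)
    rw [hbz, AdicCompletion.torsionSMul_eq h hbn ha, ← mul_smul]
    exact AdicCompletion.torsionSMul_eq h hn (by rw [map_mul, map_mul, ha, hb])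
  smul_zero r := smul_zero _
  zero_smul z := by
    obtain ⟨n, hn⟩ := h z
    exact (AdicCompletion.torsionSMul_eq h hn (a := 0) (by simp)).trans (zero_smul R z)
  smul_add r y z := by
    obtain ⟨n, hy, hz⟩ := Ideal.exists_pow_smul_eq_zero_pair h y z
    obtain ⟨a, ha, haz⟩ := AdicCompletion.exists_torsionSMul_eq h r hz
    have hyz : ∀ c ∈ I ^ n, c • (y + z) = 0 := fun c hc => by
      rw [smul_add, hy c hc, hz c hc, add_zero]
    change torsionSMul h r (y + z) = torsionSMul h r y + torsionSMul h r z
    rw [haz, AdicCompletion.torsionSMul_eq h hy ha, AdicCompletion.torsionSMul_eq h hyz ha,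
      smul_add]
  add_smul r s z := by
    obtain ⟨n, hn⟩ := h z
    obtain ⟨a, ha, haz⟩ := AdicCompletion.exists_torsionSMul_eq h r hn
    obtain ⟨b, hb, hbz⟩ := AdicCompletion.exists_torsionSMul_eq h s hn
    change torsionSMul h (r + s) z = torsionSMul h r z + torsionSMul h s z
    rw [haz, hbz, ← add_smul]
    exact AdicCompletion.torsionSMul_eq h hn (by rw [map_add, map_add, ha, hb])

theorem AdicCompletion.isScalarTower_torsionModule
    (h : ∀ z : M, ∃ n, ∀ r ∈ I ^ n, r • z = 0) :
    letI := AdicCompletion.torsionModule h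
    IsScalarTower R (AdicCompletion I R) M := by
  let := AdicCompletion.torsionModule h
  refine ⟨fun a r z => ?_⟩
  obtain ⟨n, hn⟩ := h z
  obtain ⟨b, hb, hbz⟩ := AdicCompletion.exists_torsionSMul_eq h r hn
  change torsionSMul h (a • r) z = a • torsionSMul h r z
  rw [hbz, ← mul_smul]
  exact AdicCompletion.torsionSMul_eq h hn (by rw [map_smul, ← hb, Algebra.smul_def, map_mul]; rfl)

theorem AdicCompletion.map_torsionSMul_of_frobenius
    (h : ∀ z : M, ∃ n, ∀ r ∈ I ^ n, r • z = 0) {p : ℕ} {f : M →+ M}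
    (hf : ∀ (r : R) (z : M), f (r • z) = r ^ p • f z) (r : AdicCompletion I R) (z : M) :
    f (AdicCompletion.torsionSMul h r z) = AdicCompletion.torsionSMul h (r ^ p) (f z) := by
  obtain ⟨n, hz, hfz⟩ := Ideal.exists_pow_smul_eq_zero_pair h z (f z)
  obtain ⟨a, ha, haz⟩ := AdicCompletion.exists_torsionSMul_eq h r hz
  rw [haz, hf]
  exact (AdicCompletion.torsionSMul_eq h hfz (by rw [map_pow, map_pow, ha])).symm

end TorsionModule

/-- **Hartshorne–Speiser, Lyubeznik.** Let `(A, 𝔪)` be a Noetherian local ring of prime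
characteristic `p`, `M` an Artinian `A`-module and `f : M → M` a Frobenius action (an additive
map with `f (a • z) = a^p • f z`).  If every element of `M` is killed by some iterate of `f`,
then some single iterate of `f` kills all of `M`. -/
theorem hartshorne_speiser_lyubeznik_nilpotency
    (A : Type) [CommRing A] [IsNoetherianRing A] [IsLocalRing A]
    (p : ℕ) (hp : p.Prime) [CharP A p]
    (M : Type) [AddCommGroup M] [Module A M] [IsArtinian A M]
    (f : M →+ M) (hf : ∀ (a : A) (z : M), f (a • z) = a ^ p • f z)
    (hnil : ∀ z : M, ∃ t : ℕ, (⇑f)^[t] z = 0) :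
    ∃ t : ℕ, ∀ z : M, (⇑f)^[t] z = 0 := by
  have htors : ∀ z : M, ∃ n, ∀ r ∈ maximalIdeal A ^ n, r • z = 0 :=
    IsArtinian.exists_maximalIdeal_pow_smul_eq_zero
  let := AdicCompletion.torsionModule htors
  have := AdicCompletion.isScalarTower_torsionModule htors
  have := AdicCompletion.isNoetherianRing_self (maximalIdeal A)
  have : IsArtinian (AdicCompletion (maximalIdeal A) A) M := isArtinian_of_tower A ‹_›
  exact exists_iterate_eq_zero_of_isPrecomplete (R := AdicCompletion (maximalIdeal A) A)
    hp.two_le (AdicCompletion.map_torsionSMul_of_frobenius htors hf) hnil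
end
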